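/- arXiv:1201.5842 — 4 statements merged into one kernel-verified Lean document; each statement's English description precedes it below -/
import Mathlib

section
/- Let p be the unique real number in (0,1) satisfying p³ = (1−p)². Then the Hausdorff dimension of Ξ_G equals −log₂ p. -/
open MeasureTheory

/-- The multiplicative golden mean shift: reals in `[0,1]` admitting a binary expansion
`x = ∑_{k≥1} x_k 2^{-k}` with digits in `{0,1}` satisfying `x_k * x_{2k} = 0` for all `k ≥ 1`. -/
def XiG : Set ℝ :=
  {x | ∃ a : ℕ → ℕ, (∀ k, 1 ≤ k → a k = 0 ∨ a k = 1) ∧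
    (∀ k, 1 ≤ k → a k * a (2 * k) = 0) ∧
    x = ∑' k : ℕ, (a (k + 1) : ℝ) / 2 ^ (k + 1)}

namespace MultGoldenMean

open Filter Topology ProbabilityTheory
open scoped ENNReal NNReal

/-- The digit at position `k / 2` if `k` is even, and `false` otherwise. -/
def parent (a : ℕ → Bool) (k : ℕ) : Bool := decide (k % 2 = 0) && a (k / 2)

/-- The digit sequences defining the multiplicative golden mean shift. -/
def Admissible (a : ℕ → Bool) : Prop := ∀ k, 1 ≤ k → (a k && a (2 * k)) = false

/-- The number of ones among the first `n` digits. -/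
noncomputable def onesCount (a : ℕ → Bool) (n : ℕ) : ℝ :=
  ∑ k ∈ Finset.range n, if a (k + 1) then 1 else 0

/-- The integer whose binary expansion is given by the first `n` digits. -/
def code (a : ℕ → Bool) : ℕ → ℕ
  | 0 => 0
  | n + 1 => 2 * code a n + (a (n + 1)).toNat

/-- The real number in `[0,1]` with the given binary digits. -/
noncomputable def binaryValue (a : ℕ → Bool) : ℝ :=
  ∑' k : ℕ, (if a (k + 1) then 1 else 0) / 2 ^ (k + 1)

/-- The exponent of `p` in the measure of the cylinder given by the first `n` digits. -/
noncomputable def cylinderExponent (a : ℕ → Bool) (n : ℕ) : ℝ :=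
  n + onesCount a n / 2 - onesCount a (n / 2)

/-- The admissible sequence produced from a sequence of independent coin tosses. -/
def golden (b : ℕ → Bool) : ℕ → Bool
  | 0 => false
  | k + 1 => b k && !(decide ((k + 1) % 2 = 0) && golden b ((k + 1) / 2))
decreasing_by omega

lemma golden_succ (b : ℕ → Bool) (k : ℕ) :
    golden b (k + 1) = (b k && !parent (golden b) (k + 1)) := by
  rw [golden, parent]

lemma Admissible.and_parent {a : ℕ → Bool} (ha : Admissible a) {k : ℕ} (hk : 1 ≤ k) :
    (a k && parent a k) = false := by
  unfold parent
  by_cases h : k % 2 = 0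
  · have h1 := ha (k / 2) (by omega)
    rw [show 2 * (k / 2) = k by omega] at h1
    simp only [h, decide_true, Bool.true_and]
    rwa [Bool.and_comm]
  · simp [h]

lemma admissible_golden (b : ℕ → Bool) : Admissible (golden b) := by
  intro k hk
  obtain ⟨j, hj⟩ : ∃ j, 2 * k = j + 1 := ⟨2 * k - 1, by omega⟩
  have h : parent (golden b) (j + 1) = golden b k := by
    simp [parent, ← hj]
  rw [hj, golden_succ, h]
  cases golden b k <;> simp

lemma parent_congr {a a' : ℕ → Bool} {k : ℕ} (hk : 1 ≤ k)
    (h : ∀ j, 1 ≤ j → j < k → a j = a' j) : parent a k = parent a' k := by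
  unfold parent
  by_cases h2 : k % 2 = 0
  · rw [h (k / 2) (by omega) (by omega)]
  · simp [h2]

lemma golden_congr {b b' : ℕ → Bool} {k : ℕ} (h : ∀ j, j < k → b j = b' j) :
    golden b k = golden b' k := by
  induction k using Nat.strong_induction_on with
  | _ k ih =>
    cases k with
    | zero => simp [golden]
    | succ k =>
      rw [golden_succ, golden_succ, h k (by omega)]
      rw [parent_congr (by omega) fun j _ hj => ih j hj fun i hi => h i (by omega)]

lemma sum_parent (a : ℕ → Bool) (n : ℕ) :
    ∑ k ∈ Finset.range n, (if parent a (k + 1) then (1 : ℝ) else 0) = onesCount a (n / 2) := by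
  induction n with
  | zero => simp [onesCount]
  | succ n ih =>
    rw [Finset.sum_range_succ, ih]
    by_cases h : (n + 1) % 2 = 0
    · have h1 : (n + 1) / 2 = n / 2 + 1 := by omega
      rw [h1, onesCount, onesCount, Finset.sum_range_succ, parent]
      simp [h, h1]
    · have h1 : (n + 1) / 2 = n / 2 := by omega
      simp [h1, parent, h]

lemma onesCount_nonneg (a : ℕ → Bool) (n : ℕ) : 0 ≤ onesCount a n :=
  Finset.sum_nonneg fun _ _ => by split_ifs <;> norm_num

lemma onesCount_le (a : ℕ → Bool) (n : ℕ) : onesCount a n ≤ n := by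
  calc onesCount a n ≤ ∑ _k ∈ Finset.range n, (1 : ℝ) :=
        Finset.sum_le_sum fun _ _ => by split_ifs <;> norm_num
    _ = n := by simp

lemma code_eq_iff {a a' : ℕ → Bool} {n : ℕ} :
    code a n = code a' n ↔ ∀ k < n, a (k + 1) = a' (k + 1) := by
  induction n with
  | zero => simp [code]
  | succ n ih =>
    rw [Nat.forall_lt_succ_right, ← ih, code, code]
    cases a (n + 1) <;> cases a' (n + 1) <;> simp <;> omega

lemma sum_eq_code (a : ℕ → Bool) (n : ℕ) :
    ∑ k ∈ Finset.range n, (if a (k + 1) then (1 : ℝ) else 0) / 2 ^ (k + 1) = code a n / 2 ^ n := by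
  induction n with
  | zero => simp [code]
  | succ n ih =>
    rw [Finset.sum_range_succ, ih, code]
    cases a (n + 1) <;> simp <;> field_simp <;> ring

lemma summable_digits (a : ℕ → Bool) :
    Summable fun k : ℕ => (if a (k + 1) then (1 : ℝ) else 0) / 2 ^ (k + 1) := by
  refine Summable.of_nonneg_of_le (fun k => by positivity) (fun k => ?_)
    (summable_geometric_two' 1)
  rw [pow_succ', div_div]
  gcongr
  split_ifs <;> norm_num

lemma binaryValue_mem (a : ℕ → Bool) (n : ℕ) :
    binaryValue a ∈ Set.Icc ((code a n : ℝ) / 2 ^ n) ((code a n + 1 : ℝ) / 2 ^ n) := by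
  have h := (summable_digits a).sum_add_tsum_nat_add n
  rw [sum_eq_code] at h
  have hg : ∀ k, (if a (k + n + 1) then (1 : ℝ) else 0) / 2 ^ (k + n + 1) ≤
      1 / 2 ^ n / 2 / 2 ^ k := by
    intro k
    rw [div_div, div_div, show (2 : ℝ) ^ n * (2 * 2 ^ k) = 2 ^ (k + n + 1) by ring]
    gcongr
    split_ifs <;> norm_num
  have h0 : 0 ≤ ∑' k, (if a (k + n + 1) then (1 : ℝ) else 0) / 2 ^ (k + n + 1) :=
    tsum_nonneg fun k => by positivity
  have h1 : ∑' k, (if a (k + n + 1) then (1 : ℝ) else 0) / 2 ^ (k + n + 1) ≤ 1 / 2 ^ n := by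
    rw [← tsum_geometric_two' (1 / 2 ^ n : ℝ)]
    exact Summable.tsum_le_tsum hg ((summable_nat_add_iff n).2 (summable_digits a))
      (summable_geometric_two' _)
  unfold binaryValue
  rw [add_div]
  constructor <;> linarith

lemma XiG_eq_image : XiG = binaryValue '' {a | Admissible a} := by
  ext x
  rw [XiG]
  rw [Set.mem_ofPred_eq]
  constructor
  · rintro ⟨a, h01, hadm, rfl⟩
    refine ⟨fun k => decide (a k = 1), fun k hk => ?_, ?_⟩
    · have := hadm k hk
      rcases h01 k hk with h | h <;> rcases h01 (2 * k) (by omega) with h' | h' <;> simp_all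
    · refine tsum_congr fun k => ?_
      rcases h01 (k + 1) (by omega) with h | h <;> simp [h]
  · rintro ⟨a, ha, rfl⟩
    refine ⟨fun k => (a k).toNat, fun k _ => ?_, fun k hk => ?_, ?_⟩
    · cases a k <;> simp
    · have := ha k hk
      cases h : a k <;> cases h' : a (2 * k) <;> simp_all
    · refine tsum_congr fun k => ?_
      cases h : a (k + 1) <;> simp [h]

lemma measurable_golden (k : ℕ) : Measurable fun b => golden b k := by
  induction k using Nat.strong_induction_on with
  | _ k ih =>
    cases k with
    | zero => simp only [golden]; exact measurable_const
    | succ k =>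
      simp only [golden]
      have h : Measurable fun b : ℕ → Bool => (b k, golden b ((k + 1) / 2)) :=
        (measurable_pi_apply k).prodMk (ih _ (by omega))
      exact (measurable_of_finite fun x : Bool × Bool =>
        x.1 && !(decide ((k + 1) % 2 = 0) && x.2)).comp h

lemma measurable_onesCount_golden (n : ℕ) : Measurable fun b => onesCount (golden b) n :=
  Finset.measurable_sum _ fun k _ =>
    (measurable_of_finite fun x : Bool => if x then (1 : ℝ) else 0).comp (measurable_golden (k + 1))

lemma measurable_code_golden (n : ℕ) : Measurable fun b => code (golden b) n := by
  induction n with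
  | zero => exact measurable_const
  | succ n ih =>
    exact (ih.const_mul 2).add ((measurable_of_finite Bool.toNat).comp (measurable_golden (n + 1)))

lemma measurable_binaryValue_golden : Measurable fun b => binaryValue (golden b) := by
  refine measurable_of_tendsto_metrizable (f := fun n b => (code (golden b) n : ℝ) / 2 ^ n)
    (fun n => ((measurable_of_countable (fun m : ℕ => (m : ℝ))).comp
      (measurable_code_golden n)).div_const _) ?_
  rw [tendsto_pi_nhds]
  intro b
  simp_rw [← sum_eq_code]
  exact (summable_digits (golden b)).hasSum.tendsto_sum_nat

/-- The difference between the number of ones among the first `n` digits and its conditional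
expectation. -/
noncomputable def deviation (q : ℝ) (b : ℕ → Bool) (n : ℕ) : ℝ :=
  onesCount (golden b) n - q * (n - onesCount (golden b) (n / 2))

lemma deviation_succ (q : ℝ) (b : ℕ → Bool) (n : ℕ) :
    deviation q b (n + 1) = deviation q b n +
      if parent (golden b) (n + 1) then 0 else (if b n then 1 else 0) - q := by
  unfold deviation
  rw [← sum_parent, ← sum_parent, onesCount, onesCount, Finset.sum_range_succ,
    Finset.sum_range_succ, golden_succ]
  cases b n <;> cases parent (golden b) (n + 1) <;> simp <;> ring

lemma measurable_deviation (q : ℝ) (n : ℕ) : Measurable fun b => deviation q b n :=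
  (measurable_onesCount_golden n).sub
    ((measurable_const.sub (measurable_onesCount_golden (n / 2))).const_mul q)

lemma onesCount_golden_congr {b b' : ℕ → Bool} {n m : ℕ} (hm : m ≤ n)
    (h : ∀ j < n, b j = b' j) : onesCount (golden b) m = onesCount (golden b') m := by
  refine Finset.sum_congr rfl fun k hk => ?_
  rw [Finset.mem_range] at hk
  rw [golden_congr fun j hj => h j (by omega)]

lemma deviation_congr (q : ℝ) {b b' : ℕ → Bool} {n : ℕ} (h : ∀ j < n, b j = b' j) :
    deviation q b n = deviation q b' n := by
  rw [deviation, deviation, onesCount_golden_congr le_rfl h,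
    onesCount_golden_congr (Nat.div_le_self n 2) h]

section Measure

variable (ν : Measure Bool) [IsProbabilityMeasure ν]

/-- The law of a sequence of independent coin tosses. -/
noncomputable abbrev coins : Measure (ℕ → Bool) := Measure.infinitePi fun _ => ν

lemma lintegral_coins_mul {n : ℕ} {f : (ℕ → Bool) → ℝ≥0∞}
    (hf : DependsOn f (Finset.range n : Set ℕ)) (g : Bool → ℝ≥0∞) :
    ∫⁻ b, f b * g (b n) ∂coins ν = (∫⁻ b, f b ∂coins ν) * ∫⁻ x, g x ∂ν := by
  obtain ⟨F, rfl⟩ := dependsOn_iff_exists_comp.1 hf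
  have hF : Measurable F := measurable_of_finite F
  have hg : Measurable g := measurable_of_finite g
  have hind : iIndepFun (fun (k : ℕ) (b : ℕ → Bool) => b k) (coins ν) :=
    iIndepFun_infinitePi (P := fun _ : ℕ => ν) (X := fun _ x => x) fun _ => measurable_id
  have hind2 := hind.indepFun_finset (Finset.range n) {n} (by simp)
    fun k => measurable_pi_apply k
  have hind3 := hind2.comp (φ := F)
    (ψ := fun x : ({n} : Finset ℕ) → Bool => g (x ⟨n, Finset.mem_singleton_self n⟩)) hF
    (hg.comp (measurable_pi_apply _))
  have hmeas : Measurable fun (b : ℕ → Bool) (i : Finset.range n) => b i :=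
    measurable_pi_iff.2 fun i => measurable_pi_apply _
  have h := lintegral_mul_eq_lintegral_mul_lintegral_of_indepFun (hF.comp hmeas)
    (hg.comp (measurable_pi_apply n)) hind3
  have h2 : ∫⁻ b, g (b n) ∂coins ν = ∫⁻ x, g x ∂ν := by
    rw [← (measurePreserving_eval_infinitePi (fun _ : ℕ => ν) n).lintegral_comp hg]
  rw [← h2]
  exact h

variable {ν} {p : ℝ}

lemma mul_exp_add_mul_exp_le (hp : p ∈ Set.Ioo (0 : ℝ) 1) {t : ℝ} (ht : |t| ≤ 1) :
    p * Real.exp (t * (0 - (1 - p))) + (1 - p) * Real.exp (t * (1 - (1 - p))) ≤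
      Real.exp (t ^ 2) := by
  obtain ⟨h0, h1⟩ := hp
  have ht' := abs_le.1 ht
  have e1 := (abs_le.1 (Real.abs_exp_sub_one_sub_id_le (x := t * (0 - (1 - p)))
    (by rw [abs_mul, abs_of_neg (by linarith : 0 - (1 - p) < 0)]
        nlinarith [abs_nonneg t]))).2
  have e2 := (abs_le.1 (Real.abs_exp_sub_one_sub_id_le (x := t * (1 - (1 - p)))
    (by rw [abs_mul, abs_of_pos (by linarith : 0 < 1 - (1 - p))]
        nlinarith [abs_nonneg t]))).2
  have e3 := Real.add_one_le_exp (t ^ 2)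
  have m1 := mul_le_mul_of_nonneg_left e1 h0.le
  have m2 := mul_le_mul_of_nonneg_left e2 (by linarith : 0 ≤ 1 - p)
  nlinarith [mul_nonneg (sq_nonneg t) (mul_nonneg h0.le (by linarith : 0 ≤ 1 - p)),
    mul_nonneg (sq_nonneg t) (by nlinarith : 0 ≤ 1 - p * (1 - p))]

lemma lintegral_exp_deviation_le (hp : p ∈ Set.Ioo (0 : ℝ) 1)
    (hν0 : ν {false} = ENNReal.ofReal p) (hν1 : ν {true} = ENNReal.ofReal (1 - p))
    {t : ℝ} (ht : |t| ≤ 1) (n : ℕ) :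
    ∫⁻ b, ENNReal.ofReal (Real.exp (t * deviation (1 - p) b n)) ∂coins ν ≤
      ENNReal.ofReal (Real.exp (n * t ^ 2)) := by
  induction n with
  | zero => simp [deviation, onesCount]
  | succ n ih =>
    set E : (ℕ → Bool) → ℝ≥0∞ := fun b => ENNReal.ofReal (Real.exp (t * deviation (1 - p) b n))
    set g : Bool → ℝ≥0∞ := fun x =>
      ENNReal.ofReal (Real.exp (t * ((if x then 1 else 0) - (1 - p))))
    set f₀ : (ℕ → Bool) → ℝ≥0∞ := fun b => if parent (golden b) (n + 1) then E b else 0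
    set f₁ : (ℕ → Bool) → ℝ≥0∞ := fun b => if parent (golden b) (n + 1) then 0 else E b
    have hE : Measurable E :=
      ((measurable_deviation (1 - p) n).const_mul t).exp.ennreal_ofReal
    have hpar : MeasurableSet {b | parent (golden b) (n + 1) = true} := by
      have : Measurable fun b => parent (golden b) (n + 1) :=
        (measurable_of_finite fun x : Bool => decide ((n + 1) % 2 = 0) && x).comp
          (measurable_golden ((n + 1) / 2))
      exact this (measurableSet_singleton true)
    have hf₀ : Measurable f₀ := Measurable.ite hpar hE measurable_const
    have hf₁ : DependsOn f₁ (Finset.range n : Set ℕ) := by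
      intro b b' h
      have h' : ∀ j < n, b j = b' j := fun j hj => h j (by simpa using hj)
      simp only [f₁, E]
      rw [deviation_congr _ h', parent_congr (a' := golden b') (by omega)
        fun j _ hj => golden_congr fun i hi => h' i (by omega)]
    have hstep : ∀ b, ENNReal.ofReal (Real.exp (t * deviation (1 - p) b (n + 1))) =
        f₀ b + f₁ b * g (b n) := by
      intro b
      simp only [f₀, f₁, E, g, deviation_succ]
      cases parent (golden b) (n + 1)
      · simp only [Bool.false_eq_true, if_false, zero_add]
        rw [← ENNReal.ofReal_mul (Real.exp_nonneg _), ← Real.exp_add, mul_add]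
      · simp
    have hsum : ∀ b, f₀ b + f₁ b = E b := by
      intro b
      simp only [f₀, f₁]
      split_ifs <;> simp
    have hg : ∫⁻ x, g x ∂ν ≤ ENNReal.ofReal (Real.exp (t ^ 2)) := by
      rw [lintegral_fintype, Fintype.sum_bool, hν0, hν1]
      simp only [g, if_true, Bool.false_eq_true, if_false]
      rw [← ENNReal.ofReal_mul (Real.exp_nonneg _), ← ENNReal.ofReal_mul (Real.exp_nonneg _),
        ← ENNReal.ofReal_add (mul_nonneg (Real.exp_nonneg _) (sub_nonneg.2 hp.2.le))
          (mul_nonneg (Real.exp_nonneg _) hp.1.le)]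
      refine ENNReal.ofReal_le_ofReal ?_
      linarith [mul_exp_add_mul_exp_le hp ht]
    have hone : 1 ≤ ENNReal.ofReal (Real.exp (t ^ 2)) := by
      rw [ENNReal.one_le_ofReal]
      exact Real.one_le_exp (sq_nonneg t)
    calc ∫⁻ b, ENNReal.ofReal (Real.exp (t * deviation (1 - p) b (n + 1))) ∂coins ν
        = ∫⁻ b, f₀ b ∂coins ν + (∫⁻ b, f₁ b ∂coins ν) * ∫⁻ x, g x ∂ν := by
          simp_rw [hstep]
          rw [lintegral_add_left hf₀, lintegral_coins_mul ν hf₁]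
      _ ≤ (∫⁻ b, f₀ b ∂coins ν) * ENNReal.ofReal (Real.exp (t ^ 2)) +
          (∫⁻ b, f₁ b ∂coins ν) * ENNReal.ofReal (Real.exp (t ^ 2)) := by
          gcongr
          exact le_mul_of_one_le_right' hone
      _ = (∫⁻ b, E b ∂coins ν) * ENNReal.ofReal (Real.exp (t ^ 2)) := by
          rw [← add_mul, ← lintegral_add_left hf₀]
          simp_rw [hsum]
      _ ≤ ENNReal.ofReal (Real.exp (n * t ^ 2)) * ENNReal.ofReal (Real.exp (t ^ 2)) := by
          gcongr
      _ = ENNReal.ofReal (Real.exp ((n + 1 : ℕ) * t ^ 2)) := by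
          rw [← ENNReal.ofReal_mul (Real.exp_nonneg _), ← Real.exp_add]
          push_cast
          ring_nf

lemma coins_lt_deviation_le (hp : p ∈ Set.Ioo (0 : ℝ) 1)
    (hν0 : ν {false} = ENNReal.ofReal p) (hν1 : ν {true} = ENNReal.ofReal (1 - p))
    {t ε : ℝ} (ht : |t| ≤ 1) (n : ℕ) :
    coins ν {b | n * ε ≤ t * deviation (1 - p) b n} ≤
      ENNReal.ofReal (Real.exp (n * (t ^ 2 - ε))) := by
  have h := mul_meas_ge_le_lintegral (μ := coins ν)
    ((measurable_deviation (1 - p) n).const_mul t).exp.ennreal_ofReal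
    (ENNReal.ofReal (Real.exp (n * ε)))
  have h2 := h.trans (lintegral_exp_deviation_le hp hν0 hν1 ht n)
  have h3 : {b | ENNReal.ofReal (Real.exp (n * ε)) ≤
      ENNReal.ofReal (Real.exp (t * deviation (1 - p) b n))} =
      {b | n * ε ≤ t * deviation (1 - p) b n} := by
    ext b
    simp only [Set.mem_ofPred_eq]
    rw [ENNReal.ofReal_le_ofReal_iff (Real.exp_nonneg _), Real.exp_le_exp]
  rw [h3, mul_comm, ← ENNReal.le_div_iff_mul_le (by simp [Real.exp_pos]) (by simp),
    ← ENNReal.ofReal_div_of_pos (Real.exp_pos _), ← Real.exp_sub] at h2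
  rwa [mul_sub]

lemma ae_eventually_abs_deviation_le (hp : p ∈ Set.Ioo (0 : ℝ) 1)
    (hν0 : ν {false} = ENNReal.ofReal p) (hν1 : ν {true} = ENNReal.ofReal (1 - p))
    {ε : ℝ} (hε : 0 < ε) (hε1 : ε ≤ 1) :
    ∀ᵐ b ∂coins ν, ∀ᶠ n : ℕ in atTop, |deviation (1 - p) b n| ≤ ε * n := by
  have key : ∀ σ : ℝ, |σ| = 1 → ∀ᵐ b ∂coins ν, ∀ᶠ n : ℕ in atTop,
      σ * deviation (1 - p) b n ≤ ε * n := by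
    intro σ hσ
    have hσ2 : σ ^ 2 = 1 := by rw [← sq_abs, hσ, one_pow]
    have hsum : ∑' n : ℕ, coins ν {b | n * (ε ^ 2 / 2) ≤ (σ * (ε / 2)) * deviation (1 - p) b n} ≠
        ∞ := by
      refine ne_top_of_le_ne_top ?_ (ENNReal.tsum_le_tsum fun n =>
        coins_lt_deviation_le hp hν0 hν1 ?_ n)
      · have h : Summable fun n : ℕ =>
            Real.exp (n * ((σ * (ε / 2)) ^ 2 - ε ^ 2 / 2)) := by
          refine Real.summable_exp_nat_mul_iff.2 ?_
          rw [mul_pow, hσ2]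
          nlinarith [pow_pos hε 2]
        rw [← ENNReal.ofReal_tsum_of_nonneg (fun n => Real.exp_nonneg _) h]
        exact ENNReal.ofReal_ne_top
      · rw [abs_mul, hσ, one_mul, abs_of_pos (by positivity)]
        linarith
    filter_upwards [ae_eventually_notMem hsum] with b hb
    filter_upwards [hb] with n hn
    replace hn : σ * (ε / 2) * deviation (1 - p) b n < n * (ε ^ 2 / 2) := not_le.1 hn
    have : ε / 2 * (σ * deviation (1 - p) b n) < ε / 2 * (ε * n) := by linarith
    exact (lt_of_mul_lt_mul_left this (by positivity)).le
  filter_upwards [key 1 (by simp), key (-1) (by simp)] with b h1 h2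
  filter_upwards [h1, h2] with n h1 h2
  rw [abs_le]
  constructor <;> linarith

end Measure

/-- If `1 - p = p ^ (3 / 2)`, cylinders have measure `p` to the power of `cylinderExponent`. -/
lemma coins_code_eq {ν : Measure Bool} [IsProbabilityMeasure ν] {p : ℝ}
    (hp : p ∈ Set.Ioo (0 : ℝ) 1) (hpe : 1 - p = p ^ (3 / 2 : ℝ))
    (hν0 : ν {false} = ENNReal.ofReal p) (hν1 : ν {true} = ENNReal.ofReal (1 - p))
    {a : ℕ → Bool} (ha : Admissible a) (n : ℕ) :
    coins ν {b | code (golden b) n = code a n} = ENNReal.ofReal (p ^ cylinderExponent a n) := by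
  have hset : {b | code (golden b) n = code a n} =
      Set.pi (Finset.range n : Set ℕ)
        fun k => if parent a (k + 1) then Set.univ else {a (k + 1)} := by
    ext b
    rw [Set.mem_ofPred_eq, code_eq_iff, Set.mem_pi]
    constructor
    · intro h k hk
      have hk' : k < n := by simpa using hk
      have hpar : parent (golden b) (k + 1) = parent a (k + 1) :=
        parent_congr (by omega) fun j hj hjk => by
          obtain ⟨i, rfl⟩ : ∃ i, j = i + 1 := ⟨j - 1, by omega⟩
          exact h i (by omega)
      have h1 := h k hk'
      rw [golden_succ, hpar] at h1
      by_cases hq : parent a (k + 1) = true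
      · simp [hq]
      · simpa [hq] using h1
    · intro h k
      induction k using Nat.strong_induction_on with
      | _ k ih =>
        intro hk
        have hpar : parent (golden b) (k + 1) = parent a (k + 1) :=
          parent_congr (by omega) fun j hj hjk => by
            obtain ⟨i, rfl⟩ : ∃ i, j = i + 1 := ⟨j - 1, by omega⟩
            exact ih i (by omega) (by omega)
        have h1 := h k (by simpa using hk)
        have h2 := ha.and_parent (k := k + 1) (by omega)
        rw [golden_succ, hpar]
        by_cases hq : parent a (k + 1) = true
        · simp_all
        · simpa [hq] using h1
  have hfac : ∀ k, ν (if parent a (k + 1) then Set.univ else {a (k + 1)}) =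
      ENNReal.ofReal (p ^ (1 + (if a (k + 1) then (1 : ℝ) else 0) / 2 -
        (if parent a (k + 1) then (1 : ℝ) else 0))) := by
    intro k
    have h2 := ha.and_parent (k := k + 1) (by omega)
    cases hq : parent a (k + 1) <;> cases hr : a (k + 1)
    · simp [hν0]
    · simp only [Bool.false_eq_true, if_false, if_true, hν1, hpe]
      norm_num
    · simp only [if_true, measure_univ]
      simp
    · simp [hq, hr] at h2
  rw [hset, Measure.infinitePi_pi _ fun k _ => MeasurableSet.of_discrete]
  simp_rw [hfac]
  rw [← ENNReal.ofReal_prod_of_nonneg fun k _ => Real.rpow_nonneg hp.1.le _,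
    ← Real.rpow_sum_of_pos hp.1, Finset.sum_sub_distrib, sum_parent, Finset.sum_add_distrib,
    ← Finset.sum_div]
  simp [cylinderExponent, onesCount]

lemma exists_cylinderExponent_le (a : ℕ → Bool) {ε : ℝ} (hε : 0 < ε) (N : ℕ) :
    ∃ n ≥ N, cylinderExponent a n ≤ (1 + ε) * n := by
  by_contra! h
  have hstep : ∀ j ≥ N, onesCount a (2 ^ j) / 2 ^ j + 2 * ε ≤
      onesCount a (2 ^ (j + 1)) / 2 ^ (j + 1) := by
    intro j hj
    have hj2 : N ≤ 2 ^ (j + 1) := hj.trans ((Nat.le_succ j).trans Nat.lt_two_pow_self.le)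
    have h1 := h _ hj2
    rw [cylinderExponent, show 2 ^ (j + 1) / 2 = 2 ^ j by rw [pow_succ]; simp] at h1
    push_cast at h1
    rw [div_add' _ _ _ (by positivity), div_le_div_iff₀ (by positivity) (by positivity)]
    rw [pow_succ] at h1 ⊢
    have h2 : (0 : ℝ) < 2 ^ j := by positivity
    nlinarith
  have hlin : ∀ i : ℕ, 2 * ε * i ≤ onesCount a (2 ^ (N + i)) / 2 ^ (N + i) := by
    intro i
    induction i with
    | zero => simpa using div_nonneg (onesCount_nonneg a (2 ^ N)) (by positivity)
    | succ i ih =>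
      have := hstep (N + i) (by omega)
      rw [add_assoc] at this
      push_cast
      linarith
  obtain ⟨i, hi⟩ := exists_nat_gt (1 / (2 * ε))
  rw [div_lt_iff₀ (by positivity)] at hi
  have h1 : onesCount a (2 ^ (N + i)) / 2 ^ (N + i) ≤ 1 := by
    rw [div_le_one (by positivity)]
    simpa using onesCount_le a (2 ^ (N + i))
  linarith [hlin i]

lemma exists_abs_onesCount_sub_le {q ε : ℝ} (hq : q ∈ Set.Ioo (0 : ℝ) 1) (hε : 0 < ε)
    {b : ℕ → Bool} (h : ∀ᶠ n : ℕ in atTop, |deviation q b n| ≤ ε * n) :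
    ∃ C, ∀ n : ℕ, |onesCount (golden b) n - 2 * q / (2 + q) * n| ≤ 4 * ε * n + C := by
  obtain ⟨hq0, hq1⟩ := hq
  obtain ⟨M, hM⟩ := eventually_atTop.1 h
  set α := 2 * q / (2 + q) with hα
  have hαq : α * (2 + q) = 2 * q := div_mul_cancel₀ _ (by positivity)
  have hα0 : 0 ≤ α := by positivity
  have hα1 : α ≤ 1 := by nlinarith
  have hC : 1 ≤ (1 - q) * (M + 1 / (1 - q)) := by
    rw [mul_add, mul_one_div_cancel (by linarith)]
    nlinarith [mul_nonneg (by linarith : 0 ≤ 1 - q) (Nat.cast_nonneg (α := ℝ) M)]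
  have hC2 : (M : ℝ) ≤ M + 1 / (1 - q) := by
    have : 0 ≤ 1 / (1 - q) := by rw [one_div]; exact inv_nonneg.2 (by linarith)
    linarith
  set C := (M : ℝ) + 1 / (1 - q)
  have hM0 : (0 : ℝ) ≤ M := Nat.cast_nonneg M
  refine ⟨C, fun n => ?_⟩
  induction n using Nat.strong_induction_on with
  | _ n ih =>
    have hn0 : (0 : ℝ) ≤ n := Nat.cast_nonneg n
    by_cases hn : n < M ∨ n = 0
    · have hnM : (n : ℝ) ≤ M := by
        rcases hn with hn | hn
        · exact_mod_cast hn.le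
        · simp [hn]
      have h1 := onesCount_nonneg (golden b) n
      have h2 := onesCount_le (golden b) n
      have h3 : 0 ≤ ε * n := by positivity
      rw [abs_le]
      constructor <;> nlinarith
    · push Not at hn
      have hS := hM n hn.1
      have hI := ih (n / 2) (by omega)
      have hf1 : ((n / 2 : ℕ) : ℝ) ≤ n / 2 := Nat.cast_div_le
      have hf2 : (n : ℝ) / 2 - 1 / 2 ≤ ((n / 2 : ℕ) : ℝ) := by
        have : n ≤ 2 * (n / 2) + 1 := by omega
        have : (n : ℝ) ≤ 2 * ((n / 2 : ℕ) : ℝ) + 1 := by exact_mod_cast this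
        linarith
      set m : ℝ := ((n / 2 : ℕ) : ℝ)
      have hid : onesCount (golden b) n - α * n = -(q * (onesCount (golden b) (n / 2) - α * m))
          + q * α * (n / 2 - m) + deviation q b n := by
        rw [deviation]
        linear_combination (-(n : ℝ) / 2) * hαq
      have hθ : |q * α * (n / 2 - m)| ≤ 1 := by
        rw [abs_of_nonneg (mul_nonneg (by positivity) (by linarith))]
        have : q * α ≤ 1 := mul_le_one₀ hq1.le hα0 hα1
        nlinarith [mul_nonneg hq0.le hα0]
      have hD : |-(q * (onesCount (golden b) (n / 2) - α * m))| ≤ q * (4 * ε * m + C) := by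
        rw [abs_neg, abs_mul, abs_of_pos hq0]
        gcongr
      have hqm : q * (4 * ε * m) ≤ 2 * ε * n := by
        calc q * (4 * ε * m) ≤ 1 * (4 * ε * (n / 2)) := by gcongr
          _ = 2 * ε * n := by ring
      rw [hid]
      refine (abs_add_three _ _ _).trans ?_
      nlinarith [mul_nonneg hε.le hn0]

lemma eventually_le_cylinderExponent {q ε : ℝ} (hq : q ∈ Set.Ioo (0 : ℝ) 1) (hε : 0 < ε)
    {b : ℕ → Bool} (h : ∀ᶠ n : ℕ in atTop, |deviation q b n| ≤ ε * n) :
    ∀ᶠ n : ℕ in atTop, (1 - 5 * ε) * n ≤ cylinderExponent (golden b) n := by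
  obtain ⟨C, hC⟩ := exists_abs_onesCount_sub_le hq hε h
  have hα : 0 ≤ 2 * q / (2 + q) := div_nonneg (by linarith [hq.1]) (by linarith [hq.1])
  obtain ⟨M, hM⟩ := exists_nat_gt (3 / 2 * C / ε)
  filter_upwards [eventually_ge_atTop M] with n hn
  rw [div_lt_iff₀ hε] at hM
  have hn' : (M : ℝ) ≤ n := by exact_mod_cast hn
  have h1 := (abs_le.1 (hC n)).1
  have h2 := (abs_le.1 (hC (n / 2))).2
  have hf1 : ((n / 2 : ℕ) : ℝ) ≤ n / 2 := Nat.cast_div_le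
  rw [cylinderExponent]
  nlinarith [mul_le_mul_of_nonneg_left hf1 hα, mul_le_mul_of_nonneg_left hf1 hε.le]

section Dimension

variable {ν : Measure Bool} [IsProbabilityMeasure ν] {p s : ℝ}

lemma hausdorffMeasure_XiG_ne_top (hp : p ∈ Set.Ioo (0 : ℝ) 1) (hpe : 1 - p = p ^ (3 / 2 : ℝ))
    (hν0 : ν {false} = ENNReal.ofReal p) (hν1 : ν {true} = ENNReal.ofReal (1 - p))
    (hs : 0 < s) (hps : p = 2 ^ (-s)) {d : ℝ} (hd : s < d) :
    Measure.hausdorffMeasure d XiG ≠ ∞ := by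
  obtain ⟨ε, hε, η, hη, hεη⟩ : ∃ ε > 0, ∃ η > 0, d = s * (1 + ε) + η :=
    ⟨(d - s) / (2 * s), div_pos (by linarith) (by linarith), (d - s) / 2, by linarith, by
      field_simp; ring⟩
  set good : ℕ → Set ℕ := fun n =>
    {m | ∃ a, Admissible a ∧ code a n = m ∧ cylinderExponent a n ≤ (1 + ε) * n}
  classical
  set T : ℕ → ℕ × ℕ → Set ℝ := fun N x =>
    if N ≤ x.1 ∧ x.2 ∈ good x.1 then
      Set.Icc ((x.2 : ℝ) / 2 ^ x.1) ((x.2 + 1 : ℝ) / 2 ^ x.1) else ∅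
  have hdiam : ∀ m n : ℕ, Metric.ediam (Set.Icc ((m : ℝ) / 2 ^ n) ((m + 1 : ℝ) / 2 ^ n)) =
      ENNReal.ofReal (1 / 2 ^ n) := by
    intro m n
    rw [Real.ediam_Icc]
    congr 1
    ring
  have hcover : ∀ N, XiG ⊆ ⋃ x, T N x := by
    intro N x hx
    rw [XiG_eq_image] at hx
    obtain ⟨a, ha, rfl⟩ := hx
    obtain ⟨n, hn, hle⟩ := exists_cylinderExponent_le a hε N
    refine Set.mem_iUnion.2 ⟨(n, code a n), ?_⟩
    simp only [T]
    rw [if_pos ⟨hn, a, ha, rfl, hle⟩]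
    exact binaryValue_mem a n
  have hpiece : ∀ N n m, Metric.ediam (T N (n, m)) ^ d ≤
      coins ν ((fun b => code (golden b) n) ⁻¹' {m}) * ENNReal.ofReal ((2 ^ (-η)) ^ n) := by
    intro N n m
    simp only [T]
    split_ifs with h
    · obtain ⟨-, a, ha, rfl, hle⟩ := h
      have hset : (fun b => code (golden b) n) ⁻¹' {code a n} =
        {b | code (golden b) n = code a n} := rfl
      rw [hset, coins_code_eq hp hpe hν0 hν1 ha, hdiam,
        ENNReal.ofReal_rpow_of_pos (by positivity),
        ← ENNReal.ofReal_mul (Real.rpow_nonneg hp.1.le _)]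
      refine ENNReal.ofReal_le_ofReal ?_
      have h1 : p ^ ((1 + ε) * n) ≤ p ^ cylinderExponent a n :=
        Real.rpow_le_rpow_of_exponent_ge hp.1 hp.2.le hle
      refine le_trans (le_of_eq ?_) (mul_le_mul_of_nonneg_right h1 (by positivity))
      rw [hps, ← Real.rpow_mul (by norm_num), ← Real.rpow_natCast ((2 : ℝ) ^ (-η)),
        ← Real.rpow_mul (by norm_num), ← Real.rpow_add (by norm_num), one_div,
        ← Real.rpow_natCast, ← Real.rpow_neg (by norm_num), ← Real.rpow_mul (by norm_num), hεη]
      ring_nf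
    · rw [Metric.ediam_empty, ENNReal.zero_rpow_of_pos (by linarith)]
      exact zero_le
  have htotal : ∀ N, ∑' x, Metric.ediam (T N x) ^ d ≤
      ∑' n : ℕ, ENNReal.ofReal ((2 ^ (-η)) ^ n) := by
    intro N
    rw [ENNReal.tsum_prod (f := fun n m => Metric.ediam (T N (n, m)) ^ d)]
    refine ENNReal.tsum_le_tsum fun n => (ENNReal.tsum_le_tsum fun m => hpiece N n m).trans ?_
    rw [ENNReal.tsum_mul_right]
    refine mul_le_of_le_one_left' ?_
    refine (tsum_meas_le_meas_iUnion_of_disjoint (coins ν)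
      (fun m => measurable_code_golden n (measurableSet_singleton m)) fun m m' hm => ?_).trans
      prob_le_one
    exact Disjoint.preimage _ (by simpa using hm)
  have hr1 : (2 : ℝ) ^ (-η) < 1 := Real.rpow_lt_one_of_one_lt_of_neg (by norm_num) (by linarith)
  have hfin : ∑' n : ℕ, ENNReal.ofReal (((2 : ℝ) ^ (-η)) ^ n) ≠ ∞ := by
    rw [← ENNReal.ofReal_tsum_of_nonneg (fun n => by positivity)
      (summable_geometric_of_lt_one (by positivity) hr1)]
    exact ENNReal.ofReal_ne_top
  refine ne_top_of_le_ne_top hfin ?_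
  have hr : Tendsto (fun N : ℕ => ENNReal.ofReal (1 / 2 ^ N)) atTop (𝓝 0) := by
    rw [← ENNReal.ofReal_zero]
    refine ENNReal.tendsto_ofReal ?_
    simp_rw [← one_div_pow]
    exact tendsto_pow_atTop_nhds_zero_of_lt_one (by norm_num) (by norm_num)
  refine (Measure.hausdorffMeasure_le_liminf_tsum d XiG _ hr T
    (Eventually.of_forall fun N x => ?_) (Eventually.of_forall hcover)).trans ?_
  · simp only [T]
    split_ifs with h
    · rw [hdiam]
      refine ENNReal.ofReal_le_ofReal ?_
      exact one_div_le_one_div_of_le (by positivity) (pow_le_pow_right₀ (by norm_num) h.1)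
    · simp
  · exact (liminf_le_liminf (Eventually.of_forall htotal)).trans (liminf_const _).le

lemma measure_map_binaryValue_le (hp : p ∈ Set.Ioo (0 : ℝ) 1)
    (hpe : 1 - p = p ^ (3 / 2 : ℝ))
    (hν0 : ν {false} = ENNReal.ofReal p) (hν1 : ν {true} = ENNReal.ofReal (1 - p))
    (hps : p = 2 ^ (-s)) {d : ℝ} {n : ℕ} {G : Set (ℕ → Bool)}
    (hG : ∀ b ∈ G, d * n ≤ s * cylinderExponent (golden b) n)
    {A : Set ℝ} (hA : Metric.ediam A ≤ ENNReal.ofReal ((1 / 2) ^ n)) :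
    ((coins ν).restrict G).map (fun b => binaryValue (golden b)) A ≤
      ENNReal.ofReal (4 * 2 ^ (-(d * n))) := by
  rcases A.eq_empty_or_nonempty with rfl | ⟨z, hz⟩
  · simp
  have hball : A ⊆ Metric.closedBall z ((1 / 2) ^ n) := by
    intro x hx
    rw [Metric.mem_closedBall, ← ENNReal.ofReal_le_ofReal_iff (by positivity), ← edist_dist]
    exact (Metric.edist_le_ediam_of_mem hx hz).trans hA
  refine (measure_mono hball).trans ?_
  have hmeas := measurable_binaryValue_golden
  rw [Measure.map_apply hmeas measurableSet_closedBall,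
    Measure.restrict_apply (hmeas measurableSet_closedBall)]
  have hsub : (fun b => binaryValue (golden b)) ⁻¹' Metric.closedBall z ((1 / 2) ^ n) ∩ G ⊆
      ⋃ m ∈ Finset.Icc (⌊2 ^ n * z⌋ - 2) (⌊2 ^ n * z⌋ + 1),
        {b | b ∈ G ∧ (code (golden b) n : ℤ) = m} := by
    rintro b ⟨hb, hbG⟩
    rw [Set.mem_preimage, Metric.mem_closedBall, Real.dist_eq, abs_le, one_div_pow] at hb
    obtain ⟨h1, h2⟩ := binaryValue_mem (golden b) n
    have hpos : (0 : ℝ) < 2 ^ n := by positivity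
    rw [div_le_iff₀ hpos] at h1
    rw [le_div_iff₀ hpos] at h2
    have hinv : 1 / (2 : ℝ) ^ n * 2 ^ n = 1 := by field_simp
    have hb1 := mul_le_mul_of_nonneg_right hb.1 hpos.le
    have hb2 := mul_le_mul_of_nonneg_right hb.2 hpos.le
    refine Set.mem_biUnion (x := (code (golden b) n : ℤ)) ?_ ⟨hbG, rfl⟩
    rw [Finset.mem_coe, Finset.mem_Icc]
    constructor
    · have : ((⌊2 ^ n * z⌋ : ℤ) : ℝ) ≤ ((code (golden b) n : ℤ) : ℝ) + 2 := by
        push_cast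
        linarith [Int.floor_le (2 ^ n * z)]
      have : ⌊2 ^ n * z⌋ ≤ (code (golden b) n : ℤ) + 2 := by exact_mod_cast this
      linarith
    · have : ((code (golden b) n : ℤ) : ℝ) < ((⌊2 ^ n * z⌋ : ℤ) : ℝ) + 1 + 1 := by
        push_cast
        linarith [Int.lt_floor_add_one (2 ^ n * z)]
      have : (code (golden b) n : ℤ) < ⌊2 ^ n * z⌋ + 1 + 1 := by exact_mod_cast this
      linarith
  have hpiece : ∀ m : ℤ, coins ν {b | b ∈ G ∧ (code (golden b) n : ℤ) = m} ≤
      ENNReal.ofReal (2 ^ (-(d * n))) := by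
    intro m
    rcases Set.eq_empty_or_nonempty {b | b ∈ G ∧ (code (golden b) n : ℤ) = m} with
      h | ⟨b₀, hb₀, hm⟩
    · simp [h]
    · calc coins ν {b | b ∈ G ∧ (code (golden b) n : ℤ) = m}
          ≤ coins ν {b | code (golden b) n = code (golden b₀) n} := by
            refine measure_mono fun b hb => ?_
            exact_mod_cast hb.2.trans hm.symm
        _ = ENNReal.ofReal (p ^ cylinderExponent (golden b₀) n) :=
            coins_code_eq hp hpe hν0 hν1 (admissible_golden b₀) n
        _ ≤ ENNReal.ofReal (2 ^ (-(d * n))) := by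
            refine ENNReal.ofReal_le_ofReal ?_
            rw [hps, ← Real.rpow_mul (by norm_num)]
            refine Real.rpow_le_rpow_of_exponent_le (by norm_num) ?_
            linarith [hG b₀ hb₀]
  calc _ ≤ _ := measure_mono hsub
    _ ≤ ∑ m ∈ Finset.Icc (⌊2 ^ n * z⌋ - 2) (⌊2 ^ n * z⌋ + 1),
        coins ν {b | b ∈ G ∧ (code (golden b) n : ℤ) = m} := measure_biUnion_finset_le _ _
    _ ≤ ∑ _m ∈ Finset.Icc (⌊2 ^ n * z⌋ - 2) (⌊2 ^ n * z⌋ + 1),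
        ENNReal.ofReal (2 ^ (-(d * n))) := Finset.sum_le_sum fun m _ => hpiece m
    _ = ENNReal.ofReal (4 * 2 ^ (-(d * n))) := by
      rw [Finset.sum_const, Int.card_Icc,
        show ⌊2 ^ n * z⌋ + 1 + 1 - (⌊2 ^ n * z⌋ - 2) = 4 by ring,
        ENNReal.ofReal_mul (by norm_num)]
      simp

lemma hausdorffMeasure_XiG_ne_zero (hp : p ∈ Set.Ioo (0 : ℝ) 1)
    (hpe : 1 - p = p ^ (3 / 2 : ℝ))
    (hν0 : ν {false} = ENNReal.ofReal p) (hν1 : ν {true} = ENNReal.ofReal (1 - p))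
    (hps : p = 2 ^ (-s)) {d : ℝ} (hd0 : 0 ≤ d) (hd : d < s) :
    Measure.hausdorffMeasure d XiG ≠ 0 := by
  have hs : 0 < s := hd0.trans_lt hd
  obtain ⟨ε, hε, hε1, d', hdd', hd'⟩ :
      ∃ ε > 0, ε ≤ 1 ∧ ∃ d' > d, d' = s * (1 - 5 * ε) := by
    refine ⟨(s - d) / (10 * s), div_pos (by linarith) (by linarith), ?_, (d + s) / 2,
      by linarith, ?_⟩
    · rw [div_le_one (by linarith)]
      linarith
    · field_simp
      ring
  set G : ℕ → Set (ℕ → Bool) := fun N =>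
    {b | ∀ n ≥ N, d' * n ≤ s * cylinderExponent (golden b) n}
  have hae : ∀ᵐ b ∂coins ν, ∃ N, b ∈ G N := by
    filter_upwards [ae_eventually_abs_deviation_le hp hν0 hν1 hε hε1] with b hb
    have hq : 1 - p ∈ Set.Ioo (0 : ℝ) 1 := ⟨by linarith [hp.2], by linarith [hp.1]⟩
    obtain ⟨N, hN⟩ := eventually_atTop.1 (eventually_le_cylinderExponent hq hε hb)
    refine ⟨N, fun n hn => ?_⟩
    rw [hd', mul_assoc]
    exact mul_le_mul_of_nonneg_left (hN n hn) hs.le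
  obtain ⟨N, hN⟩ : ∃ N, coins ν (G N) ≠ 0 := by
    by_contra! h
    have h0 : ∀ᵐ b ∂coins ν, ∀ N, b ∉ G N :=
      ae_all_iff.2 fun N => measure_eq_zero_iff_ae_notMem.1 (h N)
    obtain ⟨b, ⟨N, h1⟩, h2⟩ := (hae.and h0).exists
    exact h2 N h1
  set μ : Measure ℝ := ((coins ν).restrict (G N)).map fun b => binaryValue (golden b)
  have hμ : ∀ n ≥ N, ∀ A : Set ℝ, Metric.ediam A ≤ ENNReal.ofReal ((1 / 2) ^ n) →
      μ A ≤ ENNReal.ofReal (4 * 2 ^ (-(d' * n))) := fun n hn A hA =>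
    measure_map_binaryValue_le (G := G N) hp hpe hν0 hν1 hps (fun b (hb : b ∈ G N) => hb n hn) hA
  have hμX : μ XiG ≠ 0 := by
    have h1 := Measure.le_map_apply (μ := (coins ν).restrict (G N))
      measurable_binaryValue_golden.aemeasurable XiG
    have h2 : (fun b => binaryValue (golden b)) ⁻¹' XiG = Set.univ := by
      rw [XiG_eq_image]
      exact Set.eq_univ_of_forall fun b => ⟨golden b, admissible_golden b, rfl⟩
    rw [h2, Measure.restrict_apply_univ] at h1
    exact fun h => hN (le_antisymm (h1.trans h.le) zero_le)
  obtain ⟨M, hM⟩ := exists_nat_ge ((2 + d) / (d' - d))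
  rw [div_le_iff₀ (by linarith)] at hM
  have hle : μ ≤ Measure.hausdorffMeasure d := by
    refine Measure.le_hausdorffMeasure d μ (ENNReal.ofReal ((1 / 2) ^ (max M N)))
      (by simp) fun A hA => ?_
    have hfin : Metric.ediam A ≠ ∞ := ne_top_of_le_ne_top ENNReal.ofReal_ne_top hA
    rcases eq_or_ne (Metric.ediam A) 0 with h0 | h0
    · have hlim : Tendsto (fun n : ℕ => ENNReal.ofReal (4 * 2 ^ (-(d' * n)))) atTop (𝓝 0) := by
        rw [← ENNReal.ofReal_zero]
        refine ENNReal.tendsto_ofReal ?_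
        rw [← mul_zero (4 : ℝ)]
        refine Tendsto.const_mul _ ?_
        have hr1 : (2 : ℝ) ^ (-d') < 1 :=
          Real.rpow_lt_one_of_one_lt_of_neg (by norm_num) (by linarith)
        refine (tendsto_pow_atTop_nhds_zero_of_lt_one (by positivity) hr1).congr fun n => ?_
        rw [← Real.rpow_natCast, ← Real.rpow_mul (by norm_num), neg_mul]
      have : μ A ≤ 0 := ge_of_tendsto hlim <| by
        filter_upwards [eventually_ge_atTop N] with n hn
        exact hμ n hn A (by simp [h0])
      exact this.trans zero_le
    · set r := (Metric.ediam A).toReal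
      have hr0 : 0 < r := ENNReal.toReal_pos h0 hfin
      have hrA : Metric.ediam A = ENNReal.ofReal r := (ENNReal.ofReal_toReal hfin).symm
      have hrle : r ≤ (1 / 2) ^ (max M N) := by
        rwa [hrA, ENNReal.ofReal_le_ofReal_iff (by positivity)] at hA
      obtain ⟨n, hn1, hn2⟩ := exists_nat_pow_near_of_lt_one hr0
        (hrle.trans (pow_le_one₀ (by norm_num) (by norm_num)))
        (by norm_num : (0 : ℝ) < 1 / 2) (by norm_num)
      have hn : max M N ≤ n := by
        have := (pow_lt_pow_iff_right_of_lt_one₀ (by norm_num : (0 : ℝ) < 1 / 2)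
          (by norm_num)).1 (hn1.trans_le hrle)
        omega
      refine (hμ n ((le_max_right M N).trans hn) A
        (hrA.le.trans (ENNReal.ofReal_le_ofReal hn2))).trans ?_
      rw [hrA, ENNReal.ofReal_rpow_of_pos hr0]
      refine ENNReal.ofReal_le_ofReal ?_
      refine le_trans ?_ (Real.rpow_le_rpow (by positivity) hn1.le hd0)
      rw [one_div_pow, one_div, ← Real.rpow_natCast, ← Real.rpow_neg (by norm_num),
        ← Real.rpow_mul (by norm_num), show (4 : ℝ) = 2 ^ (2 : ℝ) by norm_num,
        ← Real.rpow_add (by norm_num)]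
      refine Real.rpow_le_rpow_of_exponent_le (by norm_num) ?_
      have hMn : (M : ℝ) ≤ n := by exact_mod_cast (le_max_left M N).trans hn
      push_cast
      nlinarith [mul_le_mul_of_nonneg_right hMn (by linarith : 0 ≤ d' - d)]
  exact fun h => hμX (le_antisymm ((hle XiG).trans h.le) zero_le)

end Dimension

end MultGoldenMean

/-- The Hausdorff dimension of the multiplicative golden mean shift is `-log₂ p`, where `p` is
the unique root of `p³ = (1-p)²` in `(0,1)`. -/
theorem dimH_XiG (p : ℝ) (hp : p ∈ Set.Ioo (0 : ℝ) 1) (hpe : p ^ 3 = (1 - p) ^ 2) :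
    dimH XiG = ENNReal.ofReal (-Real.logb 2 p) := by
  have hp1 : 0 ≤ 1 - p := by linarith [hp.2]
  have hpe' : 1 - p = p ^ (3 / 2 : ℝ) := by
    rw [← Real.sqrt_sq hp1, ← hpe, Real.sqrt_eq_rpow, ← Real.rpow_natCast,
      ← Real.rpow_mul hp.1.le]
    norm_num
  set ν : Measure Bool := ENNReal.ofReal p • Measure.dirac false +
    ENNReal.ofReal (1 - p) • Measure.dirac true
  have hν0 : ν {false} = ENNReal.ofReal p := by simp [ν]
  have hν1 : ν {true} = ENNReal.ofReal (1 - p) := by simp [ν]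
  have : IsProbabilityMeasure ν := ⟨by simp [ν, ← ENNReal.ofReal_add hp.1.le hp1]⟩
  have hs : 0 < -Real.logb 2 p := neg_pos.2 (Real.logb_neg (by norm_num) hp.1 hp.2)
  have hps : p = 2 ^ (-(-Real.logb 2 p)) := by
    rw [neg_neg, Real.rpow_logb (by norm_num) (by norm_num) hp.1]
  refine le_antisymm ?_ ?_
  · refine le_of_forall_gt_imp_ge_of_dense fun c hc => ?_
    rcases eq_or_ne c ⊤ with rfl | hc'
    · exact le_top
    lift c to NNReal using hc'
    refine dimH_le_of_hausdorffMeasure_ne_top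
      (MultGoldenMean.hausdorffMeasure_XiG_ne_top hp hpe' hν0 hν1 hs hps ?_)
    rw [ENNReal.ofReal, ENNReal.coe_lt_coe] at hc
    exact (Real.toNNReal_lt_iff_lt_coe hs.le).1 hc
  · refine ENNReal.le_of_forall_nnreal_lt fun d hd => ?_
    refine le_dimH_of_hausdorffMeasure_ne_zero
      (MultGoldenMean.hausdorffMeasure_XiG_ne_zero hp hpe' hν0 hν1 hps d.2 ?_)
    rw [ENNReal.ofReal, ENNReal.coe_lt_coe] at hd
    exact Real.lt_toNNReal_iff_coe_lt.1 hd
end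

section
/- Let p be the unique real number in (0,1) satisfying p³ = (1−p)², and let Φ_k be defined by Φ_1 = 1, Φ_2 = 2, Φ_{k+1} = Φ_k + Φ_{k−1} (Fibonacci numbers). Then −log₂ p < Σ_{k=1}^∞ 2^{−k−1} log₂ Φ_{k+1}. (The left side is the Hausdorff dimension of Ξ_G and the right side is its Minkowski dimension, so this expresses dim_H(Ξ_G) < dim_M(Ξ_G).) -/
open MeasureTheory

/-- Fibonacci numbers normalized so that `Φ 1 = 1`, `Φ 2 = 2`, `Φ (k+1) = Φ k + Φ (k-1)`. -/
def Phi : ℕ → ℕ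
  | 0 => 1
  | 1 => 1
  | n + 2 => Phi (n + 1) + Phi n

theorem Phi_pos : ∀ n, 1 ≤ Phi n
  | 0 => le_rfl
  | 1 => le_rfl
  | n + 2 => (Phi_pos (n + 1)).trans (Nat.le_add_right _ _)

theorem Phi_le_two_pow : ∀ n, Phi n ≤ 2 ^ n
  | 0 => by simp [Phi]
  | 1 => by simp [Phi]
  | n + 2 => by
    have h₁ := Phi_le_two_pow (n + 1)
    have h₀ := Phi_le_two_pow n
    simp only [Phi, pow_succ] at *
    omega

theorem logb_Phi_nonneg (n : ℕ) : 0 ≤ Real.logb 2 (Phi n) :=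
  Real.logb_nonneg one_lt_two (by exact_mod_cast Phi_pos n)

theorem logb_Phi_le (n : ℕ) : Real.logb 2 (Phi n) ≤ n := by
  rw [Real.logb_le_iff_le_rpow one_lt_two (by exact_mod_cast Phi_pos n), Real.rpow_natCast]
  exact_mod_cast Phi_le_two_pow n

theorem summable_logb_Phi_div_two_pow :
    Summable fun n : ℕ => Real.logb 2 (Phi n) / 2 ^ n := by
  have h := summable_pow_mul_geometric_of_norm_lt_one 1
    (show ‖(1 / 2 : ℝ)‖ < 1 by norm_num)
  refine h.of_nonneg_of_le (fun n => div_nonneg (logb_Phi_nonneg n) (by positivity)) fun n => ?_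
  rw [pow_one, one_div, inv_pow, ← div_eq_mul_inv]
  gcongr
  exact logb_Phi_le n

theorem le_of_cube_eq_one_sub_sq {p : ℝ} (hp : p ∈ Set.Ioo (0 : ℝ) 1)
    (hpe : p ^ 3 = (1 - p) ^ 2) : 569 / 1000 ≤ p := by
  by_contra! h
  have h₁ : p ^ 3 < (569 / 1000 : ℝ) ^ 3 := pow_lt_pow_left₀ h hp.1.le (by norm_num)
  have h₂ : (431 / 1000 : ℝ) ^ 2 < (1 - p) ^ 2 :=
    pow_lt_pow_left₀ (by linarith) (by norm_num) (by norm_num)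
  norm_num at h₁ h₂
  linarith

set_option exponentiation.threshold 1024 in
theorem neg_logb_lt_sum_range :
    -Real.logb 2 (569 / 1000) <
      ∑ k ∈ Finset.range 9, Real.logb 2 (Phi (k + 2)) / 2 ^ (k + 2) := by
  have h : Real.log ((1000 / 569 : ℝ) ^ 1024) <
      Real.log ((2 : ℝ) ^ 256 * 3 ^ 128 * 5 ^ 64 * 8 ^ 32 * 13 ^ 16 * 21 ^ 8 * 34 ^ 4 * 55 ^ 2
        * 89) := Real.log_lt_log (by positivity) (by norm_num)
  repeat rw [Real.log_mul (by positivity) (by positivity)] at h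
  simp only [Real.log_pow] at h
  rw [← inv_div, Real.log_inv] at h
  have hl : 0 < Real.log 2 := Real.log_pos one_lt_two
  simp only [Finset.sum_range_succ, Finset.sum_range_zero, Phi, Real.logb]
  norm_num at h ⊢
  rw [← sub_pos] at h ⊢
  refine (div_pos h (mul_pos (by norm_num : (0 : ℝ) < 1024) hl)).trans_eq ?_
  field_simp
  ring

/-- `dim_H(Ξ_G) < dim_M(Ξ_G)`: with `p ∈ (0,1)` the root of `p³ = (1-p)²`, one has
`-log₂ p < ∑_{k=1}^∞ 2^{-k-1} log₂ Φ_{k+1}` (the sum below is reindexed by `k ↦ k+1`). -/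
theorem dimH_XiG_lt_dimM (p : ℝ) (hp : p ∈ Set.Ioo (0 : ℝ) 1)
    (hpe : p ^ 3 = (1 - p) ^ 2) :
    -Real.logb 2 p < ∑' k : ℕ, Real.logb 2 (Phi (k + 2)) / 2 ^ (k + 2) := by
  have hq : Real.logb 2 (569 / 1000) ≤ Real.logb 2 p :=
    Real.logb_le_logb_of_le one_lt_two (by norm_num) (le_of_cube_eq_one_sub_sq hp hpe)
  calc -Real.logb 2 p ≤ -Real.logb 2 (569 / 1000) := neg_le_neg hq
    _ < ∑ k ∈ Finset.range 9, Real.logb 2 (Phi (k + 2)) / 2 ^ (k + 2) := neg_logb_lt_sum_range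
    _ ≤ _ := ((summable_nat_add_iff 2).2 summable_logb_Phi_div_two_pow).sum_le_tsum _
      fun k _ => div_nonneg (logb_Phi_nonneg _) (by positivity)
end

section
/- Let s = −log₂ p where p is the unique root in (0,1) of p³ = (1−p)². Then the s-dimensional Hausdorff measure of Ξ_G is infinite; moreover, Ξ_G is not σ-finite with respect to the s-dimensional Hausdorff measure (Ξ_G cannot be written as a countable union of sets of finite s-dimensional Hausdorff measure). -/
open MeasureTheory

namespace MulGoldenMean

open Finset

/-- The sequence `k ↦ f (k / 2)`, supported on even indices. -/
noncomputable def halfShift (f : ℕ → ℝ) (k : ℕ) : ℝ := if Even k then f (k / 2) else 0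

theorem sum_mul_halfShift (g f : ℕ → ℝ) (n : ℕ) :
    ∑ k ∈ Icc 1 n, g k * halfShift f k = ∑ j ∈ Icc 1 (n / 2), g (2 * j) * f j := by
  induction n with
  | zero => simp
  | succ n ih =>
    rw [sum_Icc_succ_top (by omega), ih, halfShift]
    split_ifs with h
    · obtain ⟨m, hm⟩ := h
      have h1 : (n + 1) / 2 = n / 2 + 1 := by omega
      have h2 : 2 * (n / 2 + 1) = n + 1 := by omega
      rw [h1, sum_Icc_succ_top (by omega), h2]
    · have h1 : (n + 1) / 2 = n / 2 := by
        rw [Nat.not_even_iff_odd] at h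
        obtain ⟨m, hm⟩ := h
        omega
      rw [h1, mul_zero, add_zero]

theorem sum_halfShift (f : ℕ → ℝ) (n : ℕ) :
    ∑ k ∈ Icc 1 n, halfShift f k = ∑ j ∈ Icc 1 (n / 2), f j := by
  simpa using sum_mul_halfShift (fun _ ↦ 1) f n

theorem sum_Icc_odd_eq (f : ℕ → ℝ) (m : ℕ) :
    ∑ k ∈ Icc 1 (2 * m + 1), f k = f 1 + ∑ j ∈ Icc 1 m, (f (2 * j) + f (2 * j + 1)) := by
  induction m with
  | zero => simp
  | succ m ih =>
    rw [show 2 * (m + 1) + 1 = 2 * m + 1 + 1 + 1 by ring, sum_Icc_succ_top (by omega),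
      sum_Icc_succ_top (by omega), ih, sum_Icc_succ_top (by omega),
      show 2 * (m + 1) = 2 * m + 1 + 1 by ring]
    ring

theorem sum_Icc_le_add_sum_pairs {f : ℕ → ℝ} (hf : ∀ k, 0 ≤ f k) (n : ℕ) :
    ∑ k ∈ Icc 1 n, f k ≤ f 1 + ∑ j ∈ Icc 1 (n / 2), (f (2 * j) + f (2 * j + 1)) := by
  rw [← sum_Icc_odd_eq]
  exact sum_le_sum_of_subset_of_nonneg (Icc_subset_Icc le_rfl (by omega)) fun k _ _ ↦ hf k

/-- The coefficients that rewrite `∑ k ≤ n, (f k / 2 - halfShift f k)` as a linear combination of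
the quantities `f k + v k * halfShift f k`. -/
noncomputable def coeff (v : ℕ → ℝ) (n k : ℕ) : ℝ :=
  if _h : 1 ≤ k ∧ k ≤ n then
    (1 / 2 - if 2 * k ≤ n then 1 else 0) - v (2 * k) * coeff v n (2 * k)
  else 0
termination_by n + 1 - k

theorem coeff_of_lt {v : ℕ → ℝ} {n k : ℕ} (h : n < k) : coeff v n k = 0 := by
  rw [coeff, dif_neg (by omega)]

theorem coeff_of_mem {v : ℕ → ℝ} {n k : ℕ} (h : k ∈ Icc 1 n) :
    coeff v n k = (1 / 2 - if 2 * k ≤ n then 1 else 0) - v (2 * k) * coeff v n (2 * k) := by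
  rw [coeff, dif_pos (by simpa using h)]

theorem abs_coeff_le_one {v : ℕ → ℝ} (hv : ∀ k, |v k| ≤ 1 / 2) (n k : ℕ) :
    |coeff v n k| ≤ 1 := by
  induction h : n + 1 - k using Nat.strong_induction_on generalizing k with
  | _ m ih =>
    by_cases hk : k ∈ Icc 1 n
    · have hk' := mem_Icc.1 hk
      have h1 := ih (n + 1 - 2 * k) (by omega) (2 * k) rfl
      have h2 : |v (2 * k) * coeff v n (2 * k)| ≤ 1 / 2 := by
        rw [abs_mul]
        nlinarith [hv (2 * k), abs_nonneg (v (2 * k)), abs_nonneg (coeff v n (2 * k))]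
      rw [coeff_of_mem hk]
      rw [abs_le] at h2 ⊢
      split_ifs <;> constructor <;> linarith
    · rw [coeff, dif_neg (by simpa using hk)]
      simp

theorem sum_coeff_mul (v f : ℕ → ℝ) (n : ℕ) :
    ∑ k ∈ Icc 1 n, coeff v n k * (f k + v k * halfShift f k) =
      ∑ k ∈ Icc 1 n, (f k / 2 - halfShift f k) := by
  have hsum (h : ℕ → ℝ) :
      ∑ j ∈ Icc 1 (n / 2), h j = ∑ j ∈ Icc 1 n, if 2 * j ≤ n then h j else 0 := by
    rw [← sum_filter]
    refine sum_congr ?_ fun _ _ ↦ rfl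
    ext j
    simp only [mem_Icc, mem_filter]
    omega
  have h1 : ∑ k ∈ Icc 1 n, coeff v n k * (f k + v k * halfShift f k) =
      ∑ k ∈ Icc 1 n, coeff v n k * f k +
        ∑ k ∈ Icc 1 n, (coeff v n k * v k) * halfShift f k := by
    rw [← sum_add_distrib]
    exact sum_congr rfl fun k _ ↦ by ring
  rw [h1, sum_mul_halfShift, sum_sub_distrib, sum_halfShift, hsum, hsum, ← sum_add_distrib,
    ← sum_sub_distrib]
  refine sum_congr rfl fun k hk ↦ ?_
  rw [coeff_of_mem hk]
  split_ifs with h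
  · ring
  · rw [coeff_of_lt (not_le.1 h)]
    ring

/-- The probability that the `k`-th digit is `1` under the homogeneous measure: a digit whose
predecessor `k / 2` does not forbid it is `1` with probability `β`. -/
noncomputable def baseFreq (β : ℝ) (k : ℕ) : ℝ :=
  if k = 0 then 0 else if Even k then β * (1 - baseFreq β (k / 2)) else β
termination_by k
decreasing_by omega

theorem baseFreq_eq (β : ℝ) {k : ℕ} (hk : 1 ≤ k) :
    baseFreq β k = β * (1 - halfShift (baseFreq β) k) := by
  rw [baseFreq, if_neg (by omega), halfShift]
  split_ifs <;> simp

theorem baseFreq_mem {β : ℝ} (h0 : 0 ≤ β) (h1 : β ≤ 1) (k : ℕ) :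
    0 ≤ baseFreq β k ∧ baseFreq β k ≤ β := by
  induction k using Nat.strong_induction_on with
  | _ k ih =>
    rw [baseFreq]
    split_ifs with hk h
    · exact ⟨le_rfl, h0⟩
    · have := ih (k / 2) (by omega)
      constructor <;> nlinarith
    · exact ⟨h0, le_rfl⟩

theorem sum_baseFreq_add (β : ℝ) (n : ℕ) :
    ∑ k ∈ Icc 1 n, baseFreq β k + β * ∑ k ∈ Icc 1 (n / 2), baseFreq β k = β * n := by
  rw [← sum_halfShift, mul_sum, ← sum_add_distrib,
    sum_congr rfl fun k hk ↦ show _ = β by rw [baseFreq_eq β (mem_Icc.1 hk).1]; ring]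
  simp [mul_comm]

theorem neg_le_half_sum_baseFreq_sub {β : ℝ} (h0 : 0 ≤ β) (h1 : β ≤ 1 / 2) (n : ℕ) :
    -(3 / 2) ≤ (∑ k ∈ Icc 1 n, baseFreq β k) / 2 - ∑ k ∈ Icc 1 (n / 2), baseFreq β k := by
  obtain ⟨d, hd⟩ : ∃ d, d = 2 * β / (2 + β) := ⟨_, rfl⟩
  have hd' : d * (2 + β) = 2 * β := by rw [hd]; field_simp
  have hd0 : 0 ≤ d := by rw [hd]; positivity
  have hd1 : d ≤ 1 := by nlinarith
  have key (n : ℕ) : |∑ k ∈ Icc 1 n, baseFreq β k - d * n| ≤ 1 := by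
    induction n using Nat.strong_induction_on with
    | _ n ih =>
      rcases Nat.eq_zero_or_pos n with rfl | hn
      · simp
      have hm := ih (n / 2) (by omega)
      have hs := sum_baseFreq_add β n
      obtain ⟨r, hr, hr0, hr1⟩ : ∃ r : ℝ, (n : ℝ) = 2 * (n / 2 : ℕ) + r ∧ 0 ≤ r ∧ r ≤ 1 := by
        refine ⟨(n % 2 : ℕ), ?_, by positivity, ?_⟩
        · exact_mod_cast (Nat.div_add_mod n 2).symm
        · exact_mod_cast Nat.lt_succ_iff.1 (Nat.mod_lt n two_pos)
      rw [hr] at hs ⊢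
      generalize ∑ k ∈ Icc 1 n, baseFreq β k = x at *
      generalize ∑ k ∈ Icc 1 (n / 2), baseFreq β k = y at *
      generalize ((n / 2 : ℕ) : ℝ) = m at *
      have hx : x - d * (2 * m + r) = d * β / 2 * r - β * (y - d * m) := by
        linear_combination hs - (2 * m + r) / 2 * hd'
      rw [hx]
      rw [abs_le] at hm ⊢
      have : 0 ≤ d * β / 2 * r := by positivity
      have : d * β / 2 * r ≤ 1 / 4 := by
        calc d * β / 2 * r ≤ 1 * (1 / 2) / 2 * 1 := by gcongr
          _ = 1 / 4 := by norm_num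
      constructor <;> nlinarith
  have k1 := abs_le.1 (key n)
  have k2 := abs_le.1 (key (n / 2))
  have : d * (n / 2 : ℕ) ≤ d * (n / 2) := by
    gcongr
    exact Nat.cast_div_le
  linarith

/-- The digits produced from independent bits `ω`: the `k`-th digit is `ω k`, unless the digit at
`k / 2` is `1` and forces it to be `0`. -/
def digit (ω : ℕ → Bool) (k : ℕ) : Bool :=
  if k = 0 then false else ω k && !(decide (Even k) && digit ω (k / 2))
termination_by k
decreasing_by omega

/-- The digit at `k` is forced to be `0` by the digit at `k / 2`. -/
def blocked (ω : ℕ → Bool) (k : ℕ) : Bool := decide (Even k) && digit ω (k / 2)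

theorem digit_zero (ω : ℕ → Bool) : digit ω 0 = false := by
  rw [digit, if_pos rfl]

theorem digit_eq (ω : ℕ → Bool) {k : ℕ} (hk : 1 ≤ k) :
    digit ω k = (ω k && !blocked ω k) := by
  rw [digit, if_neg (by omega), blocked]

theorem digit_congr {ω ω' : ℕ → Bool} {k : ℕ} (h : ∀ i ≤ k, ω i = ω' i) :
    digit ω k = digit ω' k := by
  induction k using Nat.strong_induction_on with
  | _ k ih =>
    rcases Nat.eq_zero_or_pos k with rfl | hk
    · rw [digit_zero, digit_zero]
    · rw [digit_eq ω hk, digit_eq ω' hk, blocked, blocked, h k le_rfl,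
        ih (k / 2) (by omega) fun i hi ↦ h i (by omega)]

theorem blocked_congr {ω ω' : ℕ → Bool} {k : ℕ} (hk : 1 ≤ k) (h : ∀ i < k, ω i = ω' i) :
    blocked ω k = blocked ω' k := by
  rw [blocked, blocked, digit_congr fun i hi ↦ h i (by omega)]

theorem blocked_eq_of_digit_eq {ω ω' : ℕ → Bool} {k : ℕ} (hk : 1 ≤ k)
    (h : ∀ i < k, digit ω i = digit ω' i) : blocked ω k = blocked ω' k := by
  rw [blocked, blocked, h (k / 2) (by omega)]

/-- The law of independent bits with success probabilities `w k`. -/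
noncomputable def bitMeasure (w : ℕ → unitInterval) : Measure (ℕ → Bool) :=
  Measure.infinitePi fun k ↦ ProbabilityTheory.bernoulliMeasure true false (w k)

instance (w : ℕ → unitInterval) : IsProbabilityMeasure (bitMeasure w) := by
  unfold bitMeasure; infer_instance

theorem measurable_of_dependsOn_lt {α : Type*} [MeasurableSpace α] {k : ℕ}
    {F : (ℕ → Bool) → α} (hF : ∀ ω ω', (∀ i < k, ω i = ω' i) → F ω = F ω') :
    Measurable F := by
  have : F = (fun η : range k → Bool ↦ F fun i ↦ if h : i ∈ range k then η ⟨i, h⟩ else false) ∘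
      (range k).restrict := by
    ext ω
    refine hF _ _ fun i hi ↦ ?_
    rw [dif_pos (mem_range.2 hi)]
    rfl
  rw [this]
  exact (measurable_of_countable _).comp (measurable_restrict _)

theorem measurable_digit (k : ℕ) : Measurable fun ω ↦ digit ω k :=
  measurable_of_dependsOn_lt (k := k + 1) fun _ _ h ↦
    digit_congr fun i hi ↦ h i (Nat.lt_succ_of_le hi)

theorem lintegral_bernoulliMeasure (t : unitInterval) (g : Bool → ENNReal) :
    ∫⁻ b, g b ∂(ProbabilityTheory.bernoulliMeasure true false t) =
      ENNReal.ofReal t * g true + ENNReal.ofReal (1 - t) * g false := by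
  have h (s : unitInterval) : ENNReal.ofReal s = (unitInterval.toNNReal s : ENNReal) := by
    rw [ENNReal.ofReal, ENNReal.coe_inj]
    ext
    simpa using s.2.1
  rw [ProbabilityTheory.bernoulliMeasure_def, lintegral_add_measure, lintegral_smul_measure,
    lintegral_smul_measure, lintegral_dirac, lintegral_dirac, h, ← unitInterval.coe_symm_eq, h]
  rfl

theorem lintegral_mul_eval (w : ℕ → unitInterval) {k : ℕ} {F : (ℕ → Bool) → ENNReal}
    (hF : ∀ ω ω', (∀ i < k, ω i = ω' i) → F ω = F ω') (g : Bool → ENNReal) :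
    ∫⁻ ω, F ω * g (ω k) ∂(bitMeasure w) = (∫⁻ ω, F ω ∂(bitMeasure w)) *
      (ENNReal.ofReal (w k) * g true + ENNReal.ofReal (1 - w k) * g false) := by
  have hg : ∫⁻ ω, g (ω k) ∂(bitMeasure w) =
      ENNReal.ofReal (w k) * g true + ENNReal.ofReal (1 - w k) * g false := by
    rw [← lintegral_bernoulliMeasure, bitMeasure]
    exact (measurePreserving_eval_infinitePi
      (fun k ↦ ProbabilityTheory.bernoulliMeasure true false (w k)) k).lintegral_comp
        (measurable_of_countable g)
  rw [← hg]
  have hind : ProbabilityTheory.iIndepFun (fun (i : ℕ) (ω : ℕ → Bool) ↦ ω i) (bitMeasure w) :=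
    ProbabilityTheory.iIndepFun_infinitePi (X := fun _ b ↦ b) fun _ ↦ measurable_id
  have hind' := hind.indepFun_finset (range k) {k} (by simp) fun i ↦ measurable_pi_apply i
  have hFg := hind'.comp
    (φ := fun η : range k → Bool ↦ F fun i ↦ if h : i ∈ range k then η ⟨i, h⟩ else false)
    (ψ := fun η : ({k} : Finset ℕ) → Bool ↦ g (η ⟨k, by simp⟩))
    (measurable_of_countable _) (measurable_of_countable _)
  refine ProbabilityTheory.lintegral_mul_eq_lintegral_mul_lintegral_of_indepFun''
    (measurable_of_dependsOn_lt hF).aemeasurable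
    ((measurable_of_countable g).comp (measurable_pi_apply k)).aemeasurable ?_
  convert hFg using 1
  · ext ω
    refine hF _ _ fun i hi ↦ ?_
    rw [dif_pos (mem_range.2 hi)]
  · rfl

theorem sum_blocked_congr (Y : ℕ → Bool → ℝ) {ω ω' : ℕ → Bool} {n : ℕ}
    (h : ∀ i < n + 1, ω i = ω' i) :
    ∑ k ∈ Icc 1 n, (if blocked ω k then 0 else Y k (ω k)) =
      ∑ k ∈ Icc 1 n, if blocked ω' k then 0 else Y k (ω' k) := by
  refine sum_congr rfl fun k hk ↦ ?_
  rw [mem_Icc] at hk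
  rw [h k (by omega), blocked_congr hk.1 fun i hi ↦ h i (by omega)]

theorem lintegral_exp_sum_le {w : ℕ → unitInterval} {Y : ℕ → Bool → ℝ} {c : ℕ → ℝ}
    (hc : ∀ k, 0 ≤ c k)
    (hY : ∀ k, (w k : ℝ) * Real.exp (Y k true) + (1 - w k) * Real.exp (Y k false) ≤
      Real.exp (c k)) (n : ℕ) :
    ∫⁻ ω, ENNReal.ofReal (Real.exp (∑ k ∈ Icc 1 n, if blocked ω k then 0 else Y k (ω k)))
      ∂(bitMeasure w) ≤ ENNReal.ofReal (Real.exp (∑ k ∈ Icc 1 n, c k)) := by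
  induction n with
  | zero => simp
  | succ n ih =>
    set M : (ℕ → Bool) → ENNReal := fun ω ↦
      ENNReal.ofReal (Real.exp (∑ k ∈ Icc 1 n, if blocked ω k then 0 else Y k (ω k))) with hM
    have hMc (ω ω' : ℕ → Bool) (h : ∀ i < n + 1, ω i = ω' i) : M ω = M ω' := by
      simp only [hM, sum_blocked_congr Y h]
    have hbc (ω ω' : ℕ → Bool) (h : ∀ i < n + 1, ω i = ω' i) :
        blocked ω (n + 1) = blocked ω' (n + 1) := blocked_congr (by omega) h
    set F : Bool → (ℕ → Bool) → ENNReal := fun b ω ↦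
      if blocked ω (n + 1) = b then M ω else 0 with hF
    have hFc (b : Bool) (ω ω' : ℕ → Bool) (h : ∀ i < n + 1, ω i = ω' i) : F b ω = F b ω' := by
      simp only [hF, hMc ω ω' h, hbc ω ω' h]
    have hFm (b : Bool) : Measurable (F b) := measurable_of_dependsOn_lt (hFc b)
    have hMF (ω : ℕ → Bool) : M ω = F true ω + F false ω := by
      simp only [hF]
      cases blocked ω (n + 1) <;> simp
    set r := ENNReal.ofReal (Real.exp (c (n + 1))) with hr
    have hr1 : 1 ≤ r := by
      rw [hr, ENNReal.one_le_ofReal]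
      exact Real.one_le_exp (hc _)
    have hr2 : ENNReal.ofReal (w (n + 1)) * ENNReal.ofReal (Real.exp (Y (n + 1) true)) +
        ENNReal.ofReal (1 - w (n + 1)) * ENNReal.ofReal (Real.exp (Y (n + 1) false)) ≤ r := by
      have h0 := (w (n + 1)).2.1
      have h1 : 0 ≤ 1 - (w (n + 1) : ℝ) := sub_nonneg.2 (w (n + 1)).2.2
      rw [← ENNReal.ofReal_mul h0, ← ENNReal.ofReal_mul h1,
        ← ENNReal.ofReal_add (by positivity) (by positivity)]
      exact ENNReal.ofReal_le_ofReal (hY (n + 1))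
    calc ∫⁻ ω, ENNReal.ofReal (Real.exp
          (∑ k ∈ Icc 1 (n + 1), if blocked ω k then 0 else Y k (ω k))) ∂(bitMeasure w)
        = ∫⁻ ω, (F true ω + F false ω * ENNReal.ofReal (Real.exp (Y (n + 1) (ω (n + 1)))))
            ∂(bitMeasure w) := by
          refine lintegral_congr fun ω ↦ ?_
          rw [sum_Icc_succ_top (by omega), Real.exp_add, ENNReal.ofReal_mul (Real.exp_nonneg _)]
          simp only [hF, hM]
          cases blocked ω (n + 1) <;> simp
      _ = ∫⁻ ω, F true ω ∂(bitMeasure w) + (∫⁻ ω, F false ω ∂(bitMeasure w)) *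
            (ENNReal.ofReal (w (n + 1)) * ENNReal.ofReal (Real.exp (Y (n + 1) true)) +
              ENNReal.ofReal (1 - w (n + 1)) *
                ENNReal.ofReal (Real.exp (Y (n + 1) false))) := by
          rw [lintegral_add_left (hFm true), lintegral_mul_eval w (hFc false)
            fun b ↦ ENNReal.ofReal (Real.exp (Y (n + 1) b))]
      _ ≤ (∫⁻ ω, F true ω ∂(bitMeasure w)) * r + (∫⁻ ω, F false ω ∂(bitMeasure w)) * r := by
          gcongr
          exact le_mul_of_one_le_right' hr1
      _ = (∫⁻ ω, M ω ∂(bitMeasure w)) * r := by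
          rw [← add_mul, ← lintegral_add_left (hFm true)]
          simp only [hMF]
      _ ≤ ENNReal.ofReal (Real.exp (∑ k ∈ Icc 1 n, c k)) * r := by gcongr
      _ = _ := by
          rw [sum_Icc_succ_top (by omega), Real.exp_add, ENNReal.ofReal_mul (Real.exp_nonneg _)]

/-- The logarithm of the conditional probability of the `k`-th digit given the preceding ones. -/
noncomputable def logWeight (w : ℕ → ℝ) (ω : ℕ → Bool) (k : ℕ) : ℝ :=
  if blocked ω k then 0 else if ω k then Real.log (w k) else Real.log (1 - w k)

theorem measure_cylinder_le {w : ℕ → unitInterval} (h0 : ∀ k, 0 < (w k : ℝ))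
    (h1 : ∀ k, (w k : ℝ) < 1) (ω : ℕ → Bool) (n : ℕ) :
    bitMeasure w {ω' | ∀ k ∈ Icc 1 n, digit ω' k = digit ω k} ≤
      ENNReal.ofReal (Real.exp (∑ k ∈ Icc 1 n, logWeight (fun k ↦ w k) ω k)) := by
  have hsub : {ω' | ∀ k ∈ Icc 1 n, digit ω' k = digit ω k} ⊆
      Set.pi ((Icc 1 n).filter fun k ↦ blocked ω k = false) fun k ↦ {ω k} := by
    intro ω' h k hk
    rw [mem_coe, mem_filter] at hk
    have hk1 := mem_Icc.1 hk.1
    have hd := h k hk.1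
    rw [digit_eq _ hk1.1, digit_eq _ hk1.1, blocked_eq_of_digit_eq hk1.1 (ω' := ω), hk.2] at hd
    · simpa using hd
    · intro i hi
      rcases Nat.eq_zero_or_pos i with rfl | hi0
      · rw [digit_zero, digit_zero]
      · exact h i (mem_Icc.2 ⟨hi0, by omega⟩)
  refine (measure_mono hsub).trans ?_
  rw [bitMeasure, Measure.infinitePi_pi _ fun _ _ ↦ .singleton _, prod_filter, Real.exp_sum,
    ENNReal.ofReal_prod_of_nonneg fun _ _ ↦ Real.exp_nonneg _]
  refine prod_le_prod' fun k _ ↦ ?_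
  have h1' := sub_pos.2 (h1 k)
  rw [logWeight]
  cases hb : blocked ω k
  · have := lintegral_bernoulliMeasure (w k) (Set.indicator {ω k} 1)
    rw [lintegral_indicator_one (.singleton _)] at this
    rw [if_pos rfl, this]
    cases hω : ω k <;> simp [Real.exp_log (h0 k), Real.exp_log h1']
  · simp

theorem bernoulli_exp_le {t r K y₁ y₀ : ℝ} (ht0 : 0 ≤ t) (ht1 : t ≤ 1) (hr : 0 ≤ r)
    (hrK : r * K ≤ 1) (h₁ : |y₁| ≤ K) (h₀ : |y₀| ≤ K) :
    t * Real.exp (r * y₁) + (1 - t) * Real.exp (r * y₀) ≤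
      Real.exp (r * (t * y₁ + (1 - t) * y₀) + r ^ 2 * K ^ 2) := by
  have key {y : ℝ} (hy : |y| ≤ K) : Real.exp (r * y) ≤ 1 + r * y + r ^ 2 * K ^ 2 := by
    have h : |r * y| ≤ r * K := by
      rw [abs_mul, abs_of_nonneg hr]
      gcongr
    have h2 := (abs_le.1 (Real.abs_exp_sub_one_sub_id_le (h.trans hrK))).2
    have h3 : (r * y) ^ 2 ≤ r ^ 2 * K ^ 2 := by
      rw [← mul_pow]
      exact sq_le_sq' (abs_le.1 h).1 (abs_le.1 h).2
    linarith
  have := Real.add_one_le_exp (r * (t * y₁ + (1 - t) * y₀) + r ^ 2 * K ^ 2)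
  nlinarith [mul_le_mul_of_nonneg_left (key h₁) ht0,
    mul_le_mul_of_nonneg_left (key h₀) (sub_nonneg.2 ht1)]

theorem exists_weights {β ℓ : ℝ} (hβ : 0 < β) (hβ' : β ≤ 1 / 2) (hℓ : 0 < ℓ) :
    ∃ v : ℕ → ℝ, (∀ k, β / 2 ≤ v k ∧ v k ≤ β) ∧ ∃ C κ : ℝ, 0 < κ ∧ ∀ n,
      ∑ k ∈ Icc 1 n, ((v k - β) ^ 2 / (β * (1 - β)) - ℓ * (coeff v n k * v k)) ≤
        C - κ * ∑ j ∈ Icc 1 (n / 2), 1 / (((Nat.log 2 j : ℝ) + 1) * (Nat.log 2 j + 2)) := by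
  obtain ⟨c, hc0, hc1, hc2⟩ : ∃ c : ℝ, 0 < c ∧ c ≤ β / 6 ∧ c ≤ ℓ * β / 144 :=
    ⟨min (β / 6) (ℓ * β / 144), by positivity, min_le_left _ _, min_le_right _ _⟩
  set L : ℕ → ℝ := fun k ↦ (Nat.log 2 k : ℝ) + 1 with hL
  have hL1 (k : ℕ) : 1 ≤ L k := by simp [hL]
  have hLdiv {k : ℕ} (hk : 2 ≤ k) : L k = L (k / 2) + 1 := by
    simp only [hL, Nat.log_of_one_lt_of_le one_lt_two hk]
    push_cast
    ring
  set e : ℕ → ℝ := fun k ↦ if k = 0 then 0 else -(c / L k) with he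
  have he_of {k : ℕ} (hk : 1 ≤ k) : e k = -(c / L k) := by
    simp only [he]
    rw [if_neg (by omega)]
  have hcL (k : ℕ) : 0 ≤ c / L k ∧ c / L k ≤ c := by
    have := hL1 k
    exact ⟨by positivity, div_le_self hc0.le this⟩
  have he_mem (k : ℕ) : -c ≤ e k ∧ e k ≤ 0 := by
    have := hcL k
    simp only [he]
    split_ifs <;> constructor <;> linarith
  set q : ℕ → ℝ := fun k ↦ baseFreq β k + e k with hq
  have hq_le (k : ℕ) : q k ≤ 1 / 2 := by
    have := (baseFreq_mem hβ.le (by linarith) k).2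
    simp only [hq]
    linarith [(he_mem k).2]
  have hhs (k : ℕ) : halfShift q k ≤ 1 / 2 := by
    rw [halfShift]
    split_ifs
    · exact hq_le _
    · norm_num
  have hhsq (k : ℕ) : halfShift q k = halfShift (baseFreq β) k + halfShift e k := by
    simp only [halfShift, hq]
    split_ifs <;> simp
  have hhse (k : ℕ) : -c ≤ halfShift e k ∧ halfShift e k ≤ 0 := by
    rw [halfShift]
    split_ifs
    · exact he_mem _
    · constructor <;> linarith
  set v : ℕ → ℝ := fun k ↦ if k = 0 then β else q k / (1 - halfShift q k) with hv
  have hv_of {k : ℕ} (hk : 1 ≤ k) : v k * (1 - halfShift q k) = q k := by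
    simp only [hv]
    rw [if_neg (by omega), div_mul_cancel₀ _ (by linarith [hhs k])]
  have hv_sub {k : ℕ} (hk : 1 ≤ k) :
      (β - v k) * (1 - halfShift q k) = -(e k + β * halfShift e k) := by
    rw [sub_mul, hv_of hk]
    simp only [hq]
    rw [baseFreq_eq β hk]
    change _ * (1 - halfShift q k) - _ = _
    rw [hhsq]
    ring
  have hv_bound {k : ℕ} (hk : 1 ≤ k) {t : ℝ} (h1 : -t ≤ e k) (h2 : -t ≤ halfShift e k) :
      0 ≤ β - v k ∧ β - v k ≤ 3 * t := by
    have h3 := hv_sub hk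
    have h4 := hhs k
    have h5 := (he_mem k).2
    have h6 := (hhse k).2
    have h7 : 0 ≤ β - v k := by
      by_contra! h
      nlinarith
    refine ⟨h7, ?_⟩
    nlinarith
  have hv_mem (k : ℕ) : β / 2 ≤ v k ∧ v k ≤ β := by
    rcases Nat.eq_zero_or_pos k with rfl | hk
    · simp only [hv, if_true]
      constructor <;> linarith
    · have := hv_bound hk (he_mem k).1 (hhse k).1
      constructor <;> linarith
  set χ : ℕ → ℝ := fun k ↦ (v k - β) ^ 2 / (β * (1 - β)) with hχ
  have hβ1 : 1 / 2 ≤ 1 - β := by linarith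
  have hχ0 (k : ℕ) : 0 ≤ χ k := by simp only [hχ]; positivity
  have hχ_le {j k : ℕ} (hj : 1 ≤ j) (hk : k / 2 = j) :
      χ k ≤ ℓ * c / 4 * (1 / (L j * (L j + 1))) := by
    have hLj := hL1 j
    have hLk : L k = L j + 1 := by rw [hLdiv (by omega), hk]
    have hcLj : c / L k ≤ c / L j := by
      rw [hLk]
      gcongr
      linarith
    have h1 : -(c / L j) ≤ e k := by
      rw [he_of (by omega)]
      linarith
    have h2 : -(c / L j) ≤ halfShift e k := by
      rw [halfShift, hk]
      split_ifs
      · rw [he_of hj]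
      · linarith [(hcL j).1]
    have h3 := hv_bound (by omega) h1 h2
    have h4 : (v k - β) ^ 2 ≤ (3 * (c / L j)) ^ 2 := by
      rw [← neg_sub, neg_sq]
      exact pow_le_pow_left₀ h3.1 h3.2 2
    calc χ k ≤ (3 * (c / L j)) ^ 2 / (β * (1 / 2)) := by
          simp only [hχ]
          gcongr
      _ = 18 * c * c / (β * (L j * L j)) := by
          field_simp
          ring
      _ ≤ 18 * c * (ℓ * β / 144) / (β * (L j * ((L j + 1) / 2))) := by
          gcongr
          linarith
      _ = ℓ * c / 4 * (1 / (L j * (L j + 1))) := by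
          field_simp
          ring
  refine ⟨v, hv_mem, χ 1 - ℓ / 2 * e 1 + 3 / 2 * ℓ, ℓ * c / 2, by positivity, fun n ↦ ?_⟩
  have hmean : ∑ k ∈ Icc 1 n, coeff v n k * v k =
      (∑ k ∈ Icc 1 n, q k) / 2 - ∑ k ∈ Icc 1 (n / 2), q k := by
    rw [← sum_halfShift q n, sum_div, ← sum_sub_distrib, ← sum_coeff_mul v]
    refine sum_congr rfl fun k hk ↦ ?_
    congr 1
    linarith [hv_of (mem_Icc.1 hk).1]
  have hbase := neg_le_half_sum_baseFreq_sub hβ.le hβ' n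
  have hpairs := sum_Icc_le_add_sum_pairs (f := fun k ↦ χ k - ℓ / 2 * e k)
    (fun k ↦ by nlinarith [hχ0 k, (he_mem k).2]) n
  have hterm : ∑ j ∈ Icc 1 (n / 2), (χ (2 * j) - ℓ / 2 * e (2 * j) +
      (χ (2 * j + 1) - ℓ / 2 * e (2 * j + 1))) ≤ ∑ j ∈ Icc 1 (n / 2),
        (-(ℓ * e j) - ℓ * c / 2 * (1 / (L j * (L j + 1)))) := by
    refine sum_le_sum fun j hj ↦ ?_
    have hj1 := (mem_Icc.1 hj).1
    have hLj := hL1 j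
    have h1 := hχ_le hj1 (k := 2 * j) (by omega)
    have h2 := hχ_le hj1 (k := 2 * j + 1) (by omega)
    have h3 : e (2 * j) = -(c / (L j + 1)) := by
      rw [he_of (by omega), hLdiv (by omega), show 2 * j / 2 = j by omega]
    have h4 : e (2 * j + 1) = -(c / (L j + 1)) := by
      rw [he_of (by omega), hLdiv (by omega), show (2 * j + 1) / 2 = j by omega]
    have h5 : c / L j - c / (L j + 1) = c * (1 / (L j * (L j + 1))) := by
      field_simp
      ring
    rw [h3, h4, he_of hj1]
    linear_combination h1 + h2 - ℓ * h5
  have hLsum : ∑ j ∈ Icc 1 (n / 2), 1 / (((Nat.log 2 j : ℝ) + 1) * (Nat.log 2 j + 2)) =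
      ∑ j ∈ Icc 1 (n / 2), 1 / (L j * (L j + 1)) :=
    sum_congr rfl fun j _ ↦ by simp only [hL]; ring_nf
  rw [hLsum]
  rw [sum_sub_distrib, ← mul_sum] at hterm hpairs ⊢
  rw [hmean]
  simp only [hq, sum_add_distrib]
  rw [sum_neg_distrib, ← mul_sum] at hterm
  nlinarith

/-- The real number with binary digits `digit ω 1, digit ω 2, …`. -/
noncomputable def value (ω : ℕ → Bool) : ℝ :=
  ∑' k : ℕ, ((digit ω (k + 1)).toNat : ℝ) / 2 ^ (k + 1)

/-- The integer with binary digits `digit ω 1, …, digit ω n`. -/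
def prefixNat (ω : ℕ → Bool) : ℕ → ℕ
  | 0 => 0
  | n + 1 => 2 * prefixNat ω n + (digit ω (n + 1)).toNat

theorem digit_eq_of_prefixNat_eq {ω ω' : ℕ → Bool} {n : ℕ} (h : prefixNat ω n = prefixNat ω' n) :
    ∀ k ∈ Icc 1 n, digit ω k = digit ω' k := by
  induction n with
  | zero => simp
  | succ n ih =>
    intro k hk
    rw [prefixNat, prefixNat] at h
    have h1 := Bool.toNat_le (digit ω (n + 1))
    have h2 := Bool.toNat_le (digit ω' (n + 1))
    rcases (mem_Icc.1 hk).2.eq_or_lt with rfl | hlt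
    · have h3 : (digit ω (n + 1)).toNat = (digit ω' (n + 1)).toNat := by omega
      cases h4 : digit ω (n + 1) <;> cases h5 : digit ω' (n + 1) <;> simp_all
    · exact ih (by omega) k (mem_Icc.2 ⟨(mem_Icc.1 hk).1, by omega⟩)

theorem digit_term_le (ω : ℕ → Bool) (k : ℕ) :
    ((digit ω (k + 1)).toNat : ℝ) / 2 ^ (k + 1) ≤ (1 / 2) ^ (k + 1) := by
  rw [one_div, inv_pow, ← one_div]
  gcongr
  exact_mod_cast Bool.toNat_le _

theorem summable_digit (ω : ℕ → Bool) :
    Summable fun k : ℕ ↦ ((digit ω (k + 1)).toNat : ℝ) / 2 ^ (k + 1) :=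
  .of_nonneg_of_le (fun _ ↦ by positivity) (digit_term_le ω)
    ((summable_nat_add_iff 1).2 summable_geometric_two)

theorem sum_range_digit (ω : ℕ → Bool) (n : ℕ) :
    ∑ k ∈ range n, ((digit ω (k + 1)).toNat : ℝ) / 2 ^ (k + 1) = prefixNat ω n / 2 ^ n := by
  induction n with
  | zero => simp [prefixNat]
  | succ n ih =>
    rw [sum_range_succ, ih, prefixNat]
    push_cast
    field_simp
    ring

theorem value_mem_Icc (ω : ℕ → Bool) (n : ℕ) :
    value ω * 2 ^ n ∈ Set.Icc (prefixNat ω n : ℝ) (prefixNat ω n + 1) := by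
  have h1 := (summable_digit ω).sum_add_tsum_nat_add n
  rw [sum_range_digit] at h1
  have h2 : 0 ≤ ∑' k : ℕ, ((digit ω (k + n + 1)).toNat : ℝ) / 2 ^ (k + n + 1) :=
    tsum_nonneg fun _ ↦ by positivity
  have h3 : ∑' k : ℕ, ((digit ω (k + n + 1)).toNat : ℝ) / 2 ^ (k + n + 1) ≤ 1 / 2 ^ n := by
    have hg : HasSum (fun k : ℕ ↦ (1 / 2 : ℝ) ^ (k + n + 1)) (1 / 2 ^ n) := by
      have h := hasSum_geometric_two.mul_left ((1 / 2 : ℝ) ^ (n + 1))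
      have h1 : (1 / 2 : ℝ) ^ (n + 1) * 2 = 1 / 2 ^ n := by
        rw [pow_succ, mul_assoc, one_div_pow]
        norm_num
      have h2 : (fun k : ℕ ↦ (1 / 2 : ℝ) ^ (k + n + 1)) =
          fun k ↦ (1 / 2 : ℝ) ^ (n + 1) * (1 / 2) ^ k := by
        funext k
        ring
      rwa [h2, ← h1]
    rw [← hg.tsum_eq]
    exact ((summable_nat_add_iff n).2 (summable_digit ω)).tsum_le_tsum
      (fun k ↦ digit_term_le ω (k + n)) hg.summable
  have h4 : value ω * 2 ^ n = prefixNat ω n +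
      (∑' k : ℕ, ((digit ω (k + n + 1)).toNat : ℝ) / 2 ^ (k + n + 1)) * 2 ^ n := by
    rw [value, ← h1]
    field_simp
  rw [h4]
  have h5 : (0 : ℝ) < 2 ^ n := by positivity
  rw [le_div_iff₀ h5] at h3
  exact ⟨by nlinarith, by linarith⟩

theorem measurable_value : Measurable value := by
  have h (n : ℕ) : Measurable fun ω ↦
      ∑ k ∈ range n, ((digit ω (k + 1)).toNat : ℝ) / 2 ^ (k + 1) :=
    Finset.measurable_sum _ fun k _ ↦
      ((measurable_of_countable fun b : Bool ↦ (b.toNat : ℝ)).comp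
        (measurable_digit (k + 1))).div_const _
  refine measurable_of_tendsto_metrizable h (tendsto_pi_nhds.2 fun ω ↦ ?_)
  exact (summable_digit ω).hasSum.tendsto_sum_nat

theorem value_mem_XiG (ω : ℕ → Bool) : value ω ∈ XiG := by
  refine ⟨fun k ↦ (digit ω k).toNat, fun k _ ↦ ?_, fun k hk ↦ ?_, rfl⟩
  · cases digit ω k <;> simp
  · dsimp only
    rw [digit_eq ω (show 1 ≤ 2 * k by omega), blocked, Nat.mul_div_cancel_left k two_pos]
    cases digit ω k <;> simp

theorem measure_value_preimage_le {Q : Measure (ℕ → Bool)} {G : Set (ℕ → Bool)} {n : ℕ}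
    {a : ENNReal}
    (hG : ∀ ω ∈ G, Q {ω' | ∀ k ∈ Icc 1 n, digit ω' k = digit ω k} ≤ a)
    {U : Set ℝ} (hU : Metric.ediam U ≤ ENNReal.ofReal ((1 / 2) ^ n)) :
    Q (value ⁻¹' U ∩ G) ≤ 5 * a := by
  rcases Set.eq_empty_or_nonempty (value ⁻¹' U ∩ G) with hemp | ⟨ω₀, hω₀, -⟩
  · simp [hemp]
  have hsub : value ⁻¹' U ∩ G ⊆ ⋃ i ∈ Icc (prefixNat ω₀ n - 2) (prefixNat ω₀ n + 2),
      {ω | ω ∈ G ∧ prefixNat ω n = i} := by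
    rintro ω ⟨hω, hωG⟩
    have h1 : dist (value ω) (value ω₀) ≤ (1 / 2) ^ n := by
      have := (Metric.edist_le_ediam_of_mem (s := U) hω hω₀).trans hU
      rwa [edist_dist, ENNReal.ofReal_le_ofReal_iff (by positivity)] at this
    have h2 := value_mem_Icc ω n
    have h3 := value_mem_Icc ω₀ n
    have h4 : |value ω * 2 ^ n - value ω₀ * 2 ^ n| ≤ 1 := by
      rw [← sub_mul, abs_mul, abs_of_pos (show (0 : ℝ) < 2 ^ n by positivity)]
      calc |value ω - value ω₀| * 2 ^ n ≤ (1 / 2) ^ n * 2 ^ n := by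
            gcongr
            exact h1
        _ = 1 := by rw [← mul_pow]; norm_num
    rw [abs_le] at h4
    have h5 : (prefixNat ω n : ℝ) ≤ (prefixNat ω₀ n + 2 : ℕ) := by
      push_cast
      linarith [h2.1, h3.2]
    have h6 : (prefixNat ω₀ n : ℝ) ≤ (prefixNat ω n + 2 : ℕ) := by
      push_cast
      linarith [h2.2, h3.1]
    rw [Nat.cast_le] at h5 h6
    simp only [Set.mem_iUnion]
    exact ⟨prefixNat ω n, mem_Icc.2 ⟨by omega, h5⟩, hωG, rfl⟩
  calc Q (value ⁻¹' U ∩ G)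
      ≤ ∑ i ∈ Icc (prefixNat ω₀ n - 2) (prefixNat ω₀ n + 2),
          Q {ω | ω ∈ G ∧ prefixNat ω n = i} :=
        (measure_mono hsub).trans (measure_biUnion_finset_le _ _)
    _ ≤ ∑ i ∈ Icc (prefixNat ω₀ n - 2) (prefixNat ω₀ n + 2), a := by
        refine sum_le_sum fun i _ ↦ ?_
        rcases Set.eq_empty_or_nonempty {ω | ω ∈ G ∧ prefixNat ω n = i} with hemp | ⟨ω₁, h⟩
        · simp [hemp]
        · exact (measure_mono fun ω hω ↦ digit_eq_of_prefixNat_eq (hω.2.trans h.2.symm)).trans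
            (hG ω₁ h.1)
    _ ≤ 5 * a := by
        rw [sum_const, Nat.card_Icc, nsmul_eq_mul]
        gcongr
        exact_mod_cast show _ ≤ 5 by omega

/-- A mass distribution principle: a measure whose cylinders of order `n` have mass at most
`p ^ n / n` does not charge sets of finite Hausdorff measure of dimension `-log₂ p`. -/
theorem measure_value_preimage_eq_zero {Q : Measure (ℕ → Bool)} [IsFiniteMeasure Q] {p : ℝ}
    (hp0 : 0 < p) (hp1 : p < 1) {G : Set (ℕ → Bool)} {N : ℕ}
    (hG : ∀ n ≥ N, ∀ ω ∈ G, Q {ω' | ∀ k ∈ Icc 1 n, digit ω' k = digit ω k} ≤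
      ENNReal.ofReal (p ^ n / n))
    {S : Set ℝ} (hS : μH[-Real.logb 2 p] S < ⊤) : Q (value ⁻¹' S ∩ G) = 0 := by
  set s := -Real.logb 2 p with hs
  have hs0 : 0 < s := neg_pos.2 (Real.logb_neg one_lt_two hp0 hp1)
  have hps : ((1 / 2 : ℝ)) ^ s = p := by
    rw [one_div, Real.inv_rpow two_pos.le, hs, Real.rpow_neg two_pos.le, inv_inv,
      Real.rpow_logb two_pos (by norm_num) hp0]
  set ν := (Q.restrict G).map value with hν
  have hνU (U : Set ℝ) {n : ℕ} (hn : N ≤ n)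
      (hU : Metric.ediam U ≤ ENNReal.ofReal ((1 / 2) ^ n)) :
      ν U ≤ 5 * ENNReal.ofReal (p ^ n / n) := by
    calc ν U ≤ ν (closure U) := measure_mono subset_closure
      _ = Q (value ⁻¹' closure U ∩ G) := by
        rw [hν, Measure.map_apply measurable_value isClosed_closure.measurableSet,
          Measure.restrict_apply (measurable_value isClosed_closure.measurableSet)]
      _ ≤ _ := measure_value_preimage_le (hG n hn) (by rwa [Metric.ediam_closure])
  have hlim : Filter.Tendsto (fun n : ℕ ↦ 5 * ENNReal.ofReal (p ^ n / n)) Filter.atTop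
      (nhds 0) := by
    have h : Filter.Tendsto (fun n : ℕ ↦ p ^ n / n) Filter.atTop (nhds 0) := by
      have := (tendsto_pow_atTop_nhds_zero_of_lt_one hp0.le hp1).mul
        (tendsto_inv_atTop_nhds_zero_nat (𝕜 := ℝ))
      simpa [div_eq_mul_inv] using this
    have := ENNReal.Tendsto.const_mul (a := 5) (ENNReal.tendsto_ofReal h) (Or.inr (by simp))
    simpa using this
  have hscale (K : NNReal) : K * ν S ≤ μH[s] S := by
    obtain ⟨M, hM⟩ := exists_nat_ge (5 * K / p : ℝ)
    have hle : K • ν ≤ μH[s] := by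
      refine Measure.le_hausdorffMeasure s (K • ν) (ENNReal.ofReal ((1 / 2) ^ (max N (M + 1))))
        (by simp) fun U hU ↦ ?_
      rw [Measure.smul_apply, ENNReal.smul_def, smul_eq_mul]
      rcases eq_or_ne (Metric.ediam U) 0 with h0 | h0
      · have hν0 : ν U = 0 := le_antisymm (ge_of_tendsto hlim <| by
          filter_upwards [Filter.eventually_ge_atTop N] with n hn
          exact hνU U hn (by simp [h0])) zero_le
        simp [hν0]
      · have htop : Metric.ediam U ≠ ⊤ := ne_top_of_le_ne_top ENNReal.ofReal_ne_top hU
        obtain ⟨d, hd⟩ : ∃ d, d = (Metric.ediam U).toReal := ⟨_, rfl⟩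
        have hdU : Metric.ediam U = ENNReal.ofReal d := by rw [hd, ENNReal.ofReal_toReal htop]
        have hd0 : 0 < d := hd ▸ ENNReal.toReal_pos h0 htop
        rw [hdU, ENNReal.ofReal_le_ofReal_iff (by positivity)] at hU
        obtain ⟨n, hn1, hn2⟩ := exists_nat_pow_near_of_lt_one hd0
          (hU.trans (pow_le_one₀ (by norm_num) (by norm_num))) (one_half_pos (α := ℝ))
          one_half_lt_one
        have hnN : max N (M + 1) ≤ n := by
          have := (pow_lt_pow_iff_right_of_lt_one₀ (one_half_pos (α := ℝ))
            one_half_lt_one).1 (hn1.trans_le hU)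
          omega
        have hn0 : 0 < (n : ℝ) := by exact_mod_cast show 0 < n by omega
        have hKn : 5 * K ≤ p * n := by
          have : (M : ℝ) ≤ n := by exact_mod_cast show M ≤ n by omega
          rw [div_le_iff₀ hp0] at hM
          nlinarith
        have hpn : p ^ (n + 1) ≤ d ^ s := by
          calc p ^ (n + 1) = ((1 / 2 : ℝ) ^ (n + 1)) ^ s := by
                rw [← Real.rpow_natCast (1 / 2), ← Real.rpow_mul (by norm_num), mul_comm,
                  Real.rpow_mul (by norm_num), hps, Real.rpow_natCast]
            _ ≤ d ^ s := Real.rpow_le_rpow (by positivity) hn1.le hs0.le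
        calc (K : ENNReal) * ν U ≤ K * (5 * ENNReal.ofReal (p ^ n / n)) := by
              gcongr
              exact hνU U (by omega) (by rw [hdU]; exact ENNReal.ofReal_le_ofReal hn2)
          _ = ENNReal.ofReal (5 * K * (p ^ n / n)) := by
              rw [ENNReal.ofReal_mul (by positivity), ENNReal.ofReal_mul (by norm_num),
                ENNReal.ofReal_coe_nnreal]
              norm_num
              ring
          _ ≤ ENNReal.ofReal (d ^ s) := by
              refine ENNReal.ofReal_le_ofReal (le_trans ?_ hpn)
              rw [← mul_div_assoc, div_le_iff₀ hn0, pow_succ]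
              calc 5 * K * p ^ n ≤ p * n * p ^ n := by gcongr
                _ = p ^ n * p * n := by ring
          _ = Metric.ediam U ^ s := by rw [hdU, ENNReal.ofReal_rpow_of_pos hd0]
    have := hle S
    rwa [Measure.smul_apply, ENNReal.smul_def, smul_eq_mul] at this
  have hνS : ν S = 0 := by
    by_contra h
    obtain ⟨K, hK⟩ := ENNReal.exists_nat_mul_gt h hS.ne
    exact (hK.trans_le (by exact_mod_cast hscale K)).false
  refine le_antisymm ?_ zero_le
  rw [← hνS]
  exact (Measure.le_restrict_apply _ _).trans
    (Measure.le_map_apply measurable_value.aemeasurable S)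

/-- The logarithmic likelihood ratio between the weights `v k` and `β` for the `k`-th digit,
corrected by the centred digit. -/
noncomputable def logRatio (v : ℕ → ℝ) (β ℓ : ℝ) (n k : ℕ) (b : Bool) : ℝ :=
  if b then Real.log (v k / β) - ℓ * coeff v n k * (1 - v k)
  else Real.log ((1 - v k) / (1 - β)) + ℓ * coeff v n k * v k

theorem sum_logWeight_add {v : ℕ → ℝ} {β ℓ : ℝ} (hβ0 : 0 < β) (hβ1 : β < 1)
    (hv : ∀ k, 0 < v k ∧ v k < 1) (hℓ : Real.log (1 - β) = -ℓ)
    (hβℓ : Real.log β = -(3 / 2 * ℓ)) (ω : ℕ → Bool) (n : ℕ) :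
    ∑ k ∈ Icc 1 n, (logWeight v ω k + ℓ) =
      ∑ k ∈ Icc 1 n, (if blocked ω k then 0 else logRatio v β ℓ n k (ω k)) -
        ∑ k ∈ Icc 1 n, ℓ * (coeff v n k * v k) := by
  set x : ℕ → ℝ := fun k ↦ if digit ω k then 1 else 0 with hx
  have hhx (k : ℕ) : halfShift x k = if blocked ω k then 1 else 0 := by
    simp only [halfShift, hx, blocked]
    by_cases h : Even k <;> simp [h]
  have hsum := sum_coeff_mul v x n
  have hterm : ∀ k ∈ Icc 1 n, logWeight v ω k + ℓ =
      (if blocked ω k then 0 else logRatio v β ℓ n k (ω k)) - ℓ * (coeff v n k * v k) +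
        ℓ * (coeff v n k * (x k + v k * halfShift x k) - (x k / 2 - halfShift x k)) := by
    intro k hk
    rw [hhx]
    simp only [hx, logWeight, logRatio]
    rw [digit_eq ω (mem_Icc.1 hk).1, Real.log_div (hv k).1.ne' hβ0.ne',
      Real.log_div (sub_pos.2 (hv k).2).ne' (sub_pos.2 hβ1).ne', hℓ, hβℓ]
    cases blocked ω k <;> cases ω k <;> simp <;> ring
  rw [sum_congr rfl hterm, sum_add_distrib, sum_sub_distrib, ← mul_sum (f := fun k ↦
    coeff v n k * (x k + v k * halfShift x k) - (x k / 2 - halfShift x k)), sum_sub_distrib, hsum,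
    sub_self, mul_zero, add_zero]

theorem abs_logRatio_le {v : ℕ → ℝ} {β ℓ : ℝ} (hβ0 : 0 < β) (hβ1 : β ≤ 1 / 2) (hℓ : 0 ≤ ℓ)
    (hv : ∀ k, β / 2 ≤ v k ∧ v k ≤ β) (n k : ℕ) (b : Bool) :
    |logRatio v β ℓ n k b| ≤ 1 + ℓ := by
  obtain ⟨h1, h2⟩ := hv k
  have hv0 : 0 < v k := by linarith
  have hA := abs_coeff_le_one (v := v) (fun k ↦ by
    rw [abs_of_nonneg (by linarith [hv k])]
    linarith [hv k]) n k
  have hcorr {t : ℝ} (ht0 : 0 ≤ t) (ht1 : t ≤ 1) : |ℓ * coeff v n k * t| ≤ ℓ := by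
    rw [abs_mul, abs_mul, abs_of_nonneg hℓ, abs_of_nonneg ht0]
    calc ℓ * |coeff v n k| * t ≤ ℓ * 1 * 1 := by gcongr
      _ = ℓ := by ring
  rw [logRatio]
  split_ifs
  · refine (abs_sub _ _).trans (add_le_add ?_ (hcorr (by linarith) (by linarith)))
    rw [abs_le]
    constructor
    · refine le_trans ?_ (Real.one_sub_inv_le_log_of_pos (by positivity))
      rw [inv_div, neg_le_sub_iff_le_add, div_le_iff₀ hv0]
      linarith
    · refine (Real.log_le_sub_one_of_pos (by positivity)).trans ?_
      have : v k / β ≤ 1 := (div_le_one hβ0).2 h2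
      linarith
  · refine (abs_add_le _ _).trans (add_le_add ?_ (hcorr (by linarith) (by linarith)))
    have hβ : 0 < 1 - β := by linarith
    have h3 : 1 ≤ (1 - v k) / (1 - β) := by
      rw [one_le_div hβ]
      linarith
    have h4 : (1 - v k) / (1 - β) ≤ 2 := by
      rw [div_le_iff₀ hβ]
      linarith
    rw [abs_of_nonneg (Real.log_nonneg h3)]
    linarith [Real.log_le_sub_one_of_pos (zero_lt_one.trans_le h3)]

theorem mean_logRatio_le {v : ℕ → ℝ} {β : ℝ} (hβ0 : 0 < β) (hβ1 : β < 1)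
    (hv : ∀ k, 0 < v k ∧ v k < 1) (ℓ : ℝ) (n k : ℕ) :
    v k * logRatio v β ℓ n k true + (1 - v k) * logRatio v β ℓ n k false ≤
      (v k - β) ^ 2 / (β * (1 - β)) := by
  obtain ⟨h0, h1⟩ := hv k
  have h1' := sub_pos.2 h1
  have hβ1' := sub_pos.2 hβ1
  have e1 := mul_le_mul_of_nonneg_left
    (Real.log_le_sub_one_of_pos (div_pos h0 hβ0)) h0.le
  have e2 := mul_le_mul_of_nonneg_left
    (Real.log_le_sub_one_of_pos (div_pos h1' hβ1')) h1'.le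
  have e3 : (v k - β) ^ 2 / (β * (1 - β)) =
      v k * (v k / β - 1) + (1 - v k) * ((1 - v k) / (1 - β) - 1) := by
    field_simp
    ring
  rw [e3]
  simp only [logRatio, if_true, Bool.false_eq_true, if_false]
  linarith

theorem measure_logWeight_gt_le {w : ℕ → unitInterval} {β ℓ r : ℝ} (hβ0 : 0 < β)
    (hβ1 : β ≤ 1 / 2) (hℓ0 : 0 ≤ ℓ) (hw : ∀ k, β / 2 ≤ (w k : ℝ) ∧ (w k : ℝ) ≤ β)
    (hℓ : Real.log (1 - β) = -ℓ) (hβℓ : Real.log β = -(3 / 2 * ℓ)) (hr0 : 0 ≤ r)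
    (hr1 : r * (1 + ℓ) ≤ 1) (n : ℕ) (a : ℝ) :
    bitMeasure w {ω | -a < ∑ k ∈ Icc 1 n, (logWeight (fun k ↦ w k) ω k + ℓ)} ≤
      ENNReal.ofReal (Real.exp (r * (a + ∑ k ∈ Icc 1 n, (((w k : ℝ) - β) ^ 2 / (β * (1 - β)) -
        ℓ * (coeff (fun k ↦ w k) n k * w k))) + r ^ 2 * (1 + ℓ) ^ 2 * n)) := by
  set v : ℕ → ℝ := fun k ↦ w k with hvw
  have hv (k : ℕ) : 0 < v k ∧ v k < 1 :=
    ⟨by linarith [(hw k).1], by linarith [(hw k).2]⟩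
  set c : ℕ → ℝ := fun k ↦ r * ((v k - β) ^ 2 / (β * (1 - β))) + r ^ 2 * (1 + ℓ) ^ 2 with hc
  set Y : ℕ → Bool → ℝ := fun k b ↦ r * logRatio v β ℓ n k b with hY
  set m := ∑ k ∈ Icc 1 n, ℓ * (coeff v n k * v k) with hm
  set f : (ℕ → Bool) → ENNReal := fun ω ↦
    ENNReal.ofReal (Real.exp (∑ k ∈ Icc 1 n, if blocked ω k then 0 else Y k (ω k))) with hf
  have hfm : Measurable f := measurable_of_dependsOn_lt (k := n + 1) fun ω ω' h ↦ by
    simp only [hf, sum_blocked_congr Y h]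
  have hint : ∫⁻ ω, f ω ∂(bitMeasure w) ≤ ENNReal.ofReal (Real.exp (∑ k ∈ Icc 1 n, c k)) := by
    refine lintegral_exp_sum_le (fun k ↦ ?_) (fun k ↦ ?_) n
    · have : 0 < 1 - β := by linarith
      positivity
    · refine (bernoulli_exp_le (w k).2.1 (w k).2.2 hr0 hr1
        (abs_logRatio_le hβ0 hβ1 hℓ0 hw n k true)
        (abs_logRatio_le hβ0 hβ1 hℓ0 hw n k false)).trans ?_
      simp only [hc]
      gcongr
      exact mean_logRatio_le hβ0 (by linarith) hv ℓ n k
  have hsub : {ω | -a < ∑ k ∈ Icc 1 n, (logWeight v ω k + ℓ)} ⊆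
      {ω | 1 ≤ ENNReal.ofReal (Real.exp (r * (a - m))) * f ω} := by
    intro ω hω
    rw [Set.mem_ofPred_eq, sum_logWeight_add hβ0 (by linarith) hv hℓ hβℓ] at hω
    rw [Set.mem_ofPred_eq, ← ENNReal.ofReal_mul (Real.exp_nonneg _), ← Real.exp_add,
      ENNReal.one_le_ofReal, Real.one_le_exp_iff]
    have : ∑ k ∈ Icc 1 n, (if blocked ω k then 0 else Y k (ω k)) =
        r * ∑ k ∈ Icc 1 n, if blocked ω k then 0 else logRatio v β ℓ n k (ω k) := by
      rw [mul_sum]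
      refine sum_congr rfl fun k _ ↦ ?_
      split_ifs <;> simp [hY]
    rw [this, ← mul_add]
    exact mul_nonneg hr0 (by linarith)
  calc bitMeasure w {ω | -a < ∑ k ∈ Icc 1 n, (logWeight v ω k + ℓ)}
      ≤ bitMeasure w {ω | 1 ≤ ENNReal.ofReal (Real.exp (r * (a - m))) * f ω} :=
        measure_mono hsub
    _ ≤ ∫⁻ ω, ENNReal.ofReal (Real.exp (r * (a - m))) * f ω ∂(bitMeasure w) := by
        simpa using mul_meas_ge_le_lintegral (μ := bitMeasure w) (hfm.const_mul _) 1
    _ ≤ ENNReal.ofReal (Real.exp (r * (a - m))) *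
          ENNReal.ofReal (Real.exp (∑ k ∈ Icc 1 n, c k)) := by
        rw [lintegral_const_mul _ hfm]
        gcongr
    _ = _ := by
        rw [← ENNReal.ofReal_mul (Real.exp_nonneg _), ← Real.exp_add]
        congr 2
        simp only [hc, hm, sum_add_distrib, sum_sub_distrib, ← mul_sum, sum_const, Nat.card_Icc,
          nsmul_eq_mul]
        simp only [add_tsub_cancel_right]
        ring

theorem le_sum_one_div_log {n : ℕ} (hn : 2 ≤ n) :
    (n : ℝ) / (8 * ((Nat.log 2 n : ℝ) + 1) ^ 2) ≤
      ∑ j ∈ Icc 1 (n / 2), 1 / (((Nat.log 2 j : ℝ) + 1) * (Nat.log 2 j + 2)) := by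
  set M := (Nat.log 2 n : ℝ) + 1 with hM
  have hM1 : 1 ≤ M := by simp [hM]
  have h : ∑ j ∈ Icc 1 (n / 2), 1 / (2 * M ^ 2) ≤
      ∑ j ∈ Icc 1 (n / 2), 1 / (((Nat.log 2 j : ℝ) + 1) * (Nat.log 2 j + 2)) := by
    refine sum_le_sum fun j hj ↦ ?_
    have hj : Nat.log 2 j ≤ Nat.log 2 n := Nat.log_mono_right (by
      have := (mem_Icc.1 hj).2
      omega)
    have hj' : (Nat.log 2 j : ℝ) ≤ Nat.log 2 n := by exact_mod_cast hj
    refine one_div_le_one_div_of_le (by positivity) ?_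
    calc ((Nat.log 2 j : ℝ) + 1) * (Nat.log 2 j + 2) ≤ M * (2 * M) := by
          gcongr <;> linarith
      _ = 2 * M ^ 2 := by ring
  refine le_trans ?_ h
  rw [sum_const, Nat.card_Icc, nsmul_eq_mul]
  have hn4 : (n : ℝ) ≤ 4 * (n / 2 : ℕ) := by exact_mod_cast show n ≤ 4 * (n / 2) by omega
  calc (n : ℝ) / (8 * M ^ 2) ≤ 4 * (n / 2 : ℕ) / (8 * M ^ 2) := by gcongr
    _ = (n / 2 + 1 - 1 : ℕ) * (1 / (2 * M ^ 2)) := by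
      rw [Nat.add_sub_cancel]
      field_simp
      ring

theorem eventually_log_pow_le {η : ℝ} (hη : 0 < η) :
    ∀ᶠ n : ℕ in Filter.atTop, 3 * ((Nat.log 2 n : ℝ) + 1) ^ 5 ≤ η * n := by
  have h := (Real.isLittleO_pow_log_id_atTop (n := 5)).comp_tendsto tendsto_natCast_atTop_atTop
  have h := h.bound (show 0 < η / 729 by positivity)
  filter_upwards [h, Filter.eventually_ge_atTop 3] with n hn hn3
  have hn3' : (3 : ℝ) ≤ n := by exact_mod_cast hn3
  have hlog1 : 1 ≤ Real.log n := by
    rw [Real.le_log_iff_exp_le (by linarith)]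
    linarith [Real.exp_one_lt_d9]
  have hlog : (Nat.log 2 n : ℝ) ≤ 2 * Real.log n := by
    refine (Real.natLog_le_logb n 2).trans ?_
    rw [Real.logb, div_le_iff₀ (by simpa using Real.log_pos one_lt_two)]
    have := Real.log_two_gt_d9
    push_cast
    nlinarith
  simp only [Function.comp_apply, id, Real.norm_eq_abs] at hn
  rw [abs_of_nonneg (by positivity), abs_of_nonneg (by positivity)] at hn
  calc 3 * ((Nat.log 2 n : ℝ) + 1) ^ 5 ≤ 3 * (3 * Real.log n) ^ 5 := by
        gcongr
        linarith
    _ = 729 * Real.log n ^ 5 := by ring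
    _ ≤ η * n := by linarith

theorem log_le_natLog_add_one {n : ℕ} (hn : 1 ≤ n) : Real.log n ≤ (Nat.log 2 n : ℝ) + 1 := by
  have h : (n : ℝ) ≤ 2 ^ (Nat.log 2 n + 1) := by
    exact_mod_cast (Nat.lt_pow_succ_log_self one_lt_two n).le
  calc Real.log n ≤ Real.log (2 ^ (Nat.log 2 n + 1)) :=
        Real.log_le_log (by exact_mod_cast hn) h
    _ = ((Nat.log 2 n : ℝ) + 1) * Real.log 2 := by
        rw [Real.log_pow]
        push_cast
        ring
    _ ≤ ((Nat.log 2 n : ℝ) + 1) * 1 := by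
        gcongr
        linarith [Real.log_two_lt_d9]
    _ = _ := mul_one _

theorem exists_exponent_le {C κ K : ℝ} (hκ : 0 < κ) (hK : 1 ≤ K) :
    ∃ r : ℕ → ℝ, (∀ n, 0 ≤ r n ∧ r n * K ≤ 1) ∧ ∀ᶠ n : ℕ in Filter.atTop,
      r n * (Real.log n + (C - κ * ∑ j ∈ Icc 1 (n / 2),
        1 / (((Nat.log 2 j : ℝ) + 1) * (Nat.log 2 j + 2)))) + r n ^ 2 * K ^ 2 * n ≤
      |C| - 2 * Real.log n := by
  obtain ⟨δ, hδ0, hδ1, hδ2⟩ : ∃ δ : ℝ, 0 < δ ∧ δ ≤ 1 / K ∧ δ ≤ κ / (16 * K ^ 2) :=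
    ⟨min (1 / K) (κ / (16 * K ^ 2)), by positivity, min_le_left _ _, min_le_right _ _⟩
  have hM1 (n : ℕ) : 1 ≤ (Nat.log 2 n : ℝ) + 1 := by simp
  rw [le_div_iff₀ (by positivity)] at hδ1 hδ2
  refine ⟨fun n ↦ δ / ((Nat.log 2 n : ℝ) + 1) ^ 2, fun n ↦ ⟨by positivity, ?_⟩, ?_⟩
  · rw [div_mul_eq_mul_div]
    exact (div_le_self (by positivity) (one_le_pow₀ (hM1 n))).trans hδ1
  filter_upwards [eventually_log_pow_le (η := δ * κ / 16) (by positivity),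
    Filter.eventually_ge_atTop 2] with n hn hn2
  have hlog := log_le_natLog_add_one (n := n) (by omega)
  have hS := le_sum_one_div_log hn2
  have hM := hM1 n
  have hlog0 : 0 ≤ Real.log n := Real.log_natCast_nonneg n
  set M := (Nat.log 2 n : ℝ) + 1
  generalize ∑ j ∈ Icc 1 (n / 2), 1 / (((Nat.log 2 j : ℝ) + 1) * (Nat.log 2 j + 2)) = S at *
  have hδK : δ ≤ 1 := by nlinarith
  have hr1 : δ / M ^ 2 ≤ 1 := (div_le_self hδ0.le (one_le_pow₀ hM)).trans hδK
  have hr0 : 0 ≤ δ / M ^ 2 := by positivity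
  have h1 : δ / M ^ 2 * (Real.log n + C) ≤ Real.log n + |C| := by
    have : δ / M ^ 2 * (Real.log n + C) ≤ δ / M ^ 2 * (Real.log n + |C|) := by
      gcongr
      exact le_abs_self C
    nlinarith [abs_nonneg C]
  have h2 : δ * κ / 8 * (n / M ^ 4) ≤ δ / M ^ 2 * (κ * S) := by
    calc δ * κ / 8 * (n / M ^ 4) = δ / M ^ 2 * (κ * (n / (8 * M ^ 2))) := by
          field_simp
      _ ≤ _ := by gcongr
  have h3 : (δ / M ^ 2) ^ 2 * K ^ 2 * n ≤ δ * κ / 16 * (n / M ^ 4) := by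
    calc (δ / M ^ 2) ^ 2 * K ^ 2 * n = δ * (δ * (16 * K ^ 2)) / 16 * (n / M ^ 4) := by
          field_simp
      _ ≤ _ := by gcongr
  have h4 : 3 * M ≤ δ * κ / 16 * (n / M ^ 4) := by
    rw [← mul_div_assoc, le_div_iff₀ (by positivity)]
    linarith
  linarith

theorem ae_eventually_sum_logWeight_le {w : ℕ → unitInterval} {β ℓ C κ : ℝ} (hβ0 : 0 < β)
    (hβ1 : β ≤ 1 / 2) (hℓ0 : 0 ≤ ℓ) (hw : ∀ k, β / 2 ≤ (w k : ℝ) ∧ (w k : ℝ) ≤ β)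
    (hℓ : Real.log (1 - β) = -ℓ) (hβℓ : Real.log β = -(3 / 2 * ℓ)) (hκ : 0 < κ)
    (hsum : ∀ n, ∑ k ∈ Icc 1 n, (((w k : ℝ) - β) ^ 2 / (β * (1 - β)) -
        ℓ * (coeff (fun k ↦ w k) n k * w k)) ≤
      C - κ * ∑ j ∈ Icc 1 (n / 2), 1 / (((Nat.log 2 j : ℝ) + 1) * (Nat.log 2 j + 2))) :
    ∀ᵐ ω ∂(bitMeasure w), ∀ᶠ n : ℕ in Filter.atTop,
      ∑ k ∈ Icc 1 n, (logWeight (fun k ↦ w k) ω k + ℓ) ≤ -Real.log n := by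
  obtain ⟨r, hr, hev⟩ := exists_exponent_le (C := C) hκ (show 1 ≤ 1 + ℓ by linarith)
  obtain ⟨N, hN⟩ := Filter.eventually_atTop.1 hev
  set bad : ℕ → Set (ℕ → Bool) := fun n ↦
    {ω | -Real.log n < ∑ k ∈ Icc 1 n, (logWeight (fun k ↦ w k) ω k + ℓ)} with hbad
  have hle (n : ℕ) (hn : N + 1 ≤ n) :
      bitMeasure w (bad n) ≤ ENNReal.ofReal (Real.exp |C| * (1 / (n : ℝ) ^ 2)) := by
    refine (measure_logWeight_gt_le hβ0 hβ1 hℓ0 hw hℓ hβℓ (hr n).1 (hr n).2 n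
      (Real.log n)).trans (ENNReal.ofReal_le_ofReal ?_)
    have hn0 : (0 : ℝ) < n := by exact_mod_cast show 0 < n by omega
    calc _ ≤ Real.exp (|C| - 2 * Real.log n) := by
          refine Real.exp_le_exp.2 (le_trans ?_ (hN n (by omega)))
          gcongr
          · exact (hr n).1
          · exact hsum n
      _ = _ := by
          rw [Real.exp_sub, mul_comm 2, Real.exp_mul, Real.exp_log hn0, mul_one_div]
          norm_num
  have hfin : ∑' n, bitMeasure w (bad (n + (N + 1))) ≠ ⊤ := by
    have hs : Summable fun n : ℕ ↦ Real.exp |C| * (1 / ((n + (N + 1) : ℕ) : ℝ) ^ 2) :=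
      ((summable_nat_add_iff (N + 1)).2
        (Real.summable_one_div_nat_pow.2 one_lt_two)).mul_left _
    exact ne_top_of_le_ne_top hs.tsum_ofReal_ne_top
      (ENNReal.tsum_le_tsum fun n ↦ hle _ (by omega))
  filter_upwards [ae_eventually_notMem hfin] with ω hω
  obtain ⟨m, hm⟩ := Filter.eventually_atTop.1 hω
  filter_upwards [Filter.eventually_ge_atTop (m + (N + 1))] with n hn
  have h := hm (n - (N + 1)) (by omega)
  rw [Nat.sub_add_cancel (by omega)] at h
  exact not_lt.1 h

theorem not_sigmaFinite_XiG {p : ℝ} (hp : p ∈ Set.Ioo (0 : ℝ) 1) (hpe : p ^ 3 = (1 - p) ^ 2) :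
    ¬ ∃ S : ℕ → Set ℝ, XiG ⊆ ⋃ n, S n ∧ ∀ n, μH[-Real.logb 2 p] (S n) < ⊤ := by
  rintro ⟨S, hXi, hS⟩
  obtain ⟨hp0, hp1⟩ := hp
  have hp2 : 1 / 2 ≤ p := by
    by_contra! h
    nlinarith [mul_pos hp0 hp0, mul_pos hp0 (mul_pos hp0 hp0)]
  have hβ0 : 0 < 1 - p := by linarith
  have hβ1 : 1 - p ≤ 1 / 2 := by linarith
  have hℓ0 : 0 < -Real.log p := neg_pos.2 (Real.log_neg hp0 hp1)
  have hℓ : Real.log (1 - (1 - p)) = -(-Real.log p) := by rw [sub_sub_cancel, neg_neg]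
  have hβℓ : Real.log (1 - p) = -(3 / 2 * -Real.log p) := by
    have := congrArg Real.log hpe
    rw [Real.log_pow, Real.log_pow] at this
    push_cast at this
    linarith
  obtain ⟨v, hv, C, κ, hκ, hsum⟩ := exists_weights hβ0 hβ1 hℓ0
  set w : ℕ → unitInterval := fun k ↦
    ⟨v k, by linarith [(hv k).1], by linarith [(hv k).2]⟩ with hw
  have hgood := ae_eventually_sum_logWeight_le (w := w) hβ0 hβ1 hℓ0.le hv hℓ hβℓ hκ hsum
  set G : ℕ → Set (ℕ → Bool) := fun N ↦ {ω | ∀ n ≥ N,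
    ∑ k ∈ Icc 1 n, (logWeight (fun k ↦ w k) ω k + -Real.log p) ≤ -Real.log n} with hG
  have hcyl (N n : ℕ) (hn : n ≥ N + 1) (ω : ℕ → Bool) (hω : ω ∈ G N) :
      bitMeasure w {ω' | ∀ k ∈ Icc 1 n, digit ω' k = digit ω k} ≤
        ENNReal.ofReal (p ^ n / n) := by
    refine (measure_cylinder_le (fun k ↦ ?_) (fun k ↦ ?_) ω n).trans
      (ENNReal.ofReal_le_ofReal ?_)
    · linarith [show (w k : ℝ) = v k from rfl, (hv k).1]
    · linarith [show (w k : ℝ) = v k from rfl, (hv k).2]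
    · have h := hω n (by omega)
      have hn0 : (0 : ℝ) < n := by exact_mod_cast show 0 < n by omega
      rw [sum_add_distrib, sum_const, Nat.card_Icc, nsmul_eq_mul, Nat.add_sub_cancel] at h
      calc _ ≤ Real.exp (n * Real.log p - Real.log n) := Real.exp_le_exp.2 (by linarith)
        _ = p ^ n / n := by
          rw [Real.exp_sub, Real.exp_log hn0, mul_comm, Real.exp_mul, Real.exp_log hp0,
            Real.rpow_natCast]
  have hzero (i N : ℕ) : bitMeasure w (value ⁻¹' S i ∩ G N) = 0 :=
    measure_value_preimage_eq_zero hp0 hp1 (hcyl N) (hS i)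
  have hcover : ∀ᵐ ω ∂(bitMeasure w), ω ∈ ⋃ i, ⋃ N, value ⁻¹' S i ∩ G N := by
    filter_upwards [hgood] with ω hω
    obtain ⟨N, hN⟩ := Filter.eventually_atTop.1 hω
    obtain ⟨i, hi⟩ := Set.mem_iUnion.1 (hXi (value_mem_XiG ω))
    exact Set.mem_iUnion₂.2 ⟨i, N, hi, hN⟩
  have hnull : bitMeasure w (⋃ i, ⋃ N, value ⁻¹' S i ∩ G N) = 0 :=
    measure_iUnion_null fun i ↦ measure_iUnion_null fun N ↦ hzero i N
  have hnull' : ∀ᵐ ω ∂(bitMeasure w), ω ∉ ⋃ i, ⋃ N, value ⁻¹' S i ∩ G N :=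
    measure_eq_zero_iff_ae_notMem.1 hnull
  obtain ⟨ω, h1, h2⟩ := (hcover.and hnull').exists
  exact h2 h1

end MulGoldenMean

/-- With `s = -log₂ p` (`p ∈ (0,1)` the root of `p³ = (1-p)²`), the `s`-dimensional Hausdorff
measure of `Ξ_G` is infinite, and `Ξ_G` is not σ-finite with respect to `μH[s]`. -/
theorem hausdorffMeasure_XiG (p : ℝ) (hp : p ∈ Set.Ioo (0 : ℝ) 1)
    (hpe : p ^ 3 = (1 - p) ^ 2) :
    μH[-Real.logb 2 p] XiG = ⊤ ∧
      ¬ ∃ S : ℕ → Set ℝ, XiG ⊆ ⋃ n, S n ∧ ∀ n, μH[-Real.logb 2 p] (S n) < ⊤ := by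
  have h := MulGoldenMean.not_sigmaFinite_XiG hp hpe
  refine ⟨?_, h⟩
  by_contra htop
  exact h ⟨fun _ ↦ XiG, Set.subset_iUnion (fun _ : ℕ ↦ XiG) 0, fun _ ↦ lt_top_iff_ne_top.2 htop⟩
end

section
/- Let s = −log₂ p where p is the unique root in (0,1) of p³ = (1−p)². There exists c₀ > 0 such that for every c ∈ (0, c₀), with gauge function φ(t) = t^s · exp(−c·|log t| / (log|log t|)²) for small t > 0 (extended to a continuous increasing function on [0,∞) with φ(0) = 0), one has H^φ(Ξ_G) = ∞, and moreover Ξ_G is not σ-finite with respect to H^φ. -/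
open MeasureTheory

noncomputable section

/-- A gauge function: continuous and increasing on `[0,∞)` with `φ(0) = 0`. -/
def IsGauge (φ : ℝ → ℝ) : Prop :=
  φ 0 = 0 ∧ ContinuousOn φ (Set.Ici 0) ∧ StrictMonoOn φ (Set.Ici 0)

/-- The generalized Hausdorff measure with gauge `φ`. -/
def gaugeMeasure {X : Type*} [EMetricSpace X] [MeasurableSpace X] [BorelSpace X]
    (φ : ℝ → ℝ) : Measure X :=
  Measure.mkMetric fun d => ENNReal.ofReal (φ d.toReal)

namespace GoldenMeanShift

/-- The predecessor of a position in its chain `i, 2i, 4i, …`; odd positions have the dummy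
predecessor `0`. -/
def halfPred (k : ℕ) : ℕ := if Even k then k / 2 else 0

lemma halfPred_lt {k : ℕ} (hk : 0 < k) : halfPred k < k := by
  unfold halfPred
  split_ifs <;> omega

lemma halfPred_zero : halfPred 0 = 0 := by simp [halfPred]

lemma halfPred_two_mul (k : ℕ) : halfPred (2 * k) = k := by simp [halfPred]

/-- Turn a sequence of coin tosses into an admissible digit sequence, by overwriting with `0` every
toss whose predecessor digit is `1`. -/
def digit (ω : ℕ → Bool) : ℕ → Bool
  | 0 => false
  | k + 1 => ω (k + 1) && !digit ω (halfPred (k + 1))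
termination_by k => k
decreasing_by exact halfPred_lt k.succ_pos

lemma digit_zero (ω : ℕ → Bool) : digit ω 0 = false := by rw [digit]

lemma digit_pos (ω : ℕ → Bool) {k : ℕ} (hk : 0 < k) :
    digit ω k = (ω k && !digit ω (halfPred k)) := by
  obtain ⟨k, rfl⟩ := Nat.exists_eq_succ_of_ne_zero hk.ne'
  rw [digit]

/-- The positions in `{1, …, n}` at which the digit is `1`. -/
def digitSet (ω : ℕ → Bool) (n : ℕ) : Finset ℕ := (Finset.Icc 1 n).filter fun k => digit ω k = true

lemma mem_digitSet {ω : ℕ → Bool} {n k : ℕ} :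
    k ∈ digitSet ω n ↔ (1 ≤ k ∧ k ≤ n) ∧ digit ω k = true := by
  simp [digitSet]

lemma halfPred_mem_digitSet {ω : ℕ → Bool} {n k : ℕ} (h1 : 1 ≤ k) (hn : k ≤ n) :
    halfPred k ∈ digitSet ω n ↔ digit ω (halfPred k) = true := by
  rw [mem_digitSet]
  refine ⟨fun h => h.2, fun h => ⟨⟨?_, ?_⟩, h⟩⟩
  · by_contra h0
    have : halfPred k = 0 := by omega
    rw [this, digit_zero] at h
    exact absurd h (by simp)
  · have := halfPred_lt h1
    omega

/-- The conditional probability of the `k`-th digit of the word with set of ones `u`. -/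
def weight (r : ℕ → unitInterval) (u : Finset ℕ) (k : ℕ) : ℝ :=
  if halfPred k ∈ u then (if k ∈ u then 0 else 1) else if k ∈ u then (r k : ℝ) else 1 - (r k : ℝ)

/-- The `k`-th digit centred at its conditional mean. -/
def increment (r : ℕ → unitInterval) (u : Finset ℕ) (k : ℕ) : ℝ :=
  (if k ∈ u then 1 else 0) - (if halfPred k ∈ u then 0 else (r k : ℝ))

lemma weight_nonneg (r : ℕ → unitInterval) (u : Finset ℕ) (k : ℕ) : 0 ≤ weight r u k := by
  have h0 := (r k).2.1
  have h1 := (r k).2.2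
  unfold weight
  split_ifs <;> linarith

/-- The law of independent coin tosses with success probabilities `r k`. -/
def tossMeasure (r : ℕ → unitInterval) : Measure (ℕ → Bool) :=
  Measure.infinitePi fun k => ProbabilityTheory.bernoulliMeasure true false (r k)

instance (r : ℕ → unitInterval) : IsProbabilityMeasure (tossMeasure r) := by
  unfold tossMeasure
  infer_instance

lemma bernoulliMeasure_singleton (t : unitInterval) (b : Bool) :
    ProbabilityTheory.bernoulliMeasure true false t {b}
      = ENNReal.ofReal (if b then (t : ℝ) else 1 - (t : ℝ)) := by
  rw [← ofReal_measureReal, ProbabilityTheory.bernoulliMeasure_real_apply _ (by simp)]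
  cases b <;> simp

lemma tossMeasure_digitSet_le (r : ℕ → unitInterval) (n : ℕ) (u : Finset ℕ) :
    tossMeasure r {ω | digitSet ω n = u}
      ≤ ENNReal.ofReal (∏ k ∈ Finset.Icc 1 n, weight r u k) := by
  by_cases hadm : ∃ k ∈ Finset.Icc 1 n, halfPred k ∈ u ∧ k ∈ u
  · obtain ⟨k, hk, hpu, hku⟩ := hadm
    have hempty : {ω | digitSet ω n = u} = ∅ := by
      ext ω
      simp only [Set.mem_ofPred_eq, Set.mem_empty_iff_false, iff_false]
      rintro rfl
      have h1 := (mem_digitSet.1 hpu).2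
      have h2 := (mem_digitSet.1 hku).2
      rw [digit_pos ω (Finset.mem_Icc.1 hk).1, h1] at h2
      simp at h2
    simp [hempty]
  · push Not at hadm
    set t : ℕ → Set Bool := fun k => if halfPred k ∈ u then Set.univ else {decide (k ∈ u)} with ht
    have hsub : {ω | digitSet ω n = u} ⊆ Set.pi (Finset.Icc 1 n) t := by
      rintro ω rfl k hk
      rw [Finset.mem_coe, Finset.mem_Icc] at hk
      simp only [ht]
      split_ifs with h
      · trivial
      · have h' : digit ω (halfPred k) = false := by
          rw [halfPred_mem_digitSet hk.1 hk.2] at h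
          simpa using h
        have := digit_pos ω hk.1
        rw [h'] at this
        simp [mem_digitSet, hk.1, hk.2, this]
    refine (measure_mono hsub).trans ?_
    rw [tossMeasure, Measure.infinitePi_pi _ (fun _ _ => MeasurableSet.of_discrete),
      ENNReal.ofReal_prod_of_nonneg fun k _ => weight_nonneg r u k]
    refine Finset.prod_le_prod' fun k hk => ?_
    simp only [ht, weight]
    split_ifs with h1 h2 h2
    · exact absurd h2 (hadm k hk h1)
    · simp
    · rw [bernoulliMeasure_singleton, decide_eq_true h2]; simp
    · rw [bernoulliMeasure_singleton, decide_eq_false h2]; simp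

/-- Kraft-type inequality: predictable subprobability weights have total mass at most `1`. -/
lemma sum_prod_le_one (g : ℕ → Finset ℕ → ℝ) (hg : ∀ k u, 0 ≤ g k u)
    (hloc : ∀ k m u, k < m → g k (insert m u) = g k u)
    (hsub : ∀ k u, 1 ≤ k → k ∉ u → g k u + g k (insert k u) ≤ 1) (n : ℕ) :
    ∑ u ∈ (Finset.Icc 1 n).powerset, ∏ k ∈ Finset.Icc 1 n, g k u ≤ 1 := by
  induction n with
  | zero => simp
  | succ n ih =>
    have hmem : n + 1 ∉ Finset.Icc 1 n := by simp
    rw [← Finset.insert_Icc_right_eq_Icc_add_one (by omega), Finset.sum_powerset_insert hmem,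
      ← Finset.sum_add_distrib]
    refine le_trans (Finset.sum_le_sum fun u hu => ?_) ih
    have hu' : n + 1 ∉ u := fun h => hmem (Finset.mem_powerset.1 hu h)
    rw [Finset.prod_insert hmem, Finset.prod_insert hmem]
    have : ∏ k ∈ Finset.Icc 1 n, g k (insert (n + 1) u) = ∏ k ∈ Finset.Icc 1 n, g k u :=
      Finset.prod_congr rfl fun k hk => hloc _ _ _ (by simp at hk; omega)
    rw [this, ← add_mul]
    exact mul_le_of_le_one_left (Finset.prod_nonneg fun k _ => hg k u)
      (hsub _ _ (by omega) hu')

lemma exp_le_one_add_add_sq {s : ℝ} (hs : |s| ≤ 1) : Real.exp s ≤ 1 + s + s ^ 2 := by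
  have := (abs_le.1 (Real.abs_exp_sub_one_sub_id_le hs)).2
  linarith

lemma two_point_mgf_le {t s : ℝ} (h0 : 0 ≤ t) (h1 : t ≤ 1) (hs : |s| ≤ 1) :
    (1 - t) * Real.exp (s * (0 - t)) + t * Real.exp (s * (1 - t)) ≤ Real.exp (s ^ 2) := by
  have e1 : Real.exp (s * (0 - t)) ≤ 1 + s * (0 - t) + (s * (0 - t)) ^ 2 := by
    apply exp_le_one_add_add_sq
    rw [abs_mul]
    exact mul_le_one₀ hs (abs_nonneg _) (by rw [abs_le]; constructor <;> linarith)
  have e2 : Real.exp (s * (1 - t)) ≤ 1 + s * (1 - t) + (s * (1 - t)) ^ 2 := by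
    apply exp_le_one_add_add_sq
    rw [abs_mul]
    exact mul_le_one₀ hs (abs_nonneg _) (by rw [abs_le]; constructor <;> linarith)
  have e3 := Real.add_one_le_exp (s ^ 2)
  have h4 : t * (1 - t) ≤ 1 := by nlinarith
  nlinarith [mul_le_mul_of_nonneg_left e1 (by linarith : 0 ≤ 1 - t),
    mul_le_mul_of_nonneg_left e2 h0, mul_le_mul_of_nonneg_left h4 (sq_nonneg s)]

lemma sum_weight_mul_exp_le (r : ℕ → unitInterval) (β : ℕ → ℝ) {K l : ℝ}
    (hβ : ∀ k, |β k| ≤ K) (hl : 0 ≤ l) (hlK : l * K ≤ 1) (n : ℕ) :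
    ∑ u ∈ (Finset.Icc 1 n).powerset, (∏ k ∈ Finset.Icc 1 n, weight r u k) *
      Real.exp (l * ∑ k ∈ Finset.Icc 1 n, β k * increment r u k) ≤ Real.exp (l ^ 2 * K ^ 2 * n) := by
  have key := sum_prod_le_one
    (fun k u => if 0 ∈ u then 0 else
      weight r u k * Real.exp (l * (β k * increment r u k) - l ^ 2 * K ^ 2)) ?_ ?_ ?_ n
  · have hle : ∀ u ∈ (Finset.Icc 1 n).powerset, (∏ k ∈ Finset.Icc 1 n, weight r u k) *
        Real.exp (l * ∑ k ∈ Finset.Icc 1 n, β k * increment r u k) =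
        Real.exp (l ^ 2 * K ^ 2 * n) * ∏ k ∈ Finset.Icc 1 n, (if 0 ∈ u then 0 else
      weight r u k * Real.exp (l * (β k * increment r u k) - l ^ 2 * K ^ 2)) := by
      intro u hu
      have h0 : 0 ∉ u := fun h => by simpa using Finset.mem_powerset.1 hu h
      simp only [if_neg h0]
      rw [Finset.prod_mul_distrib, ← Real.exp_sum, mul_left_comm, ← Real.exp_add]
      congr 2
      rw [Finset.sum_sub_distrib, Finset.mul_sum]
      simp
      ring
    rw [Finset.sum_congr rfl hle, ← Finset.mul_sum]
    exact mul_le_of_le_one_right (Real.exp_pos _).le key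
  · intro k u
    split_ifs
    · rfl
    · exact mul_nonneg (weight_nonneg r u k) (Real.exp_pos _).le
  · intro k m u hkm
    have h1 : k ≠ m := hkm.ne
    have h2 : halfPred k ≠ m := by
      rcases Nat.eq_zero_or_pos k with rfl | hk
      · rw [halfPred_zero]; omega
      · have := halfPred_lt hk; omega
    have h3 : 0 ≠ m := by omega
    simp [weight, increment, h1, h2, h3]
  · intro k u hk hku
    have h1 : halfPred k ≠ k := (halfPred_lt hk).ne
    have h3 : 0 ≠ k := by omega
    have hs : |l * β k| ≤ 1 := by
      rw [abs_mul, abs_of_nonneg hl]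
      exact (mul_le_mul_of_nonneg_left (hβ k) hl).trans hlK
    have hsq : (l * β k) ^ 2 ≤ l ^ 2 * K ^ 2 := by
      rw [mul_pow]
      exact mul_le_mul_of_nonneg_left (sq_le_sq' (abs_le.1 (hβ k)).1 (abs_le.1 (hβ k)).2)
        (sq_nonneg l)
    by_cases h0 : 0 ∈ u
    · simp [h0]
    by_cases hp : halfPred k ∈ u
    · simp [weight, increment, h0, h1, h3, hp, hku]
      positivity
    · simp only [weight, increment, Finset.mem_insert, h0, h1, h3, hp, hku, if_false, or_false,
        if_true]
      have := two_point_mgf_le (r k).2.1 (r k).2.2 hs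
      rw [Real.exp_sub, Real.exp_sub, ← mul_div_assoc, ← mul_div_assoc, ← add_div,
        div_le_one (Real.exp_pos _)]
      refine le_trans ?_ (this.trans (Real.exp_le_exp.2 hsq))
      simp only [mul_assoc, le_refl]

/-- Chernoff bound for the digit process. -/
lemma tossMeasure_increment_sum_gt_le (r : ℕ → unitInterval) (β : ℕ → ℝ) {K l : ℝ}
    (hβ : ∀ k, |β k| ≤ K) (hl : 0 ≤ l) (hlK : l * K ≤ 1) (n : ℕ) (τ : ℝ) :
    tossMeasure r {ω | τ < ∑ k ∈ Finset.Icc 1 n, β k * increment r (digitSet ω n) k}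
      ≤ ENNReal.ofReal (Real.exp (l ^ 2 * K ^ 2 * n - l * τ)) := by
  classical
  set bad := (Finset.Icc 1 n).powerset.filter fun u =>
    τ < ∑ k ∈ Finset.Icc 1 n, β k * increment r u k with hbad
  have hsub : {ω | τ < ∑ k ∈ Finset.Icc 1 n, β k * increment r (digitSet ω n) k} ⊆
      ⋃ u ∈ bad, {ω | digitSet ω n = u} := by
    intro ω hω
    simp only [Set.mem_iUnion, Set.mem_ofPred_eq, exists_prop, exists_eq_right', hbad,
      Finset.mem_filter, Finset.mem_powerset]
    exact ⟨Finset.filter_subset _ _, hω⟩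
  refine (measure_mono hsub).trans ((measure_biUnion_finset_le _ _).trans ?_)
  refine (Finset.sum_le_sum fun u _ => tossMeasure_digitSet_le r n u).trans ?_
  rw [← ENNReal.ofReal_sum_of_nonneg fun u _ => Finset.prod_nonneg fun k _ => weight_nonneg r u k]
  refine ENNReal.ofReal_le_ofReal ?_
  rw [sub_eq_add_neg, Real.exp_add, Real.exp_neg, ← div_eq_mul_inv, le_div_iff₀ (Real.exp_pos _)]
  refine le_trans ?_ (sum_weight_mul_exp_le r β hβ hl hlK n)
  rw [Finset.sum_mul]
  have hnn : ∀ u, 0 ≤ ∏ k ∈ Finset.Icc 1 n, weight r u k := fun u =>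
    Finset.prod_nonneg fun k _ => weight_nonneg r u k
  refine (Finset.sum_le_sum fun u hu => ?_).trans (Finset.sum_le_sum_of_subset_of_nonneg
    (Finset.filter_subset _ _) fun u _ _ => mul_nonneg (hnn u) (Real.exp_pos _).le)
  exact mul_le_mul_of_nonneg_left (Real.exp_le_exp.2
    (mul_le_mul_of_nonneg_left (Finset.mem_filter.1 hu).2.le hl)) (hnn u)

lemma sum_even_eq (h : ℕ → ℝ) (n : ℕ) :
    ∑ k ∈ Finset.Icc 1 n, (if Even k then h k else 0)
      = ∑ k ∈ Finset.Icc 1 (n / 2), h (2 * k) := by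
  rw [← Finset.sum_filter]
  symm
  refine Finset.sum_bij (fun k _ => 2 * k) ?_ ?_ ?_ ?_
  · intro k hk
    simp only [Finset.mem_Icc, Finset.mem_filter] at hk ⊢
    exact ⟨by omega, by simp⟩
  · intro a _ b _ hab
    omega
  · intro k hk
    simp only [Finset.mem_Icc, Finset.mem_filter] at hk
    obtain ⟨⟨h1, h2⟩, h3⟩ := hk
    refine ⟨k / 2, ?_, ?_⟩
    · rw [Finset.mem_Icc]
      obtain ⟨j, rfl⟩ := h3
      omega
    · obtain ⟨j, rfl⟩ := h3
      omega
  · intros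
    rfl

lemma sum_Icc_half_eq (h : ℕ → ℝ) (n : ℕ) :
    ∑ k ∈ Finset.Icc 1 (n / 2), h k = ∑ k ∈ Finset.Icc 1 n, (if 2 * k ≤ n then h k else 0) := by
  rw [← Finset.sum_filter]
  congr 1
  ext k
  simp only [Finset.mem_Icc, Finset.mem_filter]
  omega

lemma sum_mul_halfPred (c z : ℕ → ℝ) (hz : z 0 = 0) (n : ℕ) :
    ∑ k ∈ Finset.Icc 1 n, c k * z (halfPred k)
      = ∑ k ∈ Finset.Icc 1 n, (if 2 * k ≤ n then c (2 * k) else 0) * z k := by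
  have h1 : ∀ k, c k * z (halfPred k) = if Even k then c k * z (k / 2) else 0 := by
    intro k
    unfold halfPred
    split_ifs <;> simp [hz]
  simp only [h1, ite_mul, zero_mul]
  rw [sum_even_eq (fun k => c k * z (k / 2)), sum_Icc_half_eq]
  simp

lemma sum_halfPred (z : ℕ → ℝ) (hz : z 0 = 0) (n : ℕ) :
    ∑ k ∈ Finset.Icc 1 n, z (halfPred k) = ∑ k ∈ Finset.Icc 1 (n / 2), z k := by
  have := sum_mul_halfPred (fun _ => 1) z hz n
  simpa [sum_Icc_half_eq, ite_mul] using this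

/-- The coefficients expressing `½ N(n) - N(n/2)`, where `N` counts ones, through the centred
increments. -/
def coeff (r : ℕ → unitInterval) (n : ℕ) (k : ℕ) : ℝ :=
  if h : 0 < k ∧ 2 * k ≤ n then -(1 / 2) - (r (2 * k) : ℝ) * coeff r n (2 * k) else 1 / 2
termination_by n - k

lemma coeff_eq (r : ℕ → unitInterval) (n k : ℕ) (hk : 0 < k) :
    coeff r n k = (1 / 2 - if 2 * k ≤ n then 1 else 0)
      - if 2 * k ≤ n then (r (2 * k) : ℝ) * coeff r n (2 * k) else 0 := by
  conv_lhs => rw [coeff]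
  by_cases h : 2 * k ≤ n
  · simp only [hk, h, and_self, dite_true, if_true]; ring
  · simp [h]

lemma abs_coeff_le (r : ℕ → unitInterval) {q : ℝ} (hq1 : q < 1) (hr : ∀ k, (r k : ℝ) ≤ q)
    (n k : ℕ) : |coeff r n k| ≤ 1 / (2 * (1 - q)) := by
  have hq0 : 0 ≤ q := (r 0).2.1.trans (hr 0)
  have hhalf : (1 : ℝ) / 2 ≤ 1 / (2 * (1 - q)) :=
    one_div_le_one_div_of_le (by linarith) (by linarith)
  induction hm : n - k using Nat.strong_induction_on generalizing k with
  | _ m ih =>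
    rw [coeff]
    split_ifs with h
    · have h1 := ih (n - 2 * k) (by omega) (2 * k) rfl
      have h2 : |(r (2 * k) : ℝ) * coeff r n (2 * k)| ≤ q * (1 / (2 * (1 - q))) := by
        rw [abs_mul, abs_of_nonneg (r (2 * k)).2.1]
        exact mul_le_mul (hr _) h1 (abs_nonneg _) hq0
      have h3 : 1 / 2 + q * (1 / (2 * (1 - q))) = 1 / (2 * (1 - q)) := by
        have : (1 - q) ≠ 0 := by linarith
        field_simp
        ring
      rw [abs_le] at h2 ⊢
      constructor <;> linarith
    · rwa [abs_of_nonneg (by norm_num)]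

/-- Summation by parts along chains. -/
lemma sum_half_sub_eq (r : ℕ → unitInterval) (m : ℕ → ℝ) (hm0 : m 0 = 0)
    (hm : ∀ k, 0 < k → m k = r k * (1 - m (halfPred k))) (n : ℕ) (u : Finset ℕ) (hu : 0 ∉ u) :
    ∑ k ∈ Finset.Icc 1 n, (if k ∈ u then (1 : ℝ) else 0) / 2
        - ∑ k ∈ Finset.Icc 1 (n / 2), (if k ∈ u then (1 : ℝ) else 0)
      = (∑ k ∈ Finset.Icc 1 n, m k / 2 - ∑ k ∈ Finset.Icc 1 (n / 2), m k)
        + ∑ k ∈ Finset.Icc 1 n, coeff r n k * increment r u k := by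
  set z : ℕ → ℝ := fun k => (if k ∈ u then (1 : ℝ) else 0) - m k with hz
  have hz0 : z 0 = 0 := by simp [hz, hu, hm0]
  have hinc : ∀ k ∈ Finset.Icc 1 n, coeff r n k * increment r u k
      = coeff r n k * z k + (coeff r n k * r k) * z (halfPred k) := by
    intro k hk
    have := hm k (Finset.mem_Icc.1 hk).1
    simp only [hz, increment]
    rw [this]
    split_ifs <;> ring
  rw [Finset.sum_congr rfl hinc, Finset.sum_add_distrib,
    sum_mul_halfPred (fun k => coeff r n k * r k) z hz0, sum_Icc_half_eq, sum_Icc_half_eq,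
    ← Finset.sum_sub_distrib, ← Finset.sum_sub_distrib, ← Finset.sum_add_distrib,
    ← Finset.sum_add_distrib]
  refine Finset.sum_congr rfl fun k hk => ?_
  rw [coeff_eq r n k (Finset.mem_Icc.1 hk).1]
  simp only [hz]
  split_ifs <;> ring

/-- A one-step bound for the conditional probabilities. -/
lemma weight_le (r : ℕ → unitInterval) {p Λ : ℝ} (hp0 : 0 < p) (hp1 : p < 1)
    (hΛp : Real.exp (-Λ) = p) (hΛq : Real.exp (-(3 / 2 * Λ)) = 1 - p)
    (u : Finset ℕ) (k : ℕ) (hr : (r k : ℝ) ≤ 1 - p) :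
    weight r u k ≤ Real.exp (-Λ * (1 + (if k ∈ u then (1 : ℝ) else 0) / 2
        - (if halfPred k ∈ u then (1 : ℝ) else 0))
      + ((1 - p - r k) / (p * (1 - p)) * (1 - p - r k)
        - (1 - p - r k) / (p * (1 - p)) * increment r u k)) := by
  have hr0 := (r k).2.1
  have hq : 0 < 1 - p := by linarith
  have hpq : 0 < p * (1 - p) := by positivity
  have hθ : 0 ≤ 1 - p - (r k : ℝ) := by linarith
  unfold weight increment
  by_cases hy : halfPred k ∈ u
  · by_cases hx : k ∈ u
    · simp only [hx, hy, if_true]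
      exact (Real.exp_pos _).le
    · simp only [hx, hy, if_true, if_false]
      refine Real.one_le_exp ?_
      have : 0 ≤ (1 - p - r k) / (p * (1 - p)) * (1 - p - r k) := by positivity
      linarith
  · by_cases hx : k ∈ u
    · simp only [hx, hy, if_true, if_false]
      have e1 : -Λ * (1 + 1 / 2 - 0) + ((1 - p - r k) / (p * (1 - p)) * (1 - p - r k)
          - (1 - p - r k) / (p * (1 - p)) * (1 - r k))
          = -(3 / 2 * Λ) + -((1 - p - r k) / (1 - p)) := by
        field_simp
        ring
      rw [e1, Real.exp_add, hΛq]
      have := Real.add_one_le_exp (-((1 - p - (r k : ℝ)) / (1 - p)))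
      calc (r k : ℝ) = (1 - p) * (-((1 - p - (r k : ℝ)) / (1 - p)) + 1) := by
            field_simp; ring
        _ ≤ _ := mul_le_mul_of_nonneg_left this hq.le
    · simp only [hx, hy, if_false]
      have e1 : -Λ * (1 + 0 / 2 - 0) + ((1 - p - r k) / (p * (1 - p)) * (1 - p - r k)
          - (1 - p - r k) / (p * (1 - p)) * (0 - r k))
          = -Λ + (1 - p - r k) / p := by
        field_simp
        ring
      rw [e1, Real.exp_add, hΛp]
      have := Real.add_one_le_exp ((1 - p - (r k : ℝ)) / p)
      calc (1 - r k : ℝ) = p * ((1 - p - (r k : ℝ)) / p + 1) := by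
            field_simp; ring
        _ ≤ _ := mul_le_mul_of_nonneg_left this hp0.le

/-- The coefficients of the martingale part of the logarithm of the mass of a word. -/
def massCoeff (r : ℕ → unitInterval) (p Λ : ℝ) (n k : ℕ) : ℝ :=
  -Λ * coeff r n k - (1 - p - r k) / (p * (1 - p))

lemma abs_massCoeff_le (r : ℕ → unitInterval) {p Λ : ℝ} (hp0 : 0 < p) (hp1 : p < 1) (hΛ : 0 ≤ Λ)
    (hr : ∀ k, (r k : ℝ) ≤ 1 - p) (n k : ℕ) :
    |massCoeff r p Λ n k| ≤ Λ * (1 / (2 * p)) + 1 / p := by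
  have h1 := abs_coeff_le r (by linarith : 1 - p < 1) hr n k
  rw [sub_sub_cancel] at h1
  have hq : 0 < 1 - p := by linarith
  have h2 : |(1 - p - r k) / (p * (1 - p))| ≤ 1 / p := by
    rw [abs_of_nonneg (div_nonneg (by linarith [hr k]) (by positivity)), div_le_div_iff₀
      (by positivity) hp0]
    nlinarith [(r k).2.1]
  unfold massCoeff
  refine (abs_sub _ _).trans (add_le_add ?_ h2)
  rw [abs_mul, abs_neg, abs_of_nonneg hΛ]
  exact mul_le_mul_of_nonneg_left h1 hΛ

/-- Upper bound for the mass of a word. -/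
lemma prod_weight_le (r : ℕ → unitInterval) (m : ℕ → ℝ) (hm0 : m 0 = 0)
    (hm : ∀ k, 0 < k → m k = r k * (1 - m (halfPred k))) {p Λ : ℝ} (hp0 : 0 < p) (hp1 : p < 1)
    (hΛp : Real.exp (-Λ) = p) (hΛq : Real.exp (-(3 / 2 * Λ)) = 1 - p)
    (hr : ∀ k, (r k : ℝ) ≤ 1 - p) (n : ℕ) (u : Finset ℕ) (hu : 0 ∉ u) :
    ∏ k ∈ Finset.Icc 1 n, weight r u k ≤ Real.exp (-Λ * n
      - Λ * (∑ k ∈ Finset.Icc 1 n, m k / 2 - ∑ k ∈ Finset.Icc 1 (n / 2), m k)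
      + (∑ k ∈ Finset.Icc 1 n, (1 - p - r k) ^ 2) / (p * (1 - p))
      + ∑ k ∈ Finset.Icc 1 n, massCoeff r p Λ n k * increment r u k) := by
  refine (Finset.prod_le_prod (fun k _ => weight_nonneg r u k)
    fun k _ => weight_le r hp0 hp1 hΛp hΛq u k (hr k)).trans ?_
  rw [← Real.exp_sum]
  refine Real.exp_le_exp.2 (le_of_eq ?_)
  have hT := sum_half_sub_eq r m hm0 hm n u hu
  have hy := sum_halfPred (fun k => if k ∈ u then (1 : ℝ) else 0) (by simp [hu]) n
  rw [Finset.sum_add_distrib, Finset.sum_sub_distrib, ← Finset.mul_sum, Finset.sum_sub_distrib,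
    Finset.sum_add_distrib, hy]
  simp only [massCoeff, sub_mul, Finset.sum_sub_distrib, mul_assoc, ← Finset.mul_sum, pow_two,
    div_mul_eq_mul_div, ← Finset.sum_div]
  simp only [Finset.sum_const, Nat.card_Icc, nsmul_eq_mul, mul_one, Nat.add_sub_cancel]
  simp only [← Finset.sum_div] at hT
  linear_combination (-Λ) * hT

/-- The means of the digits under the measure of maximal dimension. -/
def baseMean (q : ℝ) : ℕ → ℝ
  | 0 => 0
  | k + 1 => q * (1 - baseMean q (halfPred (k + 1)))
termination_by k => k
decreasing_by exact halfPred_lt k.succ_pos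

lemma baseMean_zero (q : ℝ) : baseMean q 0 = 0 := by rw [baseMean]

lemma baseMean_pos_eq (q : ℝ) {k : ℕ} (hk : 0 < k) :
    baseMean q k = q * (1 - baseMean q (halfPred k)) := by
  obtain ⟨k, rfl⟩ := Nat.exists_eq_succ_of_ne_zero hk.ne'
  rw [baseMean]

lemma baseMean_mem {q : ℝ} (hq0 : 0 ≤ q) (hq1 : q ≤ 1) (k : ℕ) :
    0 ≤ baseMean q k ∧ baseMean q k ≤ q := by
  induction k using Nat.strong_induction_on with
  | _ k ih =>
    rcases Nat.eq_zero_or_pos k with rfl | hk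
    · simp [baseMean_zero, hq0]
    · rw [baseMean_pos_eq q hk]
      obtain ⟨h1, h2⟩ := ih _ (halfPred_lt hk)
      constructor
      · exact mul_nonneg hq0 (by linarith)
      · exact mul_le_of_le_one_right hq0 (by linarith)

lemma sum_baseMean (q : ℝ) (n : ℕ) :
    ∑ k ∈ Finset.Icc 1 n, baseMean q k
      = q * n - q * ∑ k ∈ Finset.Icc 1 (n / 2), baseMean q k := by
  rw [← sum_halfPred _ (baseMean_zero q), Finset.mul_sum,
    Finset.sum_congr rfl fun k hk => baseMean_pos_eq q (Finset.mem_Icc.1 hk).1]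
  simp [mul_sub, Finset.sum_sub_distrib]
  ring

/-- The limiting frequency of ones. -/
def frequency (q : ℝ) : ℝ := 2 * q / (2 + q)

lemma frequency_pos {q : ℝ} (hq0 : 0 < q) : 0 < frequency q := by
  unfold frequency; positivity

lemma frequency_le_one {q : ℝ} (hq0 : 0 < q) (hq1 : q ≤ 1) : frequency q ≤ 1 := by
  unfold frequency
  rw [div_le_one (by linarith)]
  linarith

lemma frequency_eq {q : ℝ} (hq0 : 0 < q) : frequency q = q - q * frequency q / 2 := by
  unfold frequency
  field_simp
  ring

lemma natCast_half (n : ℕ) : (n : ℝ) / 2 - 1 / 2 ≤ ((n / 2 : ℕ) : ℝ) ∧ ((n / 2 : ℕ) : ℝ) ≤ n / 2 := by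
  have h1 : n ≤ 2 * (n / 2) + 1 := by omega
  have h2 : 2 * (n / 2) ≤ n := by omega
  have h1' : (n : ℝ) ≤ 2 * ((n / 2 : ℕ) : ℝ) + 1 := by exact_mod_cast h1
  have h2' : 2 * ((n / 2 : ℕ) : ℝ) ≤ n := by exact_mod_cast h2
  constructor <;> linarith

lemma abs_sum_baseMean_sub_le {q : ℝ} (hq0 : 0 < q) (hq1 : q < 1) (n : ℕ) :
    |∑ k ∈ Finset.Icc 1 n, (baseMean q k - frequency q)| ≤ 1 / (1 - q) := by
  have hq : 0 < 1 - q := by linarith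
  induction n using Nat.strong_induction_on with
  | _ n ih =>
    rcases Nat.eq_zero_or_pos n with rfl | hn
    · simp; linarith
    · have h := ih (n / 2) (by omega)
      have ha := frequency_eq hq0
      have hhalf := natCast_half n
      rw [Finset.sum_sub_distrib] at h ⊢
      simp only [Finset.sum_const, Nat.card_Icc, nsmul_eq_mul, Nat.add_sub_cancel] at h ⊢
      rw [sum_baseMean]
      set S := ∑ k ∈ Finset.Icc 1 (n / 2), baseMean q k
      have e : q * n - q * S - n * frequency q
          = -(q * (S - ((n / 2 : ℕ) : ℝ) * frequency q))
            + q * (frequency q * (n / 2 - ((n / 2 : ℕ) : ℝ))) := by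
        linear_combination (-(n : ℝ)) * ha
      have hf1 := frequency_le_one hq0 hq1.le
      have hf0 := frequency_pos hq0
      have h3 : 0 ≤ frequency q * (n / 2 - ((n / 2 : ℕ) : ℝ)) :=
        mul_nonneg hf0.le (by linarith [hhalf.2])
      have h4 : frequency q * (n / 2 - ((n / 2 : ℕ) : ℝ)) ≤ 1 / 2 := by
        nlinarith [hhalf.1, hhalf.2]
      have h5 : q * (1 / (1 - q)) + 1 = 1 / (1 - q) := by field_simp; ring
      rw [e]
      rw [abs_le] at h ⊢
      constructor <;> nlinarith [h.1, h.2]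

/-- The relative perturbation of the means at position `k`. -/
def drift (ε : ℝ) (k : ℕ) : ℝ := ε / (Nat.log 2 k + 1)

lemma drift_nonneg {ε : ℝ} (hε : 0 ≤ ε) (k : ℕ) : 0 ≤ drift ε k := by
  unfold drift; positivity

lemma drift_antitone {ε : ℝ} (hε : 0 ≤ ε) : Antitone (drift ε) := by
  intro a b hab
  have : (Nat.log 2 a : ℝ) ≤ Nat.log 2 b := by exact_mod_cast Nat.log_mono_right hab
  unfold drift
  exact div_le_div_of_nonneg_left hε (by positivity) (by linarith)

lemma drift_zero (ε : ℝ) : drift ε 0 = ε := by simp [drift]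

lemma drift_le {ε : ℝ} (hε : 0 ≤ ε) (k : ℕ) : drift ε k ≤ ε :=
  (drift_antitone hε k.zero_le).trans (drift_zero ε).le

lemma natLog_two_mul {k : ℕ} (hk : 0 < k) : Nat.log 2 (2 * k) = Nat.log 2 k + 1 := by
  rw [mul_comm, Nat.log_mul_base (by norm_num) hk.ne']

lemma drift_le_two_mul {ε : ℝ} (hε : 0 ≤ ε) {k : ℕ} (hk : 0 < k) :
    drift ε k ≤ 2 * drift ε (2 * k) := by
  unfold drift
  rw [natLog_two_mul hk, ← mul_div_assoc, div_le_div_iff₀ (by positivity) (by positivity)]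
  push_cast
  nlinarith [mul_nonneg hε (Nat.cast_nonneg (α := ℝ) (Nat.log 2 k))]

/-- The perturbed means. -/
def mean (q ε : ℝ) (k : ℕ) : ℝ := baseMean q k * (1 - drift ε k)

lemma exists_probability {p ε : ℝ} (hp0 : 0 < p) (hp1 : p < 1) (hε0 : 0 ≤ ε) (hε1 : ε ≤ 1) :
    ∃ r : ℕ → unitInterval, (∀ k, (r k : ℝ) ≤ 1 - p) ∧
      (∀ k, 0 < k → mean (1 - p) ε k = r k * (1 - mean (1 - p) ε (halfPred k))) ∧
      ∀ k, 0 < k → 1 - p - r k ≤ (1 + 2 / p) * drift ε k := by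
  have hq0 : 0 ≤ 1 - p := by linarith
  have hf := baseMean_mem hq0 (by linarith)
  have hη0 := drift_nonneg hε0
  have hη1 : ∀ k, drift ε k ≤ 1 := fun k => (drift_le hε0 k).trans hε1
  have hm0 : ∀ k, 0 ≤ mean (1 - p) ε k := fun k =>
    mul_nonneg (hf k).1 (by linarith [hη1 k])
  have hmf : ∀ k, mean (1 - p) ε k ≤ baseMean (1 - p) k := fun k =>
    mul_le_of_le_one_right (hf k).1 (by linarith [hη0 k])
  have hden : ∀ k, p ≤ 1 - mean (1 - p) ε k := fun k => by linarith [hmf k, (hf k).2]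
  have hle : ∀ k, mean (1 - p) ε k / (1 - mean (1 - p) ε (halfPred k)) ≤ 1 - p := by
    intro k
    rw [div_le_iff₀ (by linarith [hden (halfPred k)])]
    rcases Nat.eq_zero_or_pos k with rfl | hk
    · rw [halfPred_zero]
      simp [mean, baseMean_zero, hp1.le]
    · refine (hmf k).trans ?_
      rw [baseMean_pos_eq _ hk]
      exact mul_le_mul_of_nonneg_left (by linarith [hmf (halfPred k)]) hq0
  refine ⟨fun k => ⟨mean (1 - p) ε k / (1 - mean (1 - p) ε (halfPred k)),
    div_nonneg (hm0 k) (by linarith [hden (halfPred k)]), (hle k).trans (by linarith)⟩,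
    hle, fun k _ => ?_, fun k hk => ?_⟩
  · have := hden (halfPred k)
    rw [div_mul_cancel₀]
    linarith
  · have hd := hden (halfPred k)
    have hd' : 0 < 1 - mean (1 - p) ε (halfPred k) := by linarith
    show 1 - p - mean (1 - p) ε k / (1 - mean (1 - p) ε (halfPred k)) ≤ _
    rw [sub_le_iff_le_add, ← sub_le_iff_le_add', le_div_iff₀ hd']
    have hprev : baseMean (1 - p) (halfPred k) * drift ε (halfPred k)
        ≤ baseMean (1 - p) (halfPred k) * (2 * drift ε k) := by
      by_cases he : Even k
      · obtain ⟨j, rfl⟩ := he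
        rw [← two_mul, halfPred_two_mul]
        exact mul_le_mul_of_nonneg_left (drift_le_two_mul hε0 (by omega)) (hf _).1
      · simp [halfPred, he, baseMean_zero]
    have h1 : (1 + 2 / p) * drift ε k * p ≤
        (1 + 2 / p) * drift ε k * (1 - mean (1 - p) ε (halfPred k)) :=
      mul_le_mul_of_nonneg_left hd (by have := hη0 k; positivity)
    have h2 : (1 + 2 / p) * drift ε k * p = (p + 2) * drift ε k := by field_simp
    have hb := hf (halfPred k)
    have hη := hη0 k
    have h3 : mean (1 - p) ε k = (1 - p) * (1 - baseMean (1 - p) (halfPred k)) * (1 - drift ε k) := by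
      rw [mean, baseMean_pos_eq _ hk]
    have h4 : mean (1 - p) ε (halfPred k) = baseMean (1 - p) (halfPred k)
      - baseMean (1 - p) (halfPred k) * drift ε (halfPred k) := by rw [mean]; ring
    set f := baseMean (1 - p) (halfPred k)
    set η := drift ε k
    set fη' := f * drift ε (halfPred k)
    set m' := mean (1 - p) ε (halfPred k)
    have h5 : f * η ≤ η := mul_le_of_le_one_left hη (by linarith)
    have h6 : (1 - p) * (1 - m') - mean (1 - p) ε k ≤ (1 - p) * (2 * η) := by
      rw [h3, h4]
      nlinarith
    have h7 : (1 - p) * (2 * η) ≤ 2 * η := mul_le_of_le_one_left (by linarith) (by linarith)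
    have h8 : 0 ≤ p * η := by positivity
    nlinarith

/-- Abel summation bound. -/
lemma abs_sum_mul_antitone_le (d η : ℕ → ℝ) (hη : Antitone η) (hη0 : ∀ k, 0 ≤ η k) {K : ℝ}
    (hd : ∀ n, |∑ k ∈ Finset.Icc 1 n, d k| ≤ K) (n : ℕ) :
    |∑ k ∈ Finset.Icc 1 n, d k * η k| ≤ K * η 0 := by
  have key : |∑ k ∈ Finset.Icc 1 n, d k * η k - (∑ k ∈ Finset.Icc 1 n, d k) * η n|
      ≤ K * (η 0 - η n) := by
    induction n with
    | zero => simp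
    | succ n ih =>
      rw [Finset.sum_Icc_succ_top (by omega), Finset.sum_Icc_succ_top (by omega)]
      have e : ∑ k ∈ Finset.Icc 1 n, d k * η k + d (n + 1) * η (n + 1)
          - (∑ k ∈ Finset.Icc 1 n, d k + d (n + 1)) * η (n + 1)
          = (∑ k ∈ Finset.Icc 1 n, d k * η k - (∑ k ∈ Finset.Icc 1 n, d k) * η n)
            + (∑ k ∈ Finset.Icc 1 n, d k) * (η n - η (n + 1)) := by ring
      have h1 : 0 ≤ η n - η (n + 1) := by linarith [hη n.le_succ]
      rw [e]
      refine (abs_add_le _ _).trans ?_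
      rw [abs_mul, abs_of_nonneg h1]
      nlinarith [mul_le_mul_of_nonneg_right (hd n) h1]
  have h2 : |(∑ k ∈ Finset.Icc 1 n, d k) * η n| ≤ K * η n := by
    rw [abs_mul, abs_of_nonneg (hη0 n)]
    exact mul_le_mul_of_nonneg_right (hd n) (hη0 n)
  rw [abs_le] at key h2 ⊢
  constructor <;> linarith

lemma le_sum_drift_sub {ε δ : ℝ} (hε : 0 ≤ ε) (j : ℕ)
    (hδ : ∀ i ∈ Finset.Icc 1 j, δ ≤ drift ε i - drift ε (2 * i)) :
    j * δ / 2 ≤ ∑ k ∈ Finset.Icc 1 j, drift ε k - (∑ k ∈ Finset.Icc 1 (2 * j), drift ε k) / 2 := by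
  induction j with
  | zero => simp
  | succ j ih =>
    have h1 := ih fun i hi => hδ i (Finset.Icc_subset_Icc_right (by omega) hi)
    have h2 := hδ (j + 1) (by simp)
    have h3 : drift ε (2 * j + 1) ≤ drift ε (j + 1) := drift_antitone hε (by omega)
    rw [show 2 * (j + 1) = 2 * j + 1 + 1 by ring] at h2 ⊢
    rw [Finset.sum_Icc_succ_top (by omega), Finset.sum_Icc_succ_top (by omega),
      Finset.sum_Icc_succ_top (by omega)]
    push_cast
    linarith

lemma le_sum_drift_half_sub {ε : ℝ} (hε0 : 0 ≤ ε) (hε1 : ε ≤ 1) (n : ℕ) :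
    ε * n / (8 * ((Nat.log 2 n : ℝ) + 1) ^ 2) - 1 ≤
      ∑ k ∈ Finset.Icc 1 (n / 2), drift ε k - (∑ k ∈ Finset.Icc 1 n, drift ε k) / 2 := by
  set L : ℝ := (Nat.log 2 n : ℝ) with hL
  have hL0 : 0 ≤ L := by positivity
  have hδ : ∀ i ∈ Finset.Icc 1 (n / 2),
      ε / (2 * (L + 1) ^ 2) ≤ drift ε i - drift ε (2 * i) := by
    intro i hi
    rw [Finset.mem_Icc] at hi
    have hl : (Nat.log 2 i : ℝ) ≤ L := by
      rw [hL]; exact_mod_cast Nat.log_mono_right (by omega)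
    unfold drift
    rw [natLog_two_mul hi.1]
    push_cast
    set l : ℝ := (Nat.log 2 i : ℝ)
    have hl0 : 0 ≤ l := by positivity
    have e : ε / (l + 1) - ε / (l + 1 + 1) = ε / ((l + 1) * (l + 1 + 1)) := by
      field_simp; ring
    rw [e]
    exact div_le_div_of_nonneg_left hε0 (by positivity) (by nlinarith)
  have h1 := le_sum_drift_sub hε0 (n / 2) hδ
  have h2 : ∑ k ∈ Finset.Icc 1 n, drift ε k ≤ ∑ k ∈ Finset.Icc 1 (2 * (n / 2)), drift ε k + 1 := by
    rcases Nat.even_or_odd' n with ⟨j, hj | hj⟩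
    · rw [show 2 * (n / 2) = n by omega]; linarith
    · rw [show 2 * (n / 2) = 2 * j by omega, hj, Finset.sum_Icc_succ_top (by omega)]
      linarith [drift_le hε0 (2 * j + 1)]
  have h3 := (natCast_half n).1
  have h4 : 0 ≤ ε / (2 * (L + 1) ^ 2) := by positivity
  have h5 : ε / (2 * (L + 1) ^ 2) ≤ 1 := by
    rw [div_le_one (by positivity)]; nlinarith
  have h6 : ε * n / (8 * (L + 1) ^ 2) = n / 4 * (ε / (2 * (L + 1) ^ 2)) := by
    field_simp; ring
  rw [h6]
  nlinarith [mul_le_mul_of_nonneg_right h3 h4]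

/-- The expected frequency of ones grows enough along doublings. -/
lemma le_sum_mean_half_sub {q ε : ℝ} (hq0 : 0 < q) (hq1 : q < 1) (hε0 : 0 ≤ ε) (hε1 : ε ≤ 1)
    (n : ℕ) :
    frequency q * ε / 8 * (n / ((Nat.log 2 n : ℝ) + 1) ^ 2) - (3 / (1 - q) + 1) ≤
      ∑ k ∈ Finset.Icc 1 n, mean q ε k / 2 - ∑ k ∈ Finset.Icc 1 (n / 2), mean q ε k := by
  have hE := abs_sum_baseMean_sub_le hq0 hq1
  have hB := abs_sum_mul_antitone_le (fun k => baseMean q k - frequency q) (drift ε)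
    (drift_antitone hε0) (drift_nonneg hε0) hE
  have hH := le_sum_drift_half_sub hε0 hε1 n
  have hf0 := frequency_pos hq0
  have hf1 := frequency_le_one hq0 hq1.le
  have hK : 0 < 1 / (1 - q) := one_div_pos.2 (by linarith)
  have hKε : 1 / (1 - q) * ε ≤ 1 / (1 - q) := mul_le_of_le_one_right hK.le hε1
  have hsplit : ∀ N : ℕ, ∑ k ∈ Finset.Icc 1 N, mean q ε k =
      ∑ k ∈ Finset.Icc 1 N, (baseMean q k - frequency q) + N * frequency q
      - ∑ k ∈ Finset.Icc 1 N, (baseMean q k - frequency q) * drift ε k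
      - frequency q * ∑ k ∈ Finset.Icc 1 N, drift ε k := by
    intro N
    rw [Finset.mul_sum]
    have : (N : ℝ) * frequency q = ∑ k ∈ Finset.Icc 1 N, frequency q := by simp
    rw [this]
    simp only [← Finset.sum_add_distrib, ← Finset.sum_sub_distrib]
    exact Finset.sum_congr rfl fun k _ => by rw [mean]; ring
  rw [← Finset.sum_div, hsplit, hsplit]
  have hE1 := abs_le.1 (hE n)
  have hE2 := abs_le.1 (hE (n / 2))
  have hB1 := abs_le.1 (hB n)
  have hB2 := abs_le.1 (hB (n / 2))
  rw [drift_zero] at hB1 hB2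
  have hhalf := mul_le_mul_of_nonneg_right (natCast_half n).2 hf0.le
  have hH' := mul_le_mul_of_nonneg_left hH hf0.le
  have e : frequency q * ε / 8 * (n / ((Nat.log 2 n : ℝ) + 1) ^ 2)
      = frequency q * (ε * n / (8 * ((Nat.log 2 n : ℝ) + 1) ^ 2)) := by
    field_simp
  have e3 : 3 / (1 - q) = 3 * (1 / (1 - q)) := by ring
  rw [e, e3]
  linarith [hE1.1, hE1.2, hE2.1, hE2.2, hB1.1, hB1.2, hB2.1, hB2.2]

lemma sum_block_le (L : ℕ) :
    ∑ k ∈ Finset.Ico 1 (2 ^ (L + 1)), 1 / ((Nat.log 2 k : ℝ) + 1) ^ 2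
      ≤ 9 * (2 ^ L / ((L : ℝ) + 1) ^ 2) := by
  have hblock : ∀ L : ℕ, ∑ k ∈ Finset.Ico (2 ^ L) (2 ^ (L + 1)), 1 / ((Nat.log 2 k : ℝ) + 1) ^ 2
      = 2 ^ L / ((L : ℝ) + 1) ^ 2 := by
    intro L
    have : ∀ k ∈ Finset.Ico (2 ^ L) (2 ^ (L + 1)), 1 / ((Nat.log 2 k : ℝ) + 1) ^ 2
        = 1 / ((L : ℝ) + 1) ^ 2 := by
      intro k hk
      rw [Finset.mem_Ico] at hk
      rw [Nat.log_eq_of_pow_le_of_lt_pow hk.1 hk.2]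
    rw [Finset.sum_congr rfl this, Finset.sum_const, Nat.card_Ico, pow_succ, mul_two,
      Nat.add_sub_cancel, nsmul_eq_mul]
    push_cast
    ring
  induction L with
  | zero => norm_num
  | succ L ih =>
    rw [← Finset.sum_Ico_consecutive _ (Nat.one_le_two_pow (n := L + 1))
      (Nat.pow_le_pow_right (by norm_num) (Nat.le_succ (L + 1))), hblock]
    rcases Nat.lt_or_ge L 2 with hL | hL
    · interval_cases L
      · have h1 := hblock 0
        norm_num at h1 ⊢
      · have h1 := hblock 0
        have h2 := hblock 1
        rw [← Finset.sum_Ico_consecutive _ (show 1 ≤ 2 by norm_num) (show 2 ≤ 2 ^ (1 + 1) by norm_num)]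
        norm_num at h1 h2 ⊢
        linarith
    · have hL' : (2 : ℝ) ≤ L := by exact_mod_cast hL
      have h2 : (0 : ℝ) < 2 ^ L := by positivity
      have h3 : 9 * (2 ^ L / ((L : ℝ) + 1) ^ 2) ≤ 16 * (2 ^ L / ((L : ℝ) + 2) ^ 2) := by
        rw [← mul_div_assoc, ← mul_div_assoc, div_le_div_iff₀ (by positivity) (by positivity)]
        nlinarith [mul_le_mul_of_nonneg_left
          (show 9 * ((L : ℝ) + 2) ^ 2 ≤ 16 * ((L : ℝ) + 1) ^ 2 by nlinarith) h2.le]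
      have e1 : ((L + 1 : ℕ) : ℝ) + 1 = (L : ℝ) + 2 := by push_cast; ring
      rw [e1]
      have e2 : (2 : ℝ) ^ (L + 1) / ((L : ℝ) + 2) ^ 2 = 2 * (2 ^ L / ((L : ℝ) + 2) ^ 2) := by ring
      rw [e2]
      linarith

lemma sum_inv_log_sq_le (n : ℕ) :
    ∑ k ∈ Finset.Icc 1 n, 1 / ((Nat.log 2 k : ℝ) + 1) ^ 2
      ≤ 9 * (n / ((Nat.log 2 n : ℝ) + 1) ^ 2) := by
  rcases Nat.eq_zero_or_pos n with rfl | hn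
  · simp
  refine le_trans (Finset.sum_le_sum_of_subset_of_nonneg (fun k hk => ?_)
    (fun _ _ _ => by positivity)) ((sum_block_le (Nat.log 2 n)).trans ?_)
  · rw [Finset.mem_Icc] at hk
    exact Finset.mem_Ico.2 ⟨hk.1, hk.2.trans_lt (Nat.lt_pow_succ_log_self (by norm_num) n)⟩
  · have : (2 : ℝ) ^ Nat.log 2 n ≤ n := by exact_mod_cast Nat.pow_log_le_self 2 hn.ne'
    gcongr

lemma natLog_add_one_le {n : ℕ} (hn : 3 ≤ n) : (Nat.log 2 n : ℝ) + 1 ≤ 3 * Real.log n := by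
  have hn0 : (0 : ℝ) < n := by positivity
  have h1 : 1 ≤ Real.log n := by
    rw [Real.le_log_iff_exp_le hn0]
    have : (3 : ℝ) ≤ n := by exact_mod_cast hn
    linarith [Real.exp_one_lt_d9]
  have h2 : (Nat.log 2 n : ℝ) * Real.log 2 ≤ Real.log n := by
    rw [← Real.log_pow]
    refine Real.log_le_log (by positivity) ?_
    exact_mod_cast Nat.pow_log_le_self 2 (by omega)
  have h3 := Real.log_two_gt_d9
  have h4 : (0 : ℝ) ≤ Nat.log 2 n := by positivity
  nlinarith

lemma eventually_mul_log_pow_le (C : ℝ) (hC : 0 ≤ C) (j : ℕ) :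
    ∀ᶠ n : ℕ in Filter.atTop, C * ((Nat.log 2 n : ℝ) + 1) ^ j * Real.log n ≤ n := by
  have h := (Real.isLittleO_pow_log_id_atTop (n := j + 1)).comp_tendsto
    (tendsto_natCast_atTop_atTop (R := ℝ))
  have hc : (0 : ℝ) < 1 / (C * 3 ^ j + 1) := by positivity
  filter_upwards [h.bound hc, Filter.eventually_ge_atTop 3] with n hn h3
  have hlog : 0 ≤ Real.log n := Real.log_natCast_nonneg n
  simp only [Function.comp_apply, id_eq, norm_pow, Real.norm_of_nonneg hlog] at hn
  rw [Real.norm_of_nonneg (by positivity), one_div, inv_mul_eq_div,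
    le_div_iff₀ (by positivity)] at hn
  have h1 : ((Nat.log 2 n : ℝ) + 1) ^ j ≤ (3 * Real.log n) ^ j :=
    pow_le_pow_left₀ (by positivity) (natLog_add_one_le h3) j
  calc C * ((Nat.log 2 n : ℝ) + 1) ^ j * Real.log n
      ≤ C * (3 * Real.log n) ^ j * Real.log n := by gcongr
    _ = Real.log n ^ (j + 1) * (C * 3 ^ j) := by ring
    _ ≤ Real.log n ^ (j + 1) * (C * 3 ^ j + 1) := by
        have := pow_nonneg hlog (j + 1)
        nlinarith
    _ ≤ n := hn

lemma tendsto_div_log_sq :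
    Filter.Tendsto (fun n : ℕ => (n : ℝ) / ((Nat.log 2 n : ℝ) + 1) ^ 2)
      Filter.atTop Filter.atTop := by
  rw [Filter.tendsto_atTop]
  intro b
  filter_upwards [eventually_mul_log_pow_le |b| (abs_nonneg b) 2, Filter.eventually_ge_atTop 3]
    with n hn h3
  have hn0 : (0 : ℝ) < n := by positivity
  have h1 : 1 ≤ Real.log n := by
    rw [Real.le_log_iff_exp_le hn0]
    have : (3 : ℝ) ≤ n := by exact_mod_cast h3
    linarith [Real.exp_one_lt_d9]
  rw [le_div_iff₀ (by positivity)]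
  have h2 : 0 ≤ |b| * ((Nat.log 2 n : ℝ) + 1) ^ 2 := by positivity
  have h4 : b * ((Nat.log 2 n : ℝ) + 1) ^ 2 ≤ |b| * ((Nat.log 2 n : ℝ) + 1) ^ 2 :=
    mul_le_mul_of_nonneg_right (le_abs_self b) (by positivity)
  nlinarith

lemma tsum_ofReal_exp_ne_top {c : ℝ} (hc : 0 < c) :
    ∑' n : ℕ, ENNReal.ofReal (Real.exp (-(c * (n / ((Nat.log 2 n : ℝ) + 1) ^ 4)))) ≠ ⊤ := by
  have hs : Summable fun n : ℕ => Real.exp (-(c * (n / ((Nat.log 2 n : ℝ) + 1) ^ 4))) := by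
    refine summable_of_isBigO_nat (Real.summable_one_div_nat_pow.2 one_lt_two) ?_
    refine Asymptotics.IsBigO.of_bound 1 ?_
    filter_upwards [eventually_mul_log_pow_le (2 / c) (by positivity) 4,
      Filter.eventually_ge_atTop 1] with n hn h1
    have hn0 : (0 : ℝ) < n := by exact_mod_cast h1
    rw [Real.norm_of_nonneg (Real.exp_pos _).le, Real.norm_of_nonneg (by positivity), one_mul,
      Real.exp_neg, one_div]
    refine inv_anti₀ (by positivity) ?_
    rw [← Real.log_le_iff_le_exp (by positivity), Real.log_pow, ← mul_div_assoc,
      le_div_iff₀ (by positivity)]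
    have := mul_le_mul_of_nonneg_left hn hc.le
    push_cast
    calc _ = c * (2 / c * ((Nat.log 2 n : ℝ) + 1) ^ 4 * Real.log n) := by field_simp
      _ ≤ _ := this
  exact hs.tsum_ofReal_ne_top

/-- Words have small mass, up to a martingale term. -/
lemma exists_prod_weight_le {p Λ : ℝ} (hp0 : 0 < p) (hp1 : p < 1) (hΛ : 0 < Λ)
    (hΛp : Real.exp (-Λ) = p) (hΛq : Real.exp (-(3 / 2 * Λ)) = 1 - p) :
    ∃ κ > 0, ∃ C : ℝ, ∃ r : ℕ → unitInterval, (∀ k, (r k : ℝ) ≤ 1 - p) ∧ ∀ n u, 0 ∉ u →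
      ∏ k ∈ Finset.Icc 1 n, weight r u k ≤ Real.exp (-Λ * n
        - 3 * κ * (n / ((Nat.log 2 n : ℝ) + 1) ^ 2) + C
        + ∑ k ∈ Finset.Icc 1 n, massCoeff r p Λ n k * increment r u k) := by
  have hq : 0 < 1 - p := by linarith
  have ha := frequency_pos hq
  set Q := Λ * (frequency (1 - p) / 8) with hQ
  set R := 9 * (1 + 2 / p) ^ 2 / (p * (1 - p)) with hR
  have hQ0 : 0 < Q := by positivity
  have hR0 : 0 < R := by positivity
  set ε := min 1 (Q / (2 * R)) with hε
  have hε0 : 0 < ε := by positivity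
  have hε1 : ε ≤ 1 := min_le_left _ _
  have hεQ : R * ε ≤ Q / 2 := by
    have h : ε ≤ Q / (2 * R) := min_le_right _ _
    rw [le_div_iff₀ (by positivity)] at h
    linarith
  obtain ⟨r, hr, hm, hdiff⟩ := exists_probability hp0 hp1 hε0.le hε1
  refine ⟨Q * ε / 6, by positivity, Λ * (3 / p + 1), r, hr, fun n u hu => ?_⟩
  refine (prod_weight_le r (mean (1 - p) ε) (by simp [mean, baseMean_zero]) hm hp0 hp1 hΛp hΛq hr n
    u hu).trans (Real.exp_le_exp.2 ?_)
  have hgain := mul_le_mul_of_nonneg_left (le_sum_mean_half_sub hq (by linarith) hε0.le hε1 n) hΛ.le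
  rw [sub_sub_cancel] at hgain
  have hpen : (∑ k ∈ Finset.Icc 1 n, (1 - p - r k) ^ 2) / (p * (1 - p))
      ≤ R * ε * (ε * (n / ((Nat.log 2 n : ℝ) + 1) ^ 2)) := by
    have h1 : ∑ k ∈ Finset.Icc 1 n, (1 - p - (r k : ℝ)) ^ 2 ≤
        (1 + 2 / p) ^ 2 * ε ^ 2 * ∑ k ∈ Finset.Icc 1 n, 1 / ((Nat.log 2 k : ℝ) + 1) ^ 2 := by
      rw [Finset.mul_sum]
      refine Finset.sum_le_sum fun k hk => ?_
      refine (pow_le_pow_left₀ (by linarith [hr k]) (hdiff k (Finset.mem_Icc.1 hk).1) 2).trans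
        (le_of_eq ?_)
      rw [drift]
      field_simp
    have h2 := h1.trans (mul_le_mul_of_nonneg_left (sum_inv_log_sq_le n) (by positivity))
    rw [div_le_iff₀ (by positivity)]
    refine h2.trans (le_of_eq ?_)
    rw [hR]
    field_simp
  have hP : 0 ≤ ε * (n / ((Nat.log 2 n : ℝ) + 1) ^ 2) := by positivity
  have h3 := mul_le_mul_of_nonneg_right hεQ hP
  set P := (n : ℝ) / ((Nat.log 2 n : ℝ) + 1) ^ 2
  have e1 : Λ * (frequency (1 - p) * ε / 8 * P - (3 / p + 1))
      = Q * (ε * P) - Λ * (3 / p + 1) := by rw [hQ]; ring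
  rw [e1] at hgain
  linarith

/-- For almost every admissible sequence, cylinders have small mass. -/
theorem exists_tossMeasure_cylinder_le {p Λ : ℝ} (hp0 : 0 < p) (hp1 : p < 1) (hΛ : 0 < Λ)
    (hΛp : Real.exp (-Λ) = p) (hΛq : Real.exp (-(3 / 2 * Λ)) = 1 - p) :
    ∃ κ > 0, ∃ r : ℕ → unitInterval, ∀ᵐ ω ∂tossMeasure r, ∀ᶠ n in Filter.atTop,
      tossMeasure r {ω' | digitSet ω' n = digitSet ω n} ≤
        ENNReal.ofReal (Real.exp (-Λ * n - κ * (n / ((Nat.log 2 n : ℝ) + 1) ^ 2))) := by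
  obtain ⟨κ, hκ, C, r, hr, hw⟩ := exists_prod_weight_le hp0 hp1 hΛ hΛp hΛq
  refine ⟨κ, hκ, r, ?_⟩
  set K := max κ (Λ * (1 / (2 * p)) + 1 / p) with hK
  have hK0 : 0 < K := hκ.trans_le (le_max_left _ _)
  have hβ : ∀ n k, |massCoeff r p Λ n k| ≤ K := fun n k =>
    (abs_massCoeff_le r hp0 hp1 hΛ.le hr n k).trans (le_max_right _ _)
  set bad : ℕ → Set (ℕ → Bool) := fun n => {ω | κ * (n / ((Nat.log 2 n : ℝ) + 1) ^ 2) <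
    ∑ k ∈ Finset.Icc 1 n, massCoeff r p Λ n k * increment r (digitSet ω n) k} with hbad
  have hbound : ∀ n, tossMeasure r (bad n) ≤ ENNReal.ofReal (Real.exp
      (-(κ ^ 2 / (4 * K ^ 2) * (n / ((Nat.log 2 n : ℝ) + 1) ^ 4)))) := by
    intro n
    have hL : (1 : ℝ) ≤ ((Nat.log 2 n : ℝ) + 1) ^ 2 :=
      one_le_pow₀ (by linarith [Nat.cast_nonneg (α := ℝ) (Nat.log 2 n)])
    set l := κ / (2 * K ^ 2 * ((Nat.log 2 n : ℝ) + 1) ^ 2) with hl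
    have hl0 : 0 ≤ l := by positivity
    have hlK : l * K ≤ 1 := by
      rw [hl, div_mul_eq_mul_div, div_le_one (by positivity)]
      have h1 : κ * K ≤ K ^ 2 := by
        rw [pow_two]; exact mul_le_mul_of_nonneg_right (le_max_left _ _) hK0.le
      nlinarith [mul_le_mul_of_nonneg_left hL (sq_nonneg K), sq_nonneg K]
    refine (tossMeasure_increment_sum_gt_le r (massCoeff r p Λ n) (hβ n) hl0 hlK n _).trans
      (ENNReal.ofReal_le_ofReal (Real.exp_le_exp.2 (le_of_eq ?_)))
    rw [hl]
    field_simp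
    ring
  have hsum : ∑' n, tossMeasure r (bad n) ≠ ⊤ :=
    ((ENNReal.tsum_le_tsum hbound).trans_lt
      (tsum_ofReal_exp_ne_top (by positivity)).lt_top).ne
  filter_upwards [ae_eventually_notMem hsum] with ω hω
  filter_upwards [hω, tendsto_div_log_sq.eventually_ge_atTop (C / κ)] with n hn hC
  refine (tossMeasure_digitSet_le r n _).trans (ENNReal.ofReal_le_ofReal ?_)
  refine (hw n _ (by simp [mem_digitSet])).trans (Real.exp_le_exp.2 ?_)
  simp only [hbad, Set.mem_ofPred_eq, not_lt] at hn
  rw [div_le_iff₀ hκ] at hC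
  linarith

/-- The real number with binary digits `digit ω`. -/
def value (ω : ℕ → Bool) : ℝ := ∑' k : ℕ, ((digit ω (k + 1)).toNat : ℝ) / 2 ^ (k + 1)

lemma value_mem_XiG (ω : ℕ → Bool) : value ω ∈ XiG := by
  refine ⟨fun k => (digit ω k).toNat, fun k _ => ?_, fun k hk => ?_, rfl⟩
  · cases h : digit ω k <;> simp [h]
  · have h := digit_pos ω (k := 2 * k) (by omega)
    rw [halfPred_two_mul] at h
    cases h' : digit ω k <;> simp [h, h']

/-- The integer whose binary digits are the first `n` digits. -/
def prefixInt (ω : ℕ → Bool) : ℕ → ℕ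
  | 0 => 0
  | n + 1 => 2 * prefixInt ω n + (digit ω (n + 1)).toNat

lemma sum_digit_eq_prefixInt (ω : ℕ → Bool) (n : ℕ) :
    ∑ k ∈ Finset.range n, ((digit ω (k + 1)).toNat : ℝ) / 2 ^ (k + 1) = prefixInt ω n / 2 ^ n := by
  induction n with
  | zero => simp [prefixInt]
  | succ n ih =>
    rw [Finset.sum_range_succ, ih, prefixInt]
    push_cast
    field_simp
    ring

lemma digitSet_eq_of_prefixInt_eq {ω ω' : ℕ → Bool} {n : ℕ}
    (h : prefixInt ω n = prefixInt ω' n) : digitSet ω n = digitSet ω' n := by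
  have key : ∀ k, 1 ≤ k → k ≤ n → digit ω k = digit ω' k := by
    induction n with
    | zero => intro k h1 h2; omega
    | succ n ih =>
      simp only [prefixInt] at h
      have hd : digit ω (n + 1) = digit ω' (n + 1) := by
        cases h1 : digit ω (n + 1) <;> cases h2 : digit ω' (n + 1) <;>
          simp [h1, h2] at h ⊢ <;> omega
      intro k h1 h2
      rcases h2.lt_or_eq with h2 | rfl
      · exact ih (by rw [hd] at h; omega) k h1 (by omega)
      · exact hd
  ext k
  simp only [mem_digitSet, and_congr_right_iff]
  intro hk
  rw [key k hk.1 hk.2]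

lemma prefixInt_bounds (ω : ℕ → Bool) (n : ℕ) :
    (prefixInt ω n : ℝ) ≤ 2 ^ n * value ω ∧ 2 ^ n * value ω ≤ prefixInt ω n + 1 := by
  have hle : ∀ k, ((digit ω (k + 1)).toNat : ℝ) / 2 ^ (k + 1) ≤ 1 / 2 / 2 ^ k := fun k => by
    have h1 : ((digit ω (k + 1)).toNat : ℝ) ≤ 1 := by exact_mod_cast Bool.toNat_le _
    rw [pow_succ', ← div_div]
    gcongr
  have hs : Summable fun k => ((digit ω (k + 1)).toNat : ℝ) / 2 ^ (k + 1) :=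
    Summable.of_nonneg_of_le (fun k => by positivity) hle (summable_geometric_two' 1)
  have hsplit := hs.sum_add_tsum_nat_add n
  rw [sum_digit_eq_prefixInt] at hsplit
  have h0 : 0 ≤ ∑' k, ((digit ω (k + n + 1)).toNat : ℝ) / 2 ^ (k + n + 1) :=
    tsum_nonneg fun k => by positivity
  have h1 : ∑' k, ((digit ω (k + n + 1)).toNat : ℝ) / 2 ^ (k + n + 1) ≤ 1 / 2 ^ n := by
    rw [← tsum_geometric_two' (1 / 2 ^ n : ℝ)]
    refine ((summable_nat_add_iff n).2 hs).tsum_le_tsum (fun k => (hle (k + n)).trans_eq ?_)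
      (summable_geometric_two' _)
    rw [pow_add]
    field_simp
  have hv : 2 ^ n * value ω = prefixInt ω n +
      2 ^ n * ∑' k, ((digit ω (k + n + 1)).toNat : ℝ) / 2 ^ (k + n + 1) := by
    rw [value, ← hsplit]
    field_simp
  have h2 : (2 : ℝ) ^ n * (1 / 2 ^ n) = 1 := by field_simp
  have h3 := mul_le_mul_of_nonneg_left h1 (by positivity : (0 : ℝ) ≤ 2 ^ n)
  have h4 : 0 ≤ (2 : ℝ) ^ n * ∑' k, ((digit ω (k + n + 1)).toNat : ℝ) / 2 ^ (k + n + 1) := by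
    positivity
  constructor <;> linarith

/-- A set of sequences whose values lie within `2 ^ (-n)` meets at most three cylinders of
length `n`. -/
lemma measure_le_of_value_dist_le (μ : Measure (ℕ → Bool)) {n : ℕ} {A : Set (ℕ → Bool)}
    {B : ENNReal} (hB : ∀ ω ∈ A, μ {ω' | digitSet ω' n = digitSet ω n} ≤ B)
    (hA : ∀ ω ∈ A, ∀ ω' ∈ A, |value ω - value ω'| ≤ 1 / 2 ^ n) : μ A ≤ 3 * B := by
  rcases A.eq_empty_or_nonempty with rfl | hne
  · simp
  obtain ⟨ω₀, h₀, hmin⟩ := exists_minimalFor_of_wellFoundedLT (· ∈ A) (prefixInt · n) hne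
  have hcover : A ⊆ ⋃ i ∈ Finset.range 3, {ω ∈ A | prefixInt ω n = prefixInt ω₀ n + i} := by
    intro ω hω
    have h1 : prefixInt ω₀ n ≤ prefixInt ω n := by
      rcases le_total (prefixInt ω₀ n) (prefixInt ω n) with h | h
      · exact h
      · exact hmin hω h
    have h2 : prefixInt ω n ≤ prefixInt ω₀ n + 2 := by
      have h3 := (prefixInt_bounds ω n).1
      have h4 := (prefixInt_bounds ω₀ n).2
      have h5 := (abs_le.1 (hA ω hω ω₀ h₀)).2
      have h6 := mul_le_mul_of_nonneg_left h5 (by positivity : (0 : ℝ) ≤ 2 ^ n)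
      have h7 : (2 : ℝ) ^ n * (1 / 2 ^ n) = 1 := by field_simp
      have : (prefixInt ω n : ℝ) ≤ prefixInt ω₀ n + 2 := by linarith
      exact_mod_cast this
    simp only [Set.mem_iUnion, Finset.mem_range, exists_prop]
    exact ⟨prefixInt ω n - prefixInt ω₀ n, by omega, hω, by omega⟩
  refine (measure_mono hcover).trans ((measure_biUnion_finset_le _ _).trans ?_)
  refine (Finset.sum_le_card_nsmul _ _ B fun i _ => ?_).trans_eq (by simp)
  rcases {ω ∈ A | prefixInt ω n = prefixInt ω₀ n + i}.eq_empty_or_nonempty with h | ⟨ω₁, h₁⟩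
  · simp [h]
  · refine (measure_mono fun ω hω => ?_).trans (hB ω₁ h₁.1)
    exact digitSet_eq_of_prefixInt_eq (hω.2.trans h₁.2.symm)

lemma eventually_exp_le_mul_gauge {p Λ κ c : ℝ} (hΛp : Real.exp (-Λ) = p)
    (hκ : 0 < κ) (hc0 : 0 < c) (hc : c < κ * Real.log 2 / 64) {φ : ℝ → ℝ} {t₀ : ℝ} (ht₀ : 0 < t₀)
    (hφ : ∀ t ∈ Set.Ioo (0 : ℝ) t₀, φ t = t ^ (-Real.logb 2 p) *
      Real.exp (-c * |Real.log t| / (Real.log |Real.log t|) ^ 2)) {ρ : ℝ} (hρ : 0 < ρ) :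
    ∀ᶠ n : ℕ in Filter.atTop,
      Real.exp (-Λ * n - κ * (n / ((Nat.log 2 n : ℝ) + 1) ^ 2)) ≤ ρ * φ (1 / 2 ^ (n + 1)) := by
  have hsmall : ∀ᶠ n : ℕ in Filter.atTop, (1 / 2 : ℝ) ^ (n + 1) < t₀ :=
    ((tendsto_pow_atTop_nhds_zero_of_lt_one (by norm_num) (by norm_num)).comp
      (Filter.tendsto_add_atTop_nat 1)).eventually_lt_const ht₀
  filter_upwards [hsmall, Filter.eventually_ge_atTop 2,
    tendsto_div_log_sq.eventually_ge_atTop ((Λ - Real.log ρ) / (κ / 2))] with n hn h2 hP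
  have hl2 : 0.69 < Real.log 2 := by linarith [Real.log_two_gt_d9]
  have hn0 : (2 : ℝ) ≤ n := by exact_mod_cast h2
  set X : ℝ := (n + 1) * Real.log 2 with hX
  have hX0 : 0 < X := by positivity
  set L : ℝ := (Nat.log 2 n : ℝ) with hL
  have hlogt : Real.log (1 / 2 ^ (n + 1)) = -X := by
    rw [one_div, Real.log_inv, Real.log_pow]
    push_cast
    rfl
  have habs : |Real.log (1 / 2 ^ (n + 1))| = X := by rw [hlogt, abs_neg, abs_of_pos hX0]
  have hlp : Real.log p = -Λ := by rw [← hΛp, Real.log_exp]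
  rw [hφ _ ⟨by positivity, by simpa [one_div, inv_pow] using hn⟩, habs,
    Real.rpow_def_of_pos (by positivity), hlogt]
  have hpow : -X * -Real.logb 2 p = -Λ * (n + 1) := by
    rw [Real.logb, hlp, hX]
    field_simp
  rw [hpow, ← Real.exp_add, ← Real.exp_log hρ, ← Real.exp_add, Real.exp_le_exp]
  have hL1 : 1 ≤ L := by
    have : 1 ≤ Nat.log 2 n := Nat.log_pos one_lt_two h2
    rw [hL]
    exact_mod_cast this
  have hlogn : L * Real.log 2 ≤ Real.log n := by
    rw [← Real.log_pow]
    refine Real.log_le_log (by positivity) ?_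
    exact_mod_cast Nat.pow_log_le_self 2 (by omega)
  have hlogX : Real.log n ≤ 2 * Real.log X := by
    have h := Real.log_pow X 2
    push_cast at h
    rw [← h]
    refine Real.log_le_log (by linarith) ?_
    have h69 : (n + 1) * 0.69 ≤ X := by rw [hX]; gcongr
    have hsq := pow_le_pow_left₀ (by positivity) h69 2
    nlinarith [sq_nonneg ((n : ℝ) - 1)]
  have hlow : (L + 1) * Real.log 2 / 4 ≤ Real.log X := by nlinarith
  have hlow0 : 0 < (L + 1) * Real.log 2 / 4 := by positivity
  have hmain : c * X / Real.log X ^ 2 ≤ κ / 2 * (n / (L + 1) ^ 2) := by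
    calc c * X / Real.log X ^ 2 ≤ c * X / ((L + 1) * Real.log 2 / 4) ^ 2 := by gcongr
      _ = c * (n + 1) * 16 / Real.log 2 / (L + 1) ^ 2 := by rw [hX]; field_simp; norm_num
      _ ≤ κ / 2 * n / (L + 1) ^ 2 := by
          gcongr
          rw [div_le_iff₀ (by positivity)]
          nlinarith
      _ = _ := by ring
  rw [div_le_iff₀ (by positivity)] at hP
  have : -c * X / Real.log X ^ 2 = -(c * X / Real.log X ^ 2) := by ring
  rw [this]
  linarith

/-- Mass distribution principle: if the mass of small sets is negligible with respect to the gauge,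
then sets of finite gauge measure are null. -/
lemma measure_inter_preimage_eq_zero {Ω : Type*} [MeasurableSpace Ω] (μ : Measure Ω) (f : Ω → ℝ)
    {φ : ℝ → ℝ} {A : Set Ω} {S : Set ℝ}
    (h : ∀ ρ > (0 : ℝ), ∃ δ > (0 : ENNReal), ∀ U : Set ℝ, Metric.ediam U ≤ δ →
      μ (A ∩ f ⁻¹' U) ≤ ENNReal.ofReal ρ * ENNReal.ofReal (φ (Metric.ediam U).toReal))
    (hS : gaugeMeasure φ S < ⊤) : μ (A ∩ f ⁻¹' S) = 0 := by
  set M := gaugeMeasure φ S + 1 with hM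
  have hMtop : M ≠ ⊤ := by simp [hM, hS.ne]
  have key : ∀ ρ > (0 : ℝ), μ (A ∩ f ⁻¹' S) ≤ ENNReal.ofReal ρ * M := by
    intro ρ hρ
    obtain ⟨δ, hδ, hU⟩ := h ρ hρ
    have hlt : gaugeMeasure φ S < M := ENNReal.lt_add_right hS.ne one_ne_zero
    have hle := hlt
    rw [gaugeMeasure, Measure.mkMetric_apply] at hle
    have hδle := (le_iSup₂ (α := ENNReal) δ hδ).trans_lt hle
    simp only [iInf_lt_iff] at hδle
    obtain ⟨t, hcov, hdiam, hsum⟩ := hδle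
    calc μ (A ∩ f ⁻¹' S) ≤ μ (⋃ n, A ∩ f ⁻¹' t n) := by
          refine measure_mono fun x hx => ?_
          obtain ⟨n, hn⟩ := Set.mem_iUnion.1 (hcov hx.2)
          exact Set.mem_iUnion.2 ⟨n, hx.1, hn⟩
      _ ≤ ∑' n, μ (A ∩ f ⁻¹' t n) := measure_iUnion_le _
      _ ≤ ∑' n, ENNReal.ofReal ρ * ⨆ _ : (t n).Nonempty,
            ENNReal.ofReal (φ (Metric.ediam (t n)).toReal) := by
          refine ENNReal.tsum_le_tsum fun n => ?_
          rcases (t n).eq_empty_or_nonempty with he | hne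
          · simp [he]
          · simpa [hne] using hU (t n) (hdiam n)
      _ ≤ ENNReal.ofReal ρ * M := by
          rw [ENNReal.tsum_mul_left]
          gcongr
  have hlim : Filter.Tendsto (fun ρ : ℝ => ENNReal.ofReal ρ * M) (nhdsWithin 0 (Set.Ioi 0))
      (nhds 0) := by
    have h1 : Filter.Tendsto (fun ρ : ℝ => ENNReal.ofReal ρ) (nhdsWithin 0 (Set.Ioi 0))
        (nhds 0) := by
      simpa using (ENNReal.continuous_ofReal.tendsto 0).mono_left nhdsWithin_le_nhds
    simpa using ENNReal.Tendsto.mul_const h1 (Or.inr hMtop)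
  exact le_antisymm (ge_of_tendsto hlim (eventually_mem_nhdsWithin.mono key)) zero_le

lemma exists_measure_inter_preimage_le (μ : Measure (ℕ → Bool)) {φ : ℝ → ℝ} (hφ : IsGauge φ)
    {b : ℕ → ℝ} (hb0 : Filter.Tendsto b Filter.atTop (nhds 0))
    (hb : ∀ ρ > (0 : ℝ), ∀ᶠ n in Filter.atTop, b n ≤ ρ * φ (1 / 2 ^ (n + 1)))
    {A : Set (ℕ → Bool)} {N : ℕ}
    (hA : ∀ ω ∈ A, ∀ n ≥ N, μ {ω' | digitSet ω' n = digitSet ω n} ≤ ENNReal.ofReal (b n))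
    {ρ : ℝ} (hρ : 0 < ρ) :
    ∃ δ > (0 : ENNReal), ∀ U : Set ℝ, Metric.ediam U ≤ δ →
      μ (A ∩ value ⁻¹' U) ≤ ENNReal.ofReal ρ * ENNReal.ofReal (φ (Metric.ediam U).toReal) := by
  obtain ⟨M, hM⟩ := Filter.eventually_atTop.1 (hb (ρ / 3) (by positivity))
  refine ⟨ENNReal.ofReal ((1 / 2) ^ max M N), ENNReal.ofReal_pos.2 (by positivity),
    fun U hU => ?_⟩
  have hfin : Metric.ediam U ≠ ⊤ := (hU.trans_lt ENNReal.ofReal_lt_top).ne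
  set D := (Metric.ediam U).toReal with hD
  have hDle : D ≤ (1 / 2) ^ max M N := ENNReal.toReal_le_of_le_ofReal (by positivity) hU
  have hdist : ∀ n ≥ N, D ≤ (1 / 2) ^ n →
      μ (A ∩ value ⁻¹' U) ≤ 3 * ENNReal.ofReal (b n) := by
    intro n hn hDn
    refine measure_le_of_value_dist_le μ (fun ω hω => hA ω hω.1 n hn) fun ω hω ω' hω' => ?_
    rw [← Real.dist_eq, dist_edist, one_div, ← inv_pow, ← one_div]
    exact (ENNReal.toReal_mono hfin (Metric.edist_le_ediam_of_mem hω.2 hω'.2)).trans hDn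
  rcases (ENNReal.toReal_nonneg : 0 ≤ D).eq_or_lt with h0 | h0
  · have hlim : Filter.Tendsto (fun n => 3 * ENNReal.ofReal (b n)) Filter.atTop (nhds 0) := by
      have h1 := ENNReal.tendsto_ofReal hb0
      simpa using ENNReal.Tendsto.const_mul h1 (Or.inr (by simp : (3 : ENNReal) ≠ ⊤))
    have hle : μ (A ∩ value ⁻¹' U) ≤ 0 := by
      refine ge_of_tendsto hlim ?_
      filter_upwards [Filter.eventually_ge_atTop N] with n hn
      exact hdist n hn (h0.symm.trans_le (by positivity))
    exact hle.trans zero_le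
  · obtain ⟨n, hn1, hn2⟩ := exists_nat_pow_near_of_lt_one h0
      (hDle.trans (pow_le_one₀ (by norm_num) (by norm_num))) (by norm_num : (0 : ℝ) < 1 / 2)
      (by norm_num)
    have hn : max M N < n + 1 :=
      (pow_lt_pow_iff_right_of_lt_one₀ (by norm_num : (0 : ℝ) < 1 / 2) (by norm_num)).1
        (hn1.trans_le hDle)
    have hmono : φ (1 / 2 ^ (n + 1)) ≤ φ D :=
      hφ.2.2.monotoneOn (Set.mem_Ici.2 (by positivity)) (Set.mem_Ici.2 h0.le)
        (by rw [← one_div_pow]; exact hn1.le)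
    refine (hdist n (by omega) hn2).trans ?_
    have h3 : (3 : ENNReal) = ENNReal.ofReal 3 := by simp
    rw [h3, ← ENNReal.ofReal_mul (by norm_num), ← ENNReal.ofReal_mul hρ.le]
    refine ENNReal.ofReal_le_ofReal ?_
    have := hM n (by omega)
    nlinarith

/-- The multiplicative golden mean shift is not covered by countably many sets of finite measure. -/
lemma not_subset_iUnion {φ : ℝ → ℝ} (hφ : IsGauge φ) (μ : Measure (ℕ → Bool))
    [IsProbabilityMeasure μ] {b : ℕ → ℝ} (hb0 : Filter.Tendsto b Filter.atTop (nhds 0))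
    (hb : ∀ ρ > (0 : ℝ), ∀ᶠ n in Filter.atTop, b n ≤ ρ * φ (1 / 2 ^ (n + 1)))
    (hμ : ∀ᵐ ω ∂μ, ∀ᶠ n in Filter.atTop,
      μ {ω' | digitSet ω' n = digitSet ω n} ≤ ENNReal.ofReal (b n))
    (S : ℕ → Set ℝ) (hS : ∀ n, gaugeMeasure φ (S n) < ⊤) : ¬ XiG ⊆ ⋃ n, S n := by
  intro hcov
  set A : ℕ → Set (ℕ → Bool) := fun N => {ω | ∀ n ≥ N,
    μ {ω' | digitSet ω' n = digitSet ω n} ≤ ENNReal.ofReal (b n)} with hA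
  have hnull : ∀ N i, μ (A N ∩ value ⁻¹' S i) = 0 := fun N i =>
    measure_inter_preimage_eq_zero μ value (fun ρ hρ =>
      exists_measure_inter_preimage_le μ hφ hb0 hb (A := A N) (N := N) (fun ω hω => hω) hρ) (hS i)
  have hnone : ∀ᵐ ω ∂μ, ω ∉ ⋃ N, ⋃ i, A N ∩ value ⁻¹' S i :=
    measure_eq_zero_iff_ae_notMem.1
      (measure_iUnion_null fun N => measure_iUnion_null fun i => hnull N i)
  obtain ⟨ω, hω, hω'⟩ := (hμ.and hnone).exists
  obtain ⟨N, hN⟩ := Filter.eventually_atTop.1 hω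
  obtain ⟨i, hi⟩ := Set.mem_iUnion.1 (hcov (value_mem_XiG ω))
  exact hω' (Set.mem_iUnion.2 ⟨N, Set.mem_iUnion.2 ⟨i, hN, hi⟩⟩)

end GoldenMeanShift

/-- There is a `c₀ > 0` such that for every `c ∈ (0, c₀)` and every gauge function `φ` agreeing
with `t ↦ t^s · exp(-c·|log t|/(log|log t|)²)` near `0` (where `s = -log₂ p`), the generalized
Hausdorff measure `H^φ` of `Ξ_G` is infinite, and moreover `Ξ_G` is not σ-finite
with respect to `H^φ`. -/
theorem gaugeMeasure_XiG_infinite (p : ℝ) (hp : p ∈ Set.Ioo (0 : ℝ) 1)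
    (hpe : p ^ 3 = (1 - p) ^ 2) :
    ∃ c₀ > (0 : ℝ), ∀ c ∈ Set.Ioo (0 : ℝ) c₀, ∀ φ : ℝ → ℝ, IsGauge φ →
      (∃ t₀ > (0 : ℝ), ∀ t ∈ Set.Ioo (0 : ℝ) t₀,
        φ t = t ^ (-Real.logb 2 p) *
          Real.exp (-c * |Real.log t| / (Real.log |Real.log t|) ^ 2)) →
      gaugeMeasure φ XiG = ⊤ ∧
        ¬ ∃ S : ℕ → Set ℝ, XiG ⊆ ⋃ n, S n ∧ ∀ n, gaugeMeasure φ (S n) < ⊤ := by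
  obtain ⟨hp0, hp1⟩ := hp
  obtain ⟨Λ, hΛdef⟩ : ∃ Λ, Λ = -Real.log p := ⟨_, rfl⟩
  have hΛ : 0 < Λ := by
    rw [hΛdef]
    exact neg_pos.2 (Real.log_neg hp0 hp1)
  have hΛp : Real.exp (-Λ) = p := by rw [hΛdef, neg_neg, Real.exp_log hp0]
  have hΛq : Real.exp (-(3 / 2 * Λ)) = 1 - p := by
    refine (pow_left_inj₀ (Real.exp_pos _).le (sub_nonneg.2 hp1.le) two_ne_zero).1 ?_
    rw [← hpe, ← hΛp, ← Real.exp_nat_mul, ← Real.exp_nat_mul]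
    congr 1
    push_cast
    ring
  obtain ⟨κ, hκ, r, hr⟩ := GoldenMeanShift.exists_tossMeasure_cylinder_le hp0 hp1 hΛ hΛp hΛq
  refine ⟨κ * Real.log 2 / 64, by have := Real.log_pos one_lt_two; positivity, ?_⟩
  rintro c ⟨hc0, hc⟩ φ hφ ⟨t₀, ht₀, hφt⟩
  have hlim : Filter.Tendsto (fun n : ℕ =>
      Real.exp (-Λ * n - κ * (n / ((Nat.log 2 n : ℝ) + 1) ^ 2))) Filter.atTop (nhds 0) := by
    refine Real.tendsto_exp_atBot.comp (Filter.tendsto_atBot_mono (fun n => ?_)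
      (tendsto_natCast_atTop_atTop.const_mul_atTop_of_neg (neg_neg_of_pos hΛ)))
    exact sub_le_self _ (by positivity)
  have hnot := GoldenMeanShift.not_subset_iUnion hφ (GoldenMeanShift.tossMeasure r) hlim
    (fun ρ hρ => GoldenMeanShift.eventually_exp_le_mul_gauge hΛp hκ hc0 hc ht₀ hφt hρ) hr
  refine ⟨?_, fun ⟨S, hcov, hS⟩ => hnot S hS hcov⟩
  by_contra h
  exact hnot (fun _ => XiG) (fun _ => lt_top_iff_ne_top.2 h)
    (Set.subset_iUnion_of_subset 0 subset_rfl)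

end
end
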